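/- arXiv:math/0509553 — 3 statements merged into one kernel-verified Lean document; each statement's English description precedes it below -/
import Mathlib

section
/- For every u > 0 belonging to the topological support of μ and satisfying μ̄(u) > 0, one has ψ_μ(u) < ∞ and ∫₀^{ψ_μ(u)} n([φ_μ(s),∞)) ds = log(1/μ̄(u)). (This is the analytic identity expressing that the stopping time T = inf{t : F_t ≥ φ_μ(L_t)} of the embedding theorem for positive functionals satisfies P(F_T ≥ u) = μ̄(u).) -/
open MeasureTheory Filter
open scoped ENNReal Topology Classical

/-- Topological support of a Borel measure on ℝ. -/
def measSupport (μ : MeasureTheory.Measure ℝ) : Set ℝ :=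
  {x | ∀ U : Set ℝ, IsOpen U → x ∈ U → 0 < μ U}

/-- The dual Hardy–Littlewood function `ψ_μ` of `μ` relative to `n`:
`ψ_μ(y) = ∫_{(0,y)} 1_{μ({s})=0} [μ̄(s)·n([s,∞))]⁻¹ dμ(s)
          + Σ_{0<s<y, μ({s})>0} log(μ̄(s)/μ̄(s+)) / n([s,∞))`,
with values in `[0,∞]` (and `ψ_μ(y) = 0` for `y ≤ 0`). -/
noncomputable def dualHL (μ n : MeasureTheory.Measure ℝ) (y : ℝ) : ℝ≥0∞ :=
  (∫⁻ s in Set.Ioo (0 : ℝ) y,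
      Set.indicator {t : ℝ | μ {t} = 0}
        (fun t => (μ (Set.Ici t) * n (Set.Ici t))⁻¹) s ∂μ)
  + ∑' s : {t : ℝ // 0 < t ∧ t < y ∧ 0 < μ {t}},
      ENNReal.ofReal
          (Real.log ((μ (Set.Ici (s : ℝ))).toReal / (μ (Set.Ioi (s : ℝ))).toReal))
        / n (Set.Ici (s : ℝ))

/-- The set `{y > 0 : ψ_μ(y) > l}` whose infimum is the right-continuous inverse
`φ_μ(l) = inf{y > 0 : ψ_μ(y) > l}` (with `inf ∅ = ∞`). -/
def phiHLSet (μ n : MeasureTheory.Measure ℝ) (l : ℝ≥0∞) : Set ℝ :=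
  {y : ℝ | 0 < y ∧ l < dualHL μ n y}

/-- `n([φ_μ(l),∞))`, with the convention that it equals `0` when `φ_μ(l) = inf ∅ = ∞`. -/
noncomputable def nPhiHL (μ n : MeasureTheory.Measure ℝ) (l : ℝ≥0∞) : ℝ≥0∞ :=
  if (phiHLSet μ n l).Nonempty then n (Set.Ici (sInf (phiHLSet μ n l))) else 0

noncomputable def qf (D : ℝ → ℝ≥0∞) (l : ℝ≥0∞) : ℝ := sInf {y : ℝ | 0 < y ∧ l < D y}

lemma qf_bdd (D : ℝ → ℝ≥0∞) (l : ℝ≥0∞) : BddBelow {y : ℝ | 0 < y ∧ l < D y} :=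
  ⟨0, fun _ hy => hy.1.le⟩

lemma exists_lt_Iio (m : Measure ℝ) (hm0 : m (Set.Iic 0) = 0) (y : ℝ) (l : ℝ≥0∞)
    (h : l < m (Set.Iio y)) : ∃ z, 0 < z ∧ z < y ∧ l < m (Set.Iio z) := by
  have hy : 0 < y := by
    by_contra hy
    have : m (Set.Iio y) ≤ m (Set.Iic 0) := measure_mono (fun x hx => by
      simp only [Set.mem_Iio, Set.mem_Iic] at *; linarith)
    rw [hm0] at this
    exact absurd (h.trans_le this) (by simp)
  obtain ⟨v, hv1, hv2, hv3⟩ := exists_seq_strictMono_tendsto' hy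
  have hU : Set.Iio y = ⋃ k, Set.Iio (v k) := by
    ext x
    simp only [Set.mem_Iio, Set.mem_iUnion]
    constructor
    · intro hx
      exact ((tendsto_order.1 hv3).1 x hx).exists
    · rintro ⟨k, hk⟩
      exact hk.trans (hv2 k).2
  have ht := tendsto_measure_iUnion_atTop (μ := m) (s := fun k => Set.Iio (v k))
    (fun a b hab => Set.Iio_subset_Iio (hv1.monotone hab))
  rw [← hU] at ht
  obtain ⟨k, hk⟩ := ((tendsto_order.1 ht).1 l h).exists
  exact ⟨v k, (hv2 k).1, (hv2 k).2, hk⟩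

lemma qf_lt_iff (m : Measure ℝ) (hm0 : m (Set.Iic 0) = 0) (u : ℝ) (D : ℝ → ℝ≥0∞)
    (hD : ∀ y, 0 < y → y ≤ u → D y = m (Set.Iio y)) (l : ℝ≥0∞) (hu : 0 < u) (hl : l < D u)
    (y : ℝ) (hy : 0 < y) (hyu : y ≤ u) : qf D l < y ↔ l < m (Set.Iio y) := by
  constructor
  · intro h
    obtain ⟨z, hz, hzy⟩ := exists_lt_of_csInf_lt (s := {y : ℝ | 0 < y ∧ l < D y}) ⟨u, hu, hl⟩ h
    have := hz.2
    rw [hD z hz.1 (hzy.le.trans hyu)] at this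
    exact this.trans_le (measure_mono (Set.Iio_subset_Iio hzy.le))
  · intro h
    obtain ⟨z, hz, hzy, hlz⟩ := exists_lt_Iio m hm0 y l h
    refine lt_of_le_of_lt (csInf_le (qf_bdd D l) ⟨hz, ?_⟩) hzy
    rwa [hD z hz (hzy.le.trans hyu)]

lemma Iio_eq_univ (m : Measure ℝ) (u : ℝ) (hmu : m (Set.Ici u) = 0) :
    m (Set.Iio u) = m Set.univ := by
  apply le_antisymm (measure_mono (Set.subset_univ _))
  rw [← Set.Iio_union_Ici (a := u)]
  exact (measure_union_le _ _).trans (by simp [hmu])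

lemma mem_lt (m : Measure ℝ) [IsFiniteMeasure m] (u : ℝ)
    (D : ℝ → ℝ≥0∞) (hu : 0 < u) (hmu : m (Set.Ici u) = 0)
    (hD : ∀ y, 0 < y → y ≤ u → D y = m (Set.Iio y)) (s : ℝ)
    (hs : s ∈ Set.Ioo 0 (m Set.univ).toReal) : ENNReal.ofReal s < D u := by
  rw [hD u hu le_rfl, Iio_eq_univ m u hmu]
  rw [← ENNReal.ofReal_toReal (measure_ne_top m Set.univ)]
  exact (ENNReal.ofReal_lt_ofReal_iff (hs.1.trans hs.2)).2 hs.2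

lemma qf_aemeas (m : Measure ℝ) [IsFiniteMeasure m] (u : ℝ)
    (D : ℝ → ℝ≥0∞) (hu : 0 < u) (hmu : m (Set.Ici u) = 0)
    (hD : ∀ y, 0 < y → y ≤ u → D y = m (Set.Iio y)) :
    AEMeasurable (fun s : ℝ => qf D (ENNReal.ofReal s))
      (volume.restrict (Set.Ioo 0 (m Set.univ).toReal)) := by
  apply aemeasurable_restrict_of_monotoneOn measurableSet_Ioo
  intro a ha b hb hab
  refine csInf_le_csInf (s := {y : ℝ | 0 < y ∧ ENNReal.ofReal b < D y}) (qf_bdd D _)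
    ⟨u, hu, mem_lt m u D hu hmu hD b hb⟩ ?_
  intro y hy
  exact ⟨hy.1, (ENNReal.ofReal_le_ofReal hab).trans_lt hy.2⟩

lemma qf_map (m : Measure ℝ) [IsFiniteMeasure m] (hm0 : m (Set.Iic 0) = 0) (u : ℝ)
    (D : ℝ → ℝ≥0∞) (hu : 0 < u) (hmu : m (Set.Ici u) = 0)
    (hD : ∀ y, 0 < y → y ≤ u → D y = m (Set.Iio y)) :
    Measure.map (fun s : ℝ => qf D (ENNReal.ofReal s))
      (volume.restrict (Set.Ioo 0 (m Set.univ).toReal)) = m := by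
  have hae := qf_aemeas m u D hu hmu hD
  symm
  apply Measure.ext_of_Ici
  intro y
  rw [Measure.map_apply_of_aemeasurable hae measurableSet_Ici]
  rw [Measure.restrict_apply' measurableSet_Ioo]
  rcases le_or_gt y 0 with hy | hy
  · have h1 : m (Set.Ici y) = m Set.univ := by
      apply le_antisymm (measure_mono (Set.subset_univ _))
      rw [← Set.Iic_union_Ici (a := (0:ℝ))]
      refine (measure_union_le _ _).trans ?_
      rw [hm0, zero_add]
      exact measure_mono (Set.Ici_subset_Ici.2 hy)
    rw [h1, Set.inter_eq_right.2]
    · simp [ENNReal.ofReal_toReal (measure_ne_top m Set.univ)]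
    · intro s hs
      exact hy.trans (Real.sInf_nonneg (fun z hz => hz.1.le))
  rcases le_or_gt y u with hyu | hyu
  · have h1 : m (Set.Ici y) = m Set.univ - m (Set.Iio y) := by
      rw [← Set.compl_Iio, measure_compl measurableSet_Iio (measure_ne_top _ _)]
    have key : ∀ s ∈ Set.Ioo 0 (m Set.univ).toReal,
        (y ≤ qf D (ENNReal.ofReal s) ↔ (m (Set.Iio y)).toReal ≤ s) := by
      intro s hs
      rw [← not_lt, qf_lt_iff m hm0 u D hD _ hu (mem_lt m u D hu hmu hD s hs) y hy hyu, not_lt,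
        ENNReal.le_ofReal_iff_toReal_le (measure_ne_top _ _) hs.1.le]
    have h2 : volume (Set.Ioo (m (Set.Iio y)).toReal (m Set.univ).toReal) = m (Set.Ici y) := by
      rw [Real.volume_Ioo, h1, ENNReal.ofReal_sub _ ENNReal.toReal_nonneg,
        ENNReal.ofReal_toReal (measure_ne_top _ _), ENNReal.ofReal_toReal (measure_ne_top _ _)]
    have h3 : volume (Set.Ico (m (Set.Iio y)).toReal (m Set.univ).toReal) = m (Set.Ici y) := by
      rw [← h2]; simp
    apply le_antisymm
    · rw [← h2]
      apply measure_mono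
      intro s hs
      have hs' : s ∈ Set.Ioo 0 (m Set.univ).toReal :=
        ⟨ENNReal.toReal_nonneg.trans_lt hs.1, hs.2⟩
      exact ⟨(key s hs').2 hs.1.le, hs'⟩
    · rw [← h3]
      apply measure_mono
      rintro s ⟨hs, hs'⟩
      exact ⟨(key s hs').1 hs, hs'.2⟩
  · have h1 : m (Set.Ici y) = 0 := measure_mono_null (Set.Ici_subset_Ici.2 hyu.le) hmu
    rw [h1]
    symm
    convert measure_empty (μ := (volume : Measure ℝ))
    ext s
    simp only [Set.mem_inter_iff, Set.mem_preimage, Set.mem_Ici, Set.mem_empty_iff_false,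
      iff_false, not_and]
    intro h hs
    have := csInf_le (qf_bdd D (ENNReal.ofReal s)) ⟨hu, mem_lt m u D hu hmu hD s hs⟩
    exact absurd (h.trans this) (not_le.2 hyu)

lemma lintegral_inv_log (a b : ℝ) (hab : a ≤ b) (hb : b < 1) :
    ∫⁻ t in Set.Ioo a b, ENNReal.ofReal (1 / (1 - t)) =
      ENNReal.ofReal (Real.log ((1 - a) / (1 - b))) := by
  have hc : ContinuousOn (fun t : ℝ => 1 / (1 - t)) (Set.Icc a b) := by
    apply ContinuousOn.div continuousOn_const (by fun_prop)
    intro x hx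
    have := hx.2
    linarith
  have hint : IntervalIntegrable (fun t : ℝ => 1 / (1 - t)) volume a b := by
    apply ContinuousOn.intervalIntegrable
    rwa [Set.uIcc_of_le hab]
  rw [← ofReal_integral_eq_lintegral_ofReal]
  · congr 1
    rw [← integral_Ioc_eq_integral_Ioo, ← intervalIntegral.integral_of_le hab]
    rw [intervalIntegral.integral_comp_sub_left (fun t => 1 / t), integral_one_div]
    rw [Set.uIcc_of_le (by linarith)]
    intro h
    have := h.1
    linarith
  · exact ((intervalIntegrable_iff_integrableOn_Ioc_of_le hab).1 hint).mono_set
      Set.Ioo_subset_Ioc_self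
  · filter_upwards [ae_restrict_mem measurableSet_Ioo] with t ht
    have := ht.2
    simp only [Pi.zero_apply]
    apply div_nonneg <;> linarith

lemma exists_Iio_lt (μ : Measure ℝ) [IsFiniteMeasure μ] (x u : ℝ) (hxu : x < u) (l : ℝ≥0∞)
    (h : μ (Set.Iic x) < l) : ∃ z, x < z ∧ z < u ∧ μ (Set.Iio z) < l := by
  obtain ⟨v, hv1, hv2, hv3⟩ := exists_seq_strictAnti_tendsto' hxu
  have hU : Set.Iic x = ⋂ k, Set.Iio (v k) := by
    ext y
    simp only [Set.mem_Iic, Set.mem_iInter, Set.mem_Iio]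
    constructor
    · intro hy k
      exact hy.trans_lt (hv2 k).1
    · intro hy
      exact ge_of_tendsto' hv3 (fun k => (hy k).le)
  have ht := tendsto_measure_iInter_atTop (μ := μ) (s := fun k => Set.Iio (v k))
    (fun k => measurableSet_Iio.nullMeasurableSet)
    (fun a b hab => Set.Iio_subset_Iio (hv1.antitone hab)) ⟨0, measure_ne_top _ _⟩
  rw [← hU] at ht
  obtain ⟨k, hk⟩ := ((tendsto_order.1 ht).2 l h).exists
  exact ⟨v k, (hv2 k).1, (hv2 k).2, hk⟩

lemma atoms_countable (μ : Measure ℝ) [IsFiniteMeasure μ] : {t : ℝ | 0 < μ {t}}.Countable :=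
  Measure.countable_meas_pos_of_disjoint_iUnion (fun i => measurableSet_singleton i)
    (fun i j hij => by simpa using hij)

lemma nonatoms_meas (μ : Measure ℝ) [IsFiniteMeasure μ] : MeasurableSet {t : ℝ | μ {t} = 0} := by
  have : {t : ℝ | μ {t} = 0} = {t : ℝ | 0 < μ {t}}ᶜ := by
    ext t; simp
  rw [this]
  exact (atoms_countable μ).measurableSet.compl

lemma meas_Ici (μ : Measure ℝ) : Measurable (fun t => μ (Set.Ici t)) :=
  Antitone.measurable (fun _ _ hab => measure_mono (Set.Ici_subset_Ici.2 hab))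

lemma toReal_Ici (μ : Measure ℝ) [IsProbabilityMeasure μ] (x : ℝ) :
    (μ (Set.Ici x)).toReal = 1 - (μ (Set.Iio x)).toReal := by
  rw [← Set.compl_Iio]
  exact probReal_compl_eq_one_sub (μ := μ) measurableSet_Iio

lemma toReal_Ioi (μ : Measure ℝ) [IsProbabilityMeasure μ] (x : ℝ) :
    (μ (Set.Ioi x)).toReal = 1 - (μ (Set.Iic x)).toReal := by
  rw [← Set.compl_Iic]
  exact probReal_compl_eq_one_sub (μ := μ) measurableSet_Iic

lemma nu_total (μ : Measure ℝ) [IsProbabilityMeasure μ]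
    (hμpos : μ (Set.Ioi (0 : ℝ)) = 1) (u : ℝ) (hu : 0 < u) (hμu : 0 < μ (Set.Ici u)) :
    (∫⁻ s in Set.Ioo (0 : ℝ) u,
      Set.indicator {t : ℝ | μ {t} = 0} (fun t => (μ (Set.Ici t))⁻¹) s ∂μ)
    + ∑' s : {t : ℝ // 0 < t ∧ t < u ∧ 0 < μ {t}},
      ENNReal.ofReal
          (Real.log ((μ (Set.Ici (s : ℝ))).toReal / (μ (Set.Ioi (s : ℝ))).toReal))
    = ENNReal.ofReal (Real.log (1 / (μ (Set.Ici u)).toReal)) := by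
  have h00 : μ (Set.Iic 0) = 0 := by
    rw [← Set.compl_Ioi, prob_compl_eq_zero_iff measurableSet_Ioi, hμpos]
  have hIoo : ∀ y : ℝ, μ (Set.Ioo 0 y) = μ (Set.Iio y) := by
    intro y
    apply le_antisymm (measure_mono Set.Ioo_subset_Iio_self)
    calc μ (Set.Iio y) ≤ μ (Set.Iic 0 ∪ Set.Ioo 0 y) := measure_mono (fun x hx => by
          rcases le_or_gt x 0 with h | h
          · exact Or.inl h
          · exact Or.inr ⟨h, hx⟩)
      _ ≤ _ := (measure_union_le _ _).trans (by rw [h00, zero_add])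
  set m : Measure ℝ := μ.restrict (Set.Ioo 0 u) with hm
  have hm0 : m (Set.Iic 0) = 0 := by
    rw [hm]; exact le_antisymm ((Measure.restrict_apply_le _ _).trans h00.le) bot_le
  have hmu : m (Set.Ici u) = 0 := by
    rw [hm, Measure.restrict_apply measurableSet_Ici]
    convert measure_empty (μ := μ)
    ext x
    simp only [Set.mem_inter_iff, Set.mem_Ici, Set.mem_Ioo, Set.mem_empty_iff_false, iff_false]
    rintro ⟨h, _, h'⟩
    linarith
  have hmuniv : m Set.univ = μ (Set.Iio u) := by
    rw [hm, Measure.restrict_apply_univ, hIoo]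
  set D : ℝ → ℝ≥0∞ := fun y => μ (Set.Iio y) with hDdef
  have hD : ∀ y, 0 < y → y ≤ u → D y = m (Set.Iio y) := by
    intro y _ hy
    rw [hm, Measure.restrict_apply measurableSet_Iio, hDdef]
    simp only
    rw [← hIoo]
    congr 1
    ext x
    simp only [Set.mem_inter_iff, Set.mem_Iio, Set.mem_Ioo]
    constructor
    · rintro ⟨a, b⟩; exact ⟨b, a, b.trans_le hy⟩
    · rintro ⟨a, b, _⟩; exact ⟨b, a⟩
  have hmap := qf_map m hm0 u D hu hmu hD
  have hae := qf_aemeas m u D hu hmu hD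
  have hlt := mem_lt m u D hu hmu hD
  set c := (m Set.univ).toReal with hc
  have hc1 : (μ (Set.Ici u)).toReal = 1 - c := by rw [toReal_Ici, hc, hmuniv]
  have hclt : c < 1 := by
    have := ENNReal.toReal_pos hμu.ne' (measure_ne_top _ _)
    linarith
  have hc0 : 0 ≤ c := ENNReal.toReal_nonneg
  set q : ℝ → ℝ := fun s => qf D (ENNReal.ofReal s) with hq
  set P : Measure ℝ := volume.restrict (Set.Ioo 0 c) with hP
  have hqlt : ∀ t ∈ Set.Ioo 0 c, ∀ y, 0 < y → y ≤ u → (q t < y ↔ t < (μ (Set.Iio y)).toReal) := by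
    intro t ht y hy hyu
    rw [hq]
    simp only
    rw [qf_lt_iff m hm0 u D hD _ hu (hlt t ht) y hy hyu, ← hD y hy hyu,
      ENNReal.ofReal_lt_iff_lt_toReal ht.1.le (measure_ne_top _ _)]
  have hqmem : ∀ᵐ t ∂P, q t ∈ Set.Ioo 0 u := by
    have : ∀ᵐ x ∂(Measure.map q P), x ∈ Set.Ioo 0 u := by
      rw [hmap]; exact ae_restrict_mem measurableSet_Ioo
    exact ae_of_ae_map hae this
  have hb1 : ∀ t ∈ Set.Ioo 0 c, q t ∈ Set.Ioo 0 u → (μ (Set.Iio (q t))).toReal ≤ t := by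
    intro t ht hqt
    by_contra h
    exact lt_irrefl _ ((hqlt t ht (q t) hqt.1 hqt.2.le).2 (not_le.1 h))
  have hb2 : ∀ t ∈ Set.Ioo 0 c, q t ∈ Set.Ioo 0 u → t ≤ (μ (Set.Iic (q t))).toReal := by
    intro t ht hqt
    by_contra h
    have h' : μ (Set.Iic (q t)) < ENNReal.ofReal t :=
      (ENNReal.lt_ofReal_iff_toReal_lt (measure_ne_top _ _)).2 (not_le.1 h)
    obtain ⟨z, hz1, hz2, hz3⟩ := exists_Iio_lt μ (q t) u hqt.2 _ h'
    have h4 := (hqlt t ht z (hqt.1.trans hz1) hz2.le).1 hz1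
    have h5 := (ENNReal.lt_ofReal_iff_toReal_lt (measure_ne_top _ _)).1 hz3
    linarith
  have hIicIio : ∀ x, μ {x} = 0 → μ (Set.Iic x) = μ (Set.Iio x) := by
    intro x hx
    apply le_antisymm _ (measure_mono Set.Iio_subset_Iic_self)
    rw [← Set.Iio_union_right]
    exact (measure_union_le _ _).trans (by rw [hx, add_zero])
  have hcount : Countable {t : ℝ // 0 < t ∧ t < u ∧ 0 < μ {t}} :=
    ((atoms_countable μ).mono (fun t ht => ht.2.2) :
      {t : ℝ | 0 < t ∧ t < u ∧ 0 < μ {t}}.Countable).to_subtype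
  have hgm : Measurable (Set.indicator {t : ℝ | μ {t} = 0} (fun t => (μ (Set.Ici t))⁻¹)) :=
    (meas_Ici μ).inv.indicator (nonatoms_meas μ)
  set f : ℝ → ℝ≥0∞ := fun t => ENNReal.ofReal (1 / (1 - t)) with hf
  have hfm : Measurable f := by rw [hf]; fun_prop
  have hindm : ∀ s : ℝ, Measurable (Set.indicator ({s} : Set ℝ) (1 : ℝ → ℝ≥0∞)) := fun s =>
    measurable_one.indicator (measurableSet_singleton s)
  have hterm : ∀ s : {t : ℝ // 0 < t ∧ t < u ∧ 0 < μ {t}},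
      ENNReal.ofReal
          (Real.log ((μ (Set.Ici (s : ℝ))).toReal / (μ (Set.Ioi (s : ℝ))).toReal))
      = ∫⁻ t, Set.indicator ({(s : ℝ)} : Set ℝ) (1 : ℝ → ℝ≥0∞) (q t) * f t ∂P := by
    rintro ⟨s, hs0, hsu, hsa⟩
    simp only
    set a := (μ (Set.Iio s)).toReal with ha
    set b := (μ (Set.Iic s)).toReal with hb
    have hab : a ≤ b := ENNReal.toReal_mono (measure_ne_top _ _)
      (measure_mono Set.Iio_subset_Iic_self)
    have hbc : b ≤ c := by
      rw [hb, hc, hmuniv]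
      exact ENNReal.toReal_mono (measure_ne_top _ _)
        (measure_mono (fun x hx => lt_of_le_of_lt hx hsu))
    have ha0 : 0 ≤ a := ENNReal.toReal_nonneg
    rw [toReal_Ici, toReal_Ioi, ← lintegral_inv_log a b hab (hbc.trans_lt hclt),
      ← lintegral_indicator measurableSet_Ioo, hP, ← lintegral_indicator measurableSet_Ioo]
    apply lintegral_congr_ae
    have hqmem' := (ae_restrict_iff' measurableSet_Ioo).1 hqmem
    have hna : ∀ᵐ t : ℝ, t ≠ a := by simp [ae_iff]
    have hnb : ∀ᵐ t : ℝ, t ≠ b := by simp [ae_iff]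
    filter_upwards [hqmem', hna, hnb] with t ht hta htb
    by_cases htc : t ∈ Set.Ioo 0 c
    · rw [Set.indicator_of_mem htc]
      by_cases hqs : q t = s
      · have h1 := hb1 t htc (ht htc)
        have h2 := hb2 t htc (ht htc)
        rw [hqs] at h1 h2
        rw [Set.indicator_of_mem (show t ∈ Set.Ioo a b from
          ⟨lt_of_le_of_ne h1 (Ne.symm hta), lt_of_le_of_ne h2 htb⟩)]
        simp [hqs, hf]
      · rw [Set.indicator_of_notMem, Set.indicator_of_notMem (by simpa using hqs), zero_mul]
        rintro ⟨h1, h2⟩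
        apply hqs
        apply le_antisymm
        · by_contra h
          push Not at h
          have h3 := (not_congr (hqlt t htc (q t) (ht htc).1 (ht htc).2.le)).1 (lt_irrefl _)
          apply h3
          refine h2.trans_le (ENNReal.toReal_mono (measure_ne_top _ _)
            (measure_mono (fun x hx => lt_of_le_of_lt hx h)))
        · by_contra h
          push Not at h
          have := (hqlt t htc s hs0 hsu.le).1 h
          linarith
    · rw [Set.indicator_of_notMem htc, Set.indicator_of_notMem]
      intro h
      exact htc ⟨ha0.trans_lt h.1, h.2.trans_le hbc⟩
  have hfirst : (∫⁻ s in Set.Ioo (0 : ℝ) u,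
      Set.indicator {t : ℝ | μ {t} = 0} (fun t => (μ (Set.Ici t))⁻¹) s ∂μ)
      = ∫⁻ t, Set.indicator {t : ℝ | μ {t} = 0} (fun t => (μ (Set.Ici t))⁻¹) (q t) ∂P := by
    rw [← hm]
    conv_lhs => rw [← hmap]
    rw [lintegral_map' hgm.aemeasurable hae]
  rw [hfirst, tsum_congr hterm, ← lintegral_tsum, ← lintegral_add_left', hc1]
  · have hR := lintegral_inv_log 0 c hc0 hclt
    rw [sub_zero] at hR
    rw [← hR]
    apply lintegral_congr_ae
    filter_upwards [hqmem, ae_restrict_mem measurableSet_Ioo] with t hqt ht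
    by_cases hat : μ {q t} = 0
    · rw [Set.indicator_of_mem (by exact hat)]
      have h1 := hb1 t ht hqt
      have h2 := hb2 t ht hqt
      rw [hIicIio _ hat] at h2
      have h3 : (μ (Set.Ici (q t))).toReal = 1 - t := by rw [toReal_Ici]; linarith
      have hz : ∀ s : {t : ℝ // 0 < t ∧ t < u ∧ 0 < μ {t}},
          Set.indicator ({(s : ℝ)} : Set ℝ) (1 : ℝ → ℝ≥0∞) (q t) * f t = 0 := by
        rintro ⟨s, hs⟩
        rw [Set.indicator_of_notMem, zero_mul]
        intro h
        rw [Set.mem_singleton_iff] at h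
        rw [h] at hat
        exact hs.2.2.ne' hat
      rw [tsum_congr hz, tsum_zero, add_zero, one_div, ENNReal.ofReal_inv_of_pos
        (by linarith [ht.2]), ← h3, ENNReal.ofReal_toReal (measure_ne_top _ _)]
    · rw [Set.indicator_of_notMem (by exact hat), zero_add]
      rw [tsum_eq_single (⟨q t, hqt.1, hqt.2, pos_iff_ne_zero.2 hat⟩ :
        {t : ℝ // 0 < t ∧ t < u ∧ 0 < μ {t}})]
      · simp [hf]
      · rintro ⟨s, hs⟩ hne
        rw [Set.indicator_of_notMem, zero_mul]
        intro h
        apply hne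
        rw [Set.mem_singleton_iff] at h
        simp [h]
  · exact hgm.comp_aemeasurable hae
  · intro s
    exact ((hindm s).comp_aemeasurable hae).mul hfm.aemeasurable

/-- For every `u > 0` in the topological support of `μ` with
`μ̄(u) > 0`, one has `ψ_μ(u) < ∞` and
`∫₀^{ψ_μ(u)} n([φ_μ(s),∞)) ds = log(1/μ̄(u))`. -/
theorem dualHL_integral_identity
    (μ n : MeasureTheory.Measure ℝ) [MeasureTheory.IsProbabilityMeasure μ]
    (hμpos : μ (Set.Ioi (0 : ℝ)) = 1)
    (hnfin : ∀ s : ℝ, 0 < s → n (Set.Ici s) < ⊤)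
    (hnsupp : ∀ y ∈ measSupport μ, 0 < n (Set.Ici y))
    (u : ℝ) (hu : 0 < u) (husupp : u ∈ measSupport μ)
    (hμu : 0 < μ (Set.Ici u)) :
    dualHL μ n u ≠ ⊤ ∧
      (∫⁻ s in Set.Ioo (0 : ℝ) ((dualHL μ n u).toReal), nPhiHL μ n (ENNReal.ofReal s))
        = ENNReal.ofReal (Real.log (1 / (μ (Set.Ici u)).toReal)) := by
  have hN0 : ∀ t, t ≤ u → n (Set.Ici t) ≠ 0 := fun t ht =>
    ((hnsupp u husupp).trans_le (measure_mono (Set.Ici_subset_Ici.2 ht))).ne'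
  have hNm := meas_Ici n
  have hNt : ∀ t, 0 < t → n (Set.Ici t) ≠ ⊤ := fun t ht => (hnfin t ht).ne
  have hnu := nu_total μ hμpos u hu hμu
  set L : ℝ → ℝ≥0∞ := fun s => ENNReal.ofReal
    (Real.log ((μ (Set.Ici (s : ℝ))).toReal / (μ (Set.Ioi (s : ℝ))).toReal)) with hL
  set w : ℝ → ℝ≥0∞ := Set.indicator {t : ℝ | μ {t} = 0}
        (fun t => (μ (Set.Ici t) * n (Set.Ici t))⁻¹) with hw
  have hwm : Measurable w := ((meas_Ici μ).mul hNm).inv.indicator (nonatoms_meas μ)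
  set m : Measure ℝ := (μ.restrict (Set.Ioo 0 u)).withDensity w +
    Measure.sum (fun s : {t : ℝ // 0 < t ∧ t < u ∧ 0 < μ {t}} =>
      (L s / n (Set.Ici (s : ℝ))) • Measure.dirac (s : ℝ)) with hm
  have hmN : ∫⁻ x, n (Set.Ici x) ∂m = ENNReal.ofReal (Real.log (1 / (μ (Set.Ici u)).toReal)) := by
    rw [hm, lintegral_add_measure, lintegral_sum_measure,
      lintegral_withDensity_eq_lintegral_mul _ hwm hNm, ← hnu]
    congr 1
    · apply setLIntegral_congr_fun measurableSet_Ioo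
      intro x hx
      simp only [Pi.mul_apply, hw]
      by_cases hx0 : μ {x} = 0
      · rw [Set.indicator_of_mem (by exact hx0), Set.indicator_of_mem (by exact hx0),
          ENNReal.mul_inv (Or.inr (hNt x hx.1)) (Or.inr (hN0 x hx.2.le)), mul_assoc,
          ENNReal.inv_mul_cancel (hN0 x hx.2.le) (hNt x hx.1), mul_one]
      · rw [Set.indicator_of_notMem (by exact hx0), Set.indicator_of_notMem (by exact hx0),
          zero_mul]
    · apply tsum_congr
      rintro ⟨s, hs⟩
      rw [lintegral_smul_measure, lintegral_dirac' _ hNm, smul_eq_mul,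
        ENNReal.div_mul_cancel (hN0 s hs.2.1.le) (hNt s hs.1)]
  have hD : ∀ y, 0 < y → y ≤ u → dualHL μ n y = m (Set.Iio y) := by
    intro y _ hyu
    rw [hm, Measure.add_apply, withDensity_apply _ measurableSet_Iio,
      Measure.restrict_restrict measurableSet_Iio, Measure.sum_apply _ measurableSet_Iio, dualHL]
    congr 1
    · congr 2
      ext x
      simp only [Set.mem_inter_iff, Set.mem_Iio, Set.mem_Ioo]
      constructor
      · rintro ⟨a, b⟩; exact ⟨b, a, b.trans_le hyu⟩
      · rintro ⟨a, b, _⟩; exact ⟨b, a⟩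
    · have e1 := tsum_subtype {t : ℝ | 0 < t ∧ t < y ∧ 0 < μ {t}}
        (fun s => L s / n (Set.Ici s))
      have e2 := tsum_subtype {t : ℝ | 0 < t ∧ t < u ∧ 0 < μ {t}}
        (fun s => ((L s / n (Set.Ici s)) • Measure.dirac s) (Set.Iio y))
      refine e1.trans (Eq.trans ?_ e2.symm)
      apply tsum_congr
      intro s
      simp only [Set.indicator_apply, Set.mem_setOf_eq, Measure.smul_apply,
        Measure.dirac_apply' s measurableSet_Iio, Set.mem_Iio, smul_eq_mul, Pi.one_apply]
      by_cases hsy : s < y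
      · simp [hsy, hsy.trans_le hyu]
      · simp [hsy]
  have hmu : m (Set.Ici u) = 0 := by
    rw [hm, Measure.add_apply, withDensity_apply _ measurableSet_Ici,
      Measure.restrict_restrict measurableSet_Ici, Measure.sum_apply _ measurableSet_Ici]
    have h1 : Set.Ici u ∩ Set.Ioo 0 u = ∅ := by
      ext x
      simp only [Set.mem_inter_iff, Set.mem_Ici, Set.mem_Ioo, Set.mem_empty_iff_false, iff_false]
      rintro ⟨h, _, h'⟩
      linarith
    rw [h1]
    simp only [Measure.restrict_empty, lintegral_zero_measure, zero_add, ENNReal.tsum_eq_zero]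
    rintro ⟨s, hs⟩
    simp [hs.2.1]
  have hm0 : m (Set.Iic 0) = 0 := by
    rw [hm, Measure.add_apply, withDensity_apply _ measurableSet_Iic,
      Measure.restrict_restrict measurableSet_Iic, Measure.sum_apply _ measurableSet_Iic]
    have h1 : Set.Iic 0 ∩ Set.Ioo 0 u = ∅ := by
      ext x
      simp only [Set.mem_inter_iff, Set.mem_Iic, Set.mem_Ioo, Set.mem_empty_iff_false, iff_false]
      rintro ⟨h, h', _⟩
      linarith
    rw [h1]
    simp only [Measure.restrict_empty, lintegral_zero_measure, zero_add, ENNReal.tsum_eq_zero]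
    rintro ⟨s, hs⟩
    simp [hs.1]
  have hDu : dualHL μ n u = m Set.univ := by rw [hD u hu le_rfl, Iio_eq_univ m u hmu]
  have hfin : m Set.univ ≠ ⊤ := by
    have h1 : n (Set.Ici u) * m (Set.Iio u) ≤ ∫⁻ x, n (Set.Ici x) ∂m := by
      rw [← setLIntegral_const]
      refine le_trans (setLIntegral_mono hNm ?_) (setLIntegral_le_lintegral _ _)
      intro x hx
      exact measure_mono (Set.Ici_subset_Ici.2 (le_of_lt hx))
    rw [Iio_eq_univ m u hmu, hmN] at h1
    intro h
    rw [h, ENNReal.mul_top (hN0 u le_rfl)] at h1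
    exact ENNReal.ofReal_ne_top (top_le_iff.1 h1)
  haveI : IsFiniteMeasure m := ⟨lt_top_iff_ne_top.2 hfin⟩
  refine ⟨hDu ▸ hfin, ?_⟩
  have hmap := qf_map m hm0 u (dualHL μ n) hu hmu hD
  have hae := qf_aemeas m u (dualHL μ n) hu hmu hD
  have hlt := mem_lt m u (dualHL μ n) hu hmu hD
  rw [← hmN, hDu]
  conv_rhs => rw [← hmap]
  rw [lintegral_map' hNm.aemeasurable hae]
  apply setLIntegral_congr_fun measurableSet_Ioo
  intro s hs
  have hne : (phiHLSet μ n (ENNReal.ofReal s)).Nonempty := ⟨u, hu, hlt s hs⟩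
  simp only [nPhiHL, if_pos hne]
  rfl
end

section
/- For every y > 0 in the topological support of μ: exp( −∫₀^{ψ₊(y)} [ n((−∞,−φ₋(s)]) + n([φ₊(s),∞)) ] ds ) = 1 + μ̄(y) − μ̄(G_μ⁻¹(D_μ(y))); and for every x < 0 in the topological support of μ: exp( −∫₀^{ψ₋(−x)} [ n((−∞,−φ₋(s)]) + n([φ₊(s),∞)) ] ds ) = 1 + μ̄(D_μ⁻¹(G_μ(x))) − μ̄(x). (These identities express the law of the stopped local time L_T at the levels ψ₊(y), ψ₋(−x) of the two-sided embedding construction.) -/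
open MeasureTheory Filter
open scoped ENNReal Topology Classical

/-- `D_μ(y) = ∫_{[0,y]} n([s,∞))⁻¹ dμ(s)` for `y ≥ 0` (equal to `0` for `y < 0`). -/
noncomputable def Dmu (μ n : MeasureTheory.Measure ℝ) (y : ℝ) : ℝ≥0∞ :=
  ∫⁻ s in Set.Icc (0 : ℝ) y, (n (Set.Ici s))⁻¹ ∂μ

/-- `G_μ(x) = ∫_{[x,0]} n((−∞,s])⁻¹ dμ(s)` for `x ≤ 0` (equal to `0` for `x > 0`). -/
noncomputable def Gmu (μ n : MeasureTheory.Measure ℝ) (x : ℝ) : ℝ≥0∞ :=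
  ∫⁻ s in Set.Icc x (0 : ℝ), (n (Set.Iic s))⁻¹ ∂μ

/-- The set `{y ≥ 0 : D_μ(y) > v}`; its infimum is the right-continuous inverse
`D_μ⁻¹(v)`, with `D_μ⁻¹(v) = ∞` when the set is empty. -/
def DinvSet (μ n : MeasureTheory.Measure ℝ) (v : ℝ≥0∞) : Set ℝ :=
  {y : ℝ | 0 ≤ y ∧ v < Dmu μ n y}

/-- The set `{x ≤ 0 : G_μ(x) > v}`; its supremum is the right-continuous inverse
`G_μ⁻¹(v)`, with `G_μ⁻¹(v) = −∞` when the set is empty. -/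
def GinvSet (μ n : MeasureTheory.Measure ℝ) (v : ℝ≥0∞) : Set ℝ :=
  {x : ℝ | x ≤ 0 ∧ v < Gmu μ n x}

/-- `μ̄(D_μ⁻¹(v))`, with the convention `μ̄(∞) = 0`. -/
noncomputable def mubarDinv (μ n : MeasureTheory.Measure ℝ) (v : ℝ≥0∞) : ℝ :=
  if (DinvSet μ n v).Nonempty then (μ (Set.Ici (sInf (DinvSet μ n v)))).toReal else 0

/-- `μ̄(G_μ⁻¹(v))`, with the convention `μ̄(−∞) = 1`. -/
noncomputable def mubarGinv (μ n : MeasureTheory.Measure ℝ) (v : ℝ≥0∞) : ℝ :=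
  if (GinvSet μ n v).Nonempty then (μ (Set.Ici (sSup (GinvSet μ n v)))).toReal else 1

/-- `n([D_μ⁻¹(v),∞))`, with the convention that it is `0` when `D_μ⁻¹(v) = ∞`. -/
noncomputable def nDinv (μ n : MeasureTheory.Measure ℝ) (v : ℝ≥0∞) : ℝ≥0∞ :=
  if (DinvSet μ n v).Nonempty then n (Set.Ici (sInf (DinvSet μ n v))) else 0

/-- `n((−∞,G_μ⁻¹(v)])`, with the convention that it is `0` when `G_μ⁻¹(v) = −∞`. -/
noncomputable def nGinv (μ n : MeasureTheory.Measure ℝ) (v : ℝ≥0∞) : ℝ≥0∞ :=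
  if (GinvSet μ n v).Nonempty then n (Set.Iic (sSup (GinvSet μ n v))) else 0

/-- The integrand `[n([s,∞)) · (1 + μ̄(s) − μ̄(G_μ⁻¹(D_μ(s))))]⁻¹` of `ψ₊`. -/
noncomputable def psiPlusIntegrand (μ n : MeasureTheory.Measure ℝ) (s : ℝ) : ℝ≥0∞ :=
  (n (Set.Ici s) *
    ENNReal.ofReal (1 + (μ (Set.Ici s)).toReal - mubarGinv μ n (Dmu μ n s)))⁻¹

/-- `ψ₊(y) = ∫_{[0,y]} [n([s,∞)) · (1 + μ̄(s) − μ̄(G_μ⁻¹(D_μ(s))))]⁻¹ dμ(s)`. -/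
noncomputable def psiPlus (μ n : MeasureTheory.Measure ℝ) (y : ℝ) : ℝ≥0∞ :=
  ∫⁻ s in Set.Icc (0 : ℝ) y, psiPlusIntegrand μ n s ∂μ

/-- The integrand `[n((−∞,s]) · (1 + μ̄(D_μ⁻¹(G_μ(s))) − μ̄(s))]⁻¹` of `ψ₋`. -/
noncomputable def psiMinusIntegrand (μ n : MeasureTheory.Measure ℝ) (s : ℝ) : ℝ≥0∞ :=
  (n (Set.Iic s) *
    ENNReal.ofReal (1 + mubarDinv μ n (Gmu μ n s) - (μ (Set.Ici s)).toReal))⁻¹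

/-- `ψ₋(z) = ∫_{[−z,0]} [n((−∞,s]) · (1 + μ̄(D_μ⁻¹(G_μ(s))) − μ̄(s))]⁻¹ dμ(s)`. -/
noncomputable def psiMinus (μ n : MeasureTheory.Measure ℝ) (z : ℝ) : ℝ≥0∞ :=
  ∫⁻ s in Set.Icc (-z) (0 : ℝ), psiMinusIntegrand μ n s ∂μ

/-- The set `{y ≥ 0 : ψ₊(y) ≥ l}` whose infimum is the left-continuous inverse `φ₊(l)`. -/
def phiPlusSet (μ n : MeasureTheory.Measure ℝ) (l : ℝ) : Set ℝ :=
  {y : ℝ | 0 ≤ y ∧ ENNReal.ofReal l ≤ psiPlus μ n y}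

/-- The set `{z ≥ 0 : ψ₋(z) ≥ l}` whose infimum is the left-continuous inverse `φ₋(l)`. -/
def phiMinusSet (μ n : MeasureTheory.Measure ℝ) (l : ℝ) : Set ℝ :=
  {z : ℝ | 0 ≤ z ∧ ENNReal.ofReal l ≤ psiMinus μ n z}

/-- `φ₊(l) = inf{y ≥ 0 : ψ₊(y) ≥ l}`. -/
noncomputable def phiPlus (μ n : MeasureTheory.Measure ℝ) (l : ℝ) : ℝ :=
  sInf (phiPlusSet μ n l)

/-- `φ₋(l) = inf{z ≥ 0 : ψ₋(z) ≥ l}`. -/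
noncomputable def phiMinus (μ n : MeasureTheory.Measure ℝ) (l : ℝ) : ℝ :=
  sInf (phiMinusSet μ n l)

/-- `n([φ₊(l),∞))`, with the convention that it is `0` when `φ₊(l) = inf ∅ = ∞`. -/
noncomputable def nPhiPlus (μ n : MeasureTheory.Measure ℝ) (l : ℝ) : ℝ≥0∞ :=
  if (phiPlusSet μ n l).Nonempty then n (Set.Ici (phiPlus μ n l)) else 0

/-- `n((−∞,−φ₋(l)])`, with the convention that it is `0` when `φ₋(l) = inf ∅ = ∞`. -/
noncomputable def nPhiMinus (μ n : MeasureTheory.Measure ℝ) (l : ℝ) : ℝ≥0∞ :=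
  if (phiMinusSet μ n l).Nonempty then n (Set.Iic (-(phiMinus μ n l))) else 0

/-- `∫₀^L [n((−∞,−φ₋(s)]) + n([φ₊(s),∞))] ds` for an upper limit `L ∈ [0,∞]`. -/
noncomputable def cutInt (μ n : MeasureTheory.Measure ℝ) (L : ℝ≥0∞) : ℝ≥0∞ :=
  ∫⁻ s in {s : ℝ | 0 < s ∧ ENNReal.ofReal s < L},
    (nPhiMinus μ n s + nPhiPlus μ n s)

/-- `exp(−a)` for `a ∈ [0,∞]`, with `exp(−∞) = 0`. -/
noncomputable def expNegE (a : ℝ≥0∞) : ℝ :=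
  if a = ⊤ then 0 else Real.exp (-a.toReal)

/-- `ρ(l) = exp(−∫₀^l [n((−∞,−φ₋(s)]) + n([φ₊(s),∞))] ds)`. -/
noncomputable def rho (μ n : MeasureTheory.Measure ℝ) (l : ℝ) : ℝ≥0∞ :=
  ENNReal.ofReal (expNegE (cutInt μ n (ENNReal.ofReal l)))

section LSAux

structure LSide (m : Measure ℝ) (a : ℝ → ℝ≥0∞) : Prop where
  fin : IsFiniteMeasure m
  atom : ∀ x, m {x} = 0
  anti : Antitone a
  afin : ∀ s, 0 < s → a s < ⊤
  dfin : ∀ y, ∫⁻ s in Set.Icc 0 y, (a s)⁻¹ ∂m < ⊤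

noncomputable def lsD (m : Measure ℝ) (a : ℝ → ℝ≥0∞) (y : ℝ) : ℝ :=
  (∫⁻ s in Set.Icc 0 y, (a s)⁻¹ ∂m).toReal

noncomputable def lsT (m : Measure ℝ) (a : ℝ → ℝ≥0∞) (v : ℝ) : ℝ≥0∞ :=
  m {s | 0 ≤ s ∧ v ≤ lsD m a s}

noncomputable def lsE (m : Measure ℝ) (a : ℝ → ℝ≥0∞) (v : ℝ) : ℝ :=
  sInf {y | 0 ≤ y ∧ v ≤ lsD m a y}

namespace LSide

variable {m : Measure ℝ} {a : ℝ → ℝ≥0∞}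

theorem meas (h : LSide m a) : Measurable a := h.anti.measurable

theorem ofD (h : LSide m a) (y : ℝ) :
    ENNReal.ofReal (lsD m a y) = ∫⁻ s in Set.Icc 0 y, (a s)⁻¹ ∂m :=
  ENNReal.ofReal_toReal (h.dfin y).ne

theorem mono (h : LSide m a) : Monotone (lsD m a) := by
  intro x y hxy
  apply ENNReal.toReal_mono (h.dfin y).ne
  exact lintegral_mono_set (Set.Icc_subset_Icc_right hxy)

theorem nonneg (y : ℝ) : 0 ≤ lsD m a y := ENNReal.toReal_nonneg

theorem zero (h : LSide m a) {y : ℝ} (hy : y ≤ 0) : lsD m a y = 0 := by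
  unfold lsD
  rw [setLIntegral_measure_zero, ENNReal.toReal_zero]
  refine measure_mono_null (t := {0}) ?_ (h.atom 0)
  intro s hs
  exact le_antisymm (hs.2.trans hy) hs.1

theorem incr (h : LSide m a) {x y : ℝ} (hx : 0 ≤ x) (hxy : x ≤ y) :
    ∫⁻ s in Set.Ioc x y, (a s)⁻¹ ∂m = ENNReal.ofReal (lsD m a y - lsD m a x) := by
  rw [ENNReal.ofReal_sub _ (nonneg x), h.ofD, h.ofD]
  have : Set.Icc 0 y = Set.Icc 0 x ∪ Set.Ioc x y := (Set.Icc_union_Ioc_eq_Icc hx hxy).symm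
  rw [this, lintegral_union measurableSet_Ioc]
  · rw [ENNReal.add_sub_cancel_left (h.dfin x).ne]
  · rw [Set.disjoint_left]
    intro s hs hs'
    exact absurd hs.2 (not_le.2 hs'.1)

theorem cont (h : LSide m a) : Continuous (lsD m a) := by
  have := h.fin
  have : NullSingletonClass m := ⟨h.atom⟩
  set f : ℝ → ℝ := fun s => ((Set.Ici (0:ℝ)).indicator (fun s => (a s)⁻¹) s).toReal with hf
  have hm : Measurable fun s => (Set.Ici (0:ℝ)).indicator (fun s => (a s)⁻¹) s :=
    (h.meas.inv).indicator measurableSet_Ici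
  have hfi : ∀ y, ∫⁻ s in Set.Iic y, (Set.Ici (0:ℝ)).indicator (fun s => (a s)⁻¹) s ∂m
      = ∫⁻ s in Set.Icc 0 y, (a s)⁻¹ ∂m := by
    intro y
    rw [lintegral_indicator measurableSet_Ici, Measure.restrict_restrict measurableSet_Ici]
    rfl
  have hio : ∀ y, IntegrableOn f (Set.Iic y) m := by
    intro y
    apply integrable_toReal_of_lintegral_ne_top hm.aemeasurable
    rw [hfi]; exact (h.dfin y).ne
  have hint : ∀ x y, IntervalIntegrable f m x y := by
    intro x y
    constructor
    · exact (hio y).mono_set fun s hs => hs.2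
    · exact (hio x).mono_set fun s hs => hs.2
  have hc := intervalIntegral.continuous_primitive hint (0:ℝ)
  have : lsD m a = fun y => (∫ s in (0:ℝ)..y, f s ∂m) - (∫ s in (0:ℝ)..0, f s ∂m)
      + ∫ s in Set.Iic (0:ℝ), f s ∂m := by
    funext y
    have h1 := intervalIntegral.integral_Iic_sub_Iic (hio 0) (hio y)
    have h2 : ∫ s in Set.Iic y, f s ∂m = lsD m a y := by
      rw [integral_toReal hm.aemeasurable]
      · rw [hfi]; rfl
      · apply ae_lt_top hm
        rw [hfi]; exact (h.dfin y).ne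
    simp only [intervalIntegral.integral_same]
    linarith
  rw [this]
  exact (hc.sub continuous_const).add continuous_const

theorem null (h : LSide m a) {x y : ℝ} (hx : 0 ≤ x) (hD : lsD m a y ≤ lsD m a x) :
    m (Set.Ioc x y) = 0 := by
  rcases le_total y x with hyx | hxy
  · rw [Set.Ioc_eq_empty (not_lt.2 hyx)]; simp
  have := h.incr hx hxy
  rw [ENNReal.ofReal_of_nonpos (by linarith)] at this
  rw [setLIntegral_eq_zero_iff measurableSet_Ioc (f := fun s => (a s)⁻¹) h.meas.inv] at this
  rw [measure_eq_zero_iff_ae_notMem]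
  filter_upwards [this] with s hs hs'
  have h1 := hs hs'
  rw [ENNReal.inv_eq_zero] at h1
  exact (h.afin s (hx.trans_lt hs'.1)).ne h1

theorem null_Ici (h : LSide m a) {x : ℝ} (hx : 0 ≤ x) (hD : ∀ y, lsD m a y ≤ lsD m a x) :
    m (Set.Ici x) = 0 := by
  have : Set.Ici x ⊆ {x} ∪ ⋃ k : ℕ, Set.Ioc x k := by
    intro s hs
    rcases (show x ≤ s from hs).eq_or_lt with h1 | h1
    · left; exact h1.symm
    · right
      obtain ⟨k, hk⟩ := exists_nat_ge s
      exact Set.mem_iUnion.2 ⟨k, h1, hk⟩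
  refine measure_mono_null this (measure_union_null (h.atom x) (measure_iUnion_null fun k => ?_))
  exact h.null hx (hD k)

theorem Ici_eq (h : LSide m a) {x y : ℝ} (hx : 0 ≤ x) (hxy : x ≤ y) (hD : lsD m a y ≤ lsD m a x) :
    m (Set.Ici x) = m (Set.Ici y) := by
  apply le_antisymm _ (measure_mono (Set.Ici_subset_Ici.2 hxy))
  have : Set.Ici x ⊆ ({x} ∪ Set.Ioc x y) ∪ Set.Ici y := by
    intro s hs
    rcases (show x ≤ s from hs).eq_or_lt with h1 | h1
    · left; left; exact h1.symm
    · rcases le_total s y with h2 | h2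
      · left; right; exact ⟨h1, h2⟩
      · right; exact h2
  refine (measure_mono this).trans ((measure_union_le _ _).trans ?_)
  rw [measure_union_null (h.atom x) (h.null hx hD), zero_add]

theorem E_spec (h : LSide m a) {v y : ℝ} (hv : v ≤ lsD m a y) (hy : 0 ≤ y) :
    0 ≤ lsE m a v ∧ v ≤ lsD m a (lsE m a v) := by
  have hcl : IsClosed {y | 0 ≤ y ∧ v ≤ lsD m a y} :=
    (isClosed_le continuous_const continuous_id).inter (isClosed_le continuous_const h.cont)
  exact hcl.csInf_mem ⟨y, hy, hv⟩ ⟨0, fun _ hs => hs.1⟩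

theorem E_le {v y : ℝ} (hv : v ≤ lsD m a y) (hy : 0 ≤ y) : lsE m a v ≤ y :=
  csInf_le ⟨0, fun _ hs => hs.1⟩ ⟨hy, hv⟩

theorem D_E (h : LSide m a) {v y : ℝ} (hv0 : 0 ≤ v) (hv : v ≤ lsD m a y) (hy : 0 ≤ y) :
    lsD m a (lsE m a v) = v := by
  obtain ⟨h1, h2⟩ := h.E_spec hv hy
  have := intermediate_value_Icc h1 (h.cont.continuousOn)
  obtain ⟨z, hz, hz'⟩ := this (show v ∈ _ from ⟨by rw [h.zero le_rfl]; exact hv0, h2⟩)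
  have h3 : lsE m a v ≤ z := E_le hz'.ge hz.1
  rw [le_antisymm h3 hz.2, hz']

theorem T_E (h : LSide m a) {v y : ℝ} (hv : v ≤ lsD m a y) (hy : 0 ≤ y) :
    lsT m a v = m (Set.Ici (lsE m a v)) := by
  unfold lsT
  congr 1
  ext s
  constructor
  · rintro ⟨h1, h2⟩; exact E_le h2 h1
  · intro hs
    obtain ⟨h1, h2⟩ := h.E_spec hv hy
    exact ⟨h1.trans hs, h2.trans (h.mono hs)⟩

theorem T_D (h : LSide m a) {y : ℝ} (hy : 0 ≤ y) :
    lsT m a (lsD m a y) = m (Set.Ici y) := by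
  rw [h.T_E le_rfl hy]
  have := h.D_E (nonneg y) le_rfl hy
  exact h.Ici_eq (h.E_spec le_rfl hy).1 (E_le le_rfl hy) this.ge

theorem T_zero : lsT m a 0 = m (Set.Ici 0) := by
  unfold lsT
  congr 1
  ext s
  simp [nonneg]

theorem T_anti : Antitone (lsT m a) := by
  intro u v huv
  exact measure_mono fun s hs => ⟨hs.1, huv.trans hs.2⟩

theorem T_top (h : LSide m a) {v : ℝ} (hv : 0 ≤ v) (hD : ∀ y, 0 ≤ y → lsD m a y ≤ v) :
    lsT m a v = 0 := by
  by_cases hy : ∃ y, 0 ≤ y ∧ v ≤ lsD m a y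
  · obtain ⟨y, hy, hvy⟩ := hy
    rw [h.T_E hvy hy]
    apply h.null_Ici (h.E_spec hvy hy).1
    intro z
    rw [h.D_E hv hvy hy]
    rcases le_total 0 z with hz | hz
    · exact hD z hz
    · rw [h.zero hz]; exact hv
  · push Not at hy
    unfold lsT
    convert measure_empty (μ := m)
    ext s
    simp only [Set.mem_ofPred_eq, Set.mem_empty_iff_false, iff_false, not_and, not_le]
    exact hy s

theorem T_inv (h : LSide m a) {v : ℝ} (hv : 0 ≤ v) :
    (if {y | 0 ≤ y ∧ v < lsD m a y}.Nonempty then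
      m (Set.Ici (sInf {y | 0 ≤ y ∧ v < lsD m a y})) else 0) = lsT m a v := by
  split_ifs with hne
  · obtain ⟨y, hy, hvy⟩ := hne
    set r := sInf {y | 0 ≤ y ∧ v < lsD m a y} with hr
    have hbd : BddBelow {y | 0 ≤ y ∧ v < lsD m a y} := ⟨0, fun _ hs => hs.1⟩
    have hr0 : 0 ≤ r := le_csInf ⟨y, hy, hvy⟩ fun _ hs => hs.1
    have her : lsE m a v ≤ r :=
      le_csInf ⟨y, hy, hvy⟩ fun s hs => E_le hs.2.le hs.1
    rw [h.T_E hvy.le hy]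
    refine (h.Ici_eq (h.E_spec hvy.le hy).1 her ?_).symm
    rw [h.D_E hv hvy.le hy]
    by_contra hc
    push Not at hc
    have hrne : r ≠ 0 := by
      intro h0
      rw [h.zero h0.le] at hc
      linarith
    have hrpos : 0 < r := lt_of_le_of_ne hr0 hrne.symm
    have hev : ∀ᶠ z in 𝓝[<] r, v < lsD m a z ∧ 0 < z :=
      (((h.cont.tendsto r).eventually (lt_mem_nhds hc)).and (lt_mem_nhds hrpos)).filter_mono
        nhdsWithin_le_nhds
    obtain ⟨z, ⟨hz1, hz2⟩, hz3⟩ := (hev.and self_mem_nhdsWithin).exists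
    exact absurd (csInf_le hbd ⟨hz2.le, hz1⟩) (not_le.2 hz3)
  · symm
    apply h.T_top hv
    intro y hy
    by_contra hc
    exact hne ⟨y, hy, not_le.1 hc⟩

theorem T_pos (h : LSide m a) {v y : ℝ} (hv0 : 0 ≤ v) (hv : v < lsD m a y) (hy : 0 ≤ y) :
    0 < lsT m a v := by
  rw [h.T_E hv.le hy, pos_iff_ne_zero]
  intro h0
  have h1 := (h.E_spec hv.le hy).1
  have h2 : lsE m a v ≤ y := E_le hv.le hy
  have h3 := h.incr h1 h2
  rw [setLIntegral_measure_zero, h.D_E hv0 hv.le hy] at h3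
  · have := (ENNReal.ofReal_eq_zero.1 h3.symm)
    linarith
  · exact measure_mono_null (fun s hs => hs.1.le) h0

theorem E_pos (h : LSide m a) {v y : ℝ} (hv0 : 0 < v) (hv : v ≤ lsD m a y) (hy : 0 ≤ y) :
    0 < lsE m a v := by
  by_contra hc
  have h1 := h.D_E hv0.le hv hy
  rw [h.zero (not_lt.1 hc)] at h1
  exact hv0.ne h1

theorem T_diff (h : LSide m a) {u v y : ℝ} (hu : 0 ≤ u) (huv : u ≤ v) (hv : v ≤ lsD m a y)
    (hy : 0 ≤ y) :
    a (lsE m a v) * ENNReal.ofReal (v - u) + lsT m a v ≤ lsT m a u ∧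
    (0 < u → lsT m a u ≤ a (lsE m a u) * ENNReal.ofReal (v - u) + lsT m a v) := by
  have huy := huv.trans hv
  have hv0 := hu.trans huv
  have e1 := (h.E_spec huy hy).1
  have e12 : lsE m a u ≤ lsE m a v := by
    have := h.E_spec hv hy
    exact E_le (huv.trans this.2) this.1
  have hi := h.incr e1 e12
  rw [h.D_E hu huy hy, h.D_E hv0 hv hy] at hi
  rw [h.T_E huy hy, h.T_E hv hy]
  have hsplit : m (Set.Ici (lsE m a u)) =
      m (Set.Ioc (lsE m a u) (lsE m a v)) + m (Set.Ici (lsE m a v)) := by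
    have : NullSingletonClass m := ⟨h.atom⟩
    rw [← measure_congr (Ioi_ae_eq_Ici (a := lsE m a u)),
      ← measure_congr (Ioi_ae_eq_Ici (a := lsE m a v)), ← Set.Ioc_union_Ioi_eq_Ioi e12,
      measure_union _ measurableSet_Ioi]
    rw [Set.disjoint_left]
    intro s hs hs'
    exact absurd hs.2 (not_le.2 hs')
  rw [hsplit]
  constructor
  · gcongr
    rw [← hi]
    calc _ ≤ a (lsE m a v) * ((a (lsE m a v))⁻¹ * m (Set.Ioc (lsE m a u) (lsE m a v))) := by
          gcongr
          rw [← setLIntegral_const]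
          apply setLIntegral_mono' measurableSet_Ioc
          intro s hs
          exact ENNReal.inv_le_inv.2 (h.anti hs.2)
      _ ≤ 1 * m (Set.Ioc (lsE m a u) (lsE m a v)) := by
          rw [← mul_assoc]
          gcongr
          exact ENNReal.mul_inv_le_one _
      _ = _ := one_mul _
  · intro hu0
    gcongr
    rw [← hi]
    have hep := h.E_pos hu0 huy hy
    by_cases ha0 : a (lsE m a u) = 0
    · -- then the integrand is infinite
      by_contra hc
      push Not at hc
      have hz : ∀ s ∈ Set.Ioc (lsE m a u) (lsE m a v), (⊤ : ℝ≥0∞) ≤ (a s)⁻¹ := by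
        intro s hs
        have : a s ≤ 0 := ha0 ▸ h.anti hs.1.le
        rw [nonpos_iff_eq_zero.1 this]; simp
      have h2 := setLIntegral_mono' (μ := m) measurableSet_Ioc hz
      rw [setLIntegral_const, hi, ENNReal.top_mul (by rw [ha0, zero_mul] at hc; exact hc.ne')] at h2
      exact ENNReal.ofReal_ne_top (top_le_iff.1 h2)
    calc m (Set.Ioc (lsE m a u) (lsE m a v))
        = a (lsE m a u) * ((a (lsE m a u))⁻¹ * m (Set.Ioc (lsE m a u) (lsE m a v))) := by
          rw [← mul_assoc, ENNReal.mul_inv_cancel ha0 (h.afin _ hep).ne, one_mul]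
      _ ≤ _ := by
          gcongr
          rw [← setLIntegral_const]
          apply setLIntegral_mono' measurableSet_Ioc
          intro s hs
          exact ENNReal.inv_le_inv.2 (h.anti hs.1.le)

theorem T_cont (h : LSide m a) : Continuous (fun v => (lsT m a v).toReal) := by
  have := h.fin
  set k : Measure ℝ := (m.restrict (Set.Ici 0)).map (lsD m a) with hk
  have hTk : ∀ v, lsT m a v = k (Set.Ici v) := by
    intro v
    rw [hk, Measure.map_apply h.mono.measurable measurableSet_Ici,
      Measure.restrict_apply (h.mono.measurable measurableSet_Ici)]
    unfold lsT
    congr 1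
    ext s
    simp [and_comm]
  have : NullSingletonClass k := by
    constructor
    intro v
    rw [hk, Measure.map_apply h.mono.measurable (measurableSet_singleton v),
      Measure.restrict_apply (h.mono.measurable (measurableSet_singleton v))]
    by_cases hy : ∃ y, 0 ≤ y ∧ v = lsD m a y
    · obtain ⟨y, hy, rfl⟩ := hy
      have hE := h.E_spec le_rfl hy
      have hDE := h.D_E (nonneg y) le_rfl hy
      refine measure_mono_null
        (t := {lsE m a (lsD m a y)} ∪ ⋃ k : ℕ, (if lsD m a k ≤ lsD m a y then
          Set.Ioc (lsE m a (lsD m a y)) k else ∅) ∪ Set.Ioc (lsE m a (lsD m a y))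
            (sSup (lsD m a ⁻¹' {lsD m a y}))) ?_ ?_
      · rintro s ⟨hs, hs0⟩
        have hs : lsD m a s = lsD m a y := hs
        rcases (E_le hs.ge hs0 : lsE m a (lsD m a y) ≤ s).eq_or_lt with h1 | h1
        · left; exact h1.symm
        · right
          by_cases hb : ∀ k : ℕ, lsD m a k ≤ lsD m a y
          · obtain ⟨k, hk⟩ := exists_nat_ge s
            refine Set.mem_iUnion.2 ⟨k, Or.inl ?_⟩
            rw [if_pos (hb k)]
            exact ⟨h1, hk⟩
          · push Not at hb
            obtain ⟨k, hk⟩ := hb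
            refine Set.mem_iUnion.2 ⟨0, Or.inr ⟨h1, le_csSup ⟨k, ?_⟩ hs⟩⟩
            intro z hz
            have hz : lsD m a z = lsD m a y := hz
            by_contra hc
            have := h.mono (not_le.1 hc).le
            linarith
      · refine measure_union_null (h.atom _) (measure_iUnion_null fun j => measure_union_null ?_ ?_)
        · split_ifs with hj
          · exact h.null hE.1 (by rw [hDE]; exact hj)
          · simp
        · by_cases hb : BddAbove (lsD m a ⁻¹' {lsD m a y})
          · apply h.null hE.1
            rw [hDE]
            have : IsClosed (lsD m a ⁻¹' {lsD m a y}) := isClosed_singleton.preimage h.cont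
            exact (this.csSup_mem ⟨y, rfl⟩ hb).le
          · rw [Real.sSup_of_not_bddAbove hb, Set.Ioc_eq_empty (not_lt.2 hE.1)]; simp
    · convert measure_empty (μ := m)
      ext s
      simp only [Set.mem_inter_iff, Set.mem_preimage, Set.mem_singleton_iff, Set.mem_Ici,
        Set.mem_empty_iff_false, iff_false, not_and]
      intro h1 h2
      exact hy ⟨s, h2, h1.symm⟩
  have hint : ∀ x y, IntervalIntegrable (fun _ => (1:ℝ)) k x y := fun x y => by simp
  have hc := intervalIntegral.continuous_primitive hint (0:ℝ)
  have : (fun v => (lsT m a v).toReal)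
      = fun v => k.real Set.univ - (∫ s in (0:ℝ)..v, (1:ℝ) ∂k) - k.real (Set.Iic 0) := by
    funext v
    have hio : ∀ y, IntegrableOn (fun _ => (1:ℝ)) (Set.Iic y) k := fun y => integrable_const _
    have h1 := intervalIntegral.integral_Iic_sub_Iic (hio 0) (hio v)
    rw [← h1]
    have h3 : (lsT m a v).toReal = k.real (Set.Ioi v) := by
      rw [hTk, ← measure_congr (Ioi_ae_eq_Ici (a := v))]; rfl
    have h4 : k.real (Set.Ioi v) = k.real Set.univ - k.real (Set.Iic v) := by
      rw [← Set.compl_Iic, measureReal_compl measurableSet_Iic]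
    rw [h3, h4]
    simp
    ring
  rw [this]
  exact (continuous_const.sub hc).sub continuous_const

end LSide

end LSAux

section LSAux2

noncomputable def lsN (a : ℝ → ℝ≥0∞) (ψ : ℝ → ℝ≥0∞) (l : ℝ) : ℝ≥0∞ :=
  if {y : ℝ | 0 ≤ y ∧ ENNReal.ofReal l ≤ ψ y}.Nonempty then
    a (sInf {y : ℝ | 0 ≤ y ∧ ENNReal.ofReal l ≤ ψ y}) else 0

namespace LSide

variable {m : Measure ℝ} {a : ℝ → ℝ≥0∞}

theorem map_D (h : LSide m a) {y : ℝ} (hy : 0 ≤ y) :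
    ((m.restrict (Set.Icc 0 y)).withDensity (fun s => (a s)⁻¹)).map (lsD m a)
      = volume.restrict (Set.Icc 0 (lsD m a y)) := by
  have hfin : IsFiniteMeasure ((m.restrict (Set.Icc 0 y)).withDensity (fun s => (a s)⁻¹)) :=
    isFiniteMeasure_withDensity (h.dfin y).ne
  apply Measure.ext_of_Iic
  intro v
  have hms := h.mono.measurable (measurableSet_Iic (a := v))
  rw [Measure.map_apply h.mono.measurable measurableSet_Iic, withDensity_apply _ hms,
    Measure.restrict_restrict hms, Measure.restrict_apply measurableSet_Iic]
  rcases lt_or_ge v 0 with hv | hv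
  · have e1 : lsD m a ⁻¹' Set.Iic v ∩ Set.Icc 0 y = ∅ := by
      ext s
      simp only [Set.mem_inter_iff, Set.mem_preimage, Set.mem_Iic, Set.mem_empty_iff_false,
        iff_false, not_and]
      intro h1
      have := nonneg (m := m) (a := a) s
      linarith
    have e2 : Set.Iic v ∩ Set.Icc 0 (lsD m a y) = ∅ := by
      ext s
      simp only [Set.mem_inter_iff, Set.mem_Iic, Set.mem_empty_iff_false, Set.mem_Icc,
        iff_false, not_and]
      intro h1 h2
      linarith
    rw [e1, e2]; simp
  rcases le_total (lsD m a y) v with hvy | hvy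
  · have e1 : lsD m a ⁻¹' Set.Iic v ∩ Set.Icc 0 y = Set.Icc 0 y := by
      apply Set.inter_eq_right.2
      intro s hs
      exact (h.mono hs.2).trans hvy
    have e2 : Set.Iic v ∩ Set.Icc 0 (lsD m a y) = Set.Icc 0 (lsD m a y) := by
      apply Set.inter_eq_right.2
      intro s hs
      exact hs.2.trans hvy
    rw [e1, e2, Real.volume_Icc, ← h.ofD, sub_zero]
  · set S := lsD m a ⁻¹' Set.Iic v ∩ Set.Icc 0 y with hS
    have hcl : IsClosed S := (isClosed_Iic.preimage h.cont).inter isClosed_Icc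
    have hE := h.E_spec hvy hy
    have hDE := h.D_E hv hvy hy
    have hES : lsE m a v ∈ S := ⟨hDE.le, hE.1, E_le hvy hy⟩
    have hbd : BddAbove S := ⟨y, fun s hs => hs.2.2⟩
    have hr := hcl.csSup_mem ⟨_, hES⟩ hbd
    have hEr := le_csSup hbd hES
    set r := sSup S
    have e1 : S = Set.Icc 0 r := by
      ext s
      constructor
      · intro hs; exact ⟨hs.2.1, le_csSup hbd hs⟩
      · intro hs; exact ⟨(h.mono hs.2).trans hr.1, hs.1, hs.2.trans hr.2.2⟩
    have e2 : Set.Iic v ∩ Set.Icc 0 (lsD m a y) = Set.Icc 0 v := by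
      ext s
      simp only [Set.mem_inter_iff, Set.mem_Iic, Set.mem_Icc]
      constructor
      · rintro ⟨h1, h2, h3⟩; exact ⟨h2, h1⟩
      · rintro ⟨h1, h2⟩; exact ⟨h2, h1, h2.trans hvy⟩
    have e3 : lsD m a r = v := le_antisymm hr.1 (hDE ▸ h.mono hEr)
    rw [e1, e2, Real.volume_Icc, ← h.ofD, e3, sub_zero]

theorem psi_eq (h : LSide m a) {f : ℝ → ℝ≥0∞} (hf : Measurable f) (hft : ∀ u, f u ≠ ⊤)
    {y : ℝ} (hy : 0 ≤ y) :
    ∫⁻ s in Set.Icc 0 y, (a s * f (lsD m a s))⁻¹ ∂m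
      = ∫⁻ u in Set.Icc 0 (lsD m a y), (f u)⁻¹ := by
  rw [← h.map_D hy, lintegral_map (f := fun u => (f u)⁻¹) hf.inv h.mono.measurable,
    lintegral_withDensity_eq_lintegral_mul _ (f := fun s => (a s)⁻¹) h.meas.inv
      (g := fun s => (f (lsD m a s))⁻¹) ((hf.comp h.mono.measurable).inv)]
  apply setLIntegral_congr_fun_ae measurableSet_Icc
  have h0 : ∀ᵐ s ∂m, s ≠ 0 := by
    rw [ae_iff]; simpa using h.atom 0
  filter_upwards [h0] with s hs0 hs
  have : 0 < s := lt_of_le_of_ne hs.1 hs0.symm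
  simp only [Pi.mul_apply]
  exact ENNReal.mul_inv (Or.inr (hft _)) (Or.inl (h.afin s this).ne)

theorem N_bd (h : LSide m a) {H ψ : ℝ → ℝ≥0∞} (hH : Monotone H)
    (hψ : ∀ y, 0 ≤ y → ψ y = H (lsD m a y)) {u v y l : ℝ} (hu : 0 ≤ u) (huv : u ≤ v)
    (hv : v ≤ lsD m a y) (hy : 0 ≤ y)
    (hl1 : H u < ENNReal.ofReal l) (hl2 : ENNReal.ofReal l ≤ H v) :
    a (lsE m a v) ≤ lsN a ψ l ∧ lsN a ψ l ≤ a (lsE m a u) := by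
  have hE := h.E_spec hv hy
  have hDE := h.D_E (hu.trans huv) hv hy
  have hmem : lsE m a v ∈ {y : ℝ | 0 ≤ y ∧ ENNReal.ofReal l ≤ ψ y} := by
    refine ⟨hE.1, ?_⟩
    rw [hψ _ hE.1, hDE]; exact hl2
  have hne : {y : ℝ | 0 ≤ y ∧ ENNReal.ofReal l ≤ ψ y}.Nonempty := ⟨_, hmem⟩
  unfold lsN
  rw [if_pos hne]
  constructor
  · exact h.anti (csInf_le ⟨0, fun _ hs => hs.1⟩ hmem)
  · apply h.anti
    apply le_csInf hne
    rintro z ⟨hz0, hz⟩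
    rw [hψ z hz0] at hz
    apply E_le _ hz0
    by_contra hc
    exact absurd (hH (not_le.1 hc).le) (not_le.2 (hl1.trans_le hz))

end LSide

theorem ls_partition {E P : ℝ → ℝ} {x w : ℝ} (hxw : x ≤ w)
    (hE : ∀ u v, x ≤ u → u ≤ v → v ≤ w → |E v - E u| ≤ (P v - P u) * (v - u)) :
    E w = E x := by
  have key : ∀ N : ℕ, 0 < N → |E w - E x| ≤ (P w - P x) * (w - x) / N := by
    intro N hN
    have hN' : (0:ℝ) < N := by exact_mod_cast hN
    set δ := (w - x) / N with hδ
    have hδ0 : 0 ≤ δ := div_nonneg (by linarith) hN'.le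
    have hNδ : N * δ = w - x := by rw [hδ]; field_simp
    have ind : ∀ k : ℕ, k ≤ N → |E (x + k * δ) - E x| ≤ (P (x + k * δ) - P x) * δ := by
      intro k
      induction k with
      | zero => intro _; simp
      | succ k ih =>
        intro hk
        have h1 := ih (by omega)
        have hk' : ((k + 1 : ℕ) : ℝ) ≤ N := by exact_mod_cast hk
        have h3 : ((k + 1 : ℕ) : ℝ) * δ ≤ w - x := by
          rw [← hNδ]; exact mul_le_mul_of_nonneg_right hk' hδ0
        have hkδ : 0 ≤ (k:ℝ) * δ := by positivity
        push_cast at h3 ⊢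
        have h2 := hE (x + k * δ) (x + (k + 1) * δ) (by linarith) (by linarith) (by linarith)
        have h4 : x + (k + 1) * δ - (x + k * δ) = δ := by ring
        rw [h4] at h2
        calc |E (x + (k + 1) * δ) - E x|
            = |(E (x + (k + 1) * δ) - E (x + k * δ)) + (E (x + k * δ) - E x)| := by
              congr 1; ring
          _ ≤ _ := abs_add_le _ _
          _ ≤ (P (x + (k + 1) * δ) - P (x + k * δ)) * δ + (P (x + k * δ) - P x) * δ :=
              add_le_add h2 h1
          _ = _ := by ring
    have := ind N le_rfl
    rw [hNδ] at this
    have e : x + (w - x) = w := by ring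
    rw [e] at this
    rw [hδ] at this
    rw [mul_div_assoc]; exact this
  have hlim : Tendsto (fun N : ℕ => (P w - P x) * (w - x) / N) atTop (𝓝 0) :=
    tendsto_const_div_atTop_nhds_zero_nat _
  have : |E w - E x| ≤ 0 := by
    apply ge_of_tendsto hlim
    filter_upwards [eventually_gt_atTop 0] with N hN using key N hN
  have := abs_nonpos_iff.1 this
  linarith

theorem ls_core {x w : ℝ} (hxw : x ≤ w) {q A h f : ℝ → ℝ}
    (hq : ∀ v, x ≤ v → v ≤ w → 0 < q v) (hA : ∀ v, x ≤ v → v ≤ w → 0 ≤ A v)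
    (hAa : ∀ u v, x ≤ u → u ≤ v → v ≤ w → A v ≤ A u)
    (H1 : ∀ u v, x ≤ u → u ≤ v → v ≤ w → A v * (v - u) ≤ q u - q v ∧ q u - q v ≤ A u * (v - u))
    (H2 : ∀ u v, x ≤ u → u ≤ v → v ≤ w → (v - u) / q u ≤ h v - h u ∧ h v - h u ≤ (v - u) / q v)
    (H3 : ∀ u v, x ≤ u → u ≤ v → v ≤ w →
      A v * (h v - h u) ≤ f v - f u ∧ f v - f u ≤ A u * (h v - h u)) :
    f w - f x = Real.log (q x) - Real.log (q w) := by
  have key := ls_partition (E := fun v => f v + Real.log (q v))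
    (P := fun v => A x * (q v)⁻¹ - A v * (q w)⁻¹) hxw ?_
  · linarith
  intro u v hu huv hv
  have hqu := hq u hu (huv.trans hv)
  have hqv := hq v (hu.trans huv) hv
  have hqw := hq w hxw le_rfl
  have hAu := hA u hu (huv.trans hv)
  have hAv := hA v (hu.trans huv) hv
  have hAx := hAa x u le_rfl hu (huv.trans hv)
  have hAuv := hAa u v hu huv hv
  obtain ⟨p1, p2⟩ := H1 u v hu huv hv
  obtain ⟨p3, p4⟩ := H2 u v hu huv hv
  obtain ⟨p5, p6⟩ := H3 u v hu huv hv
  have hd : 0 ≤ v - u := by linarith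
  have hquv : q v ≤ q u := by nlinarith
  have hqwu : q w ≤ q u := by
    have := (H1 u w hu (huv.trans hv) le_rfl).1
    have h2 := hA w hxw le_rfl
    have : 0 ≤ A w * (w - u) := mul_nonneg h2 (by linarith)
    linarith
  -- bounds in common interval
  have f1 : A v * (v - u) * (q u)⁻¹ ≤ f v - f u := by
    refine le_trans ?_ p5
    rw [mul_assoc]
    apply mul_le_mul_of_nonneg_left _ hAv
    rwa [div_eq_mul_inv] at p3
  have f2 : f v - f u ≤ A u * (v - u) * (q v)⁻¹ := by
    refine le_trans p6 ?_
    rw [mul_assoc]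
    apply mul_le_mul_of_nonneg_left _ hAu
    rwa [div_eq_mul_inv] at p4
  have g1 : A v * (v - u) * (q u)⁻¹ ≤ Real.log (q u) - Real.log (q v) := by
    have := Real.log_le_sub_one_of_pos (div_pos hqv hqu)
    rw [Real.log_div hqv.ne' hqu.ne'] at this
    have e : (q u - q v) * (q u)⁻¹ = 1 - q v / q u := by field_simp
    have : A v * (v - u) * (q u)⁻¹ ≤ (q u - q v) * (q u)⁻¹ :=
      mul_le_mul_of_nonneg_right p1 (inv_nonneg.2 hqu.le)
    linarith
  have g2 : Real.log (q u) - Real.log (q v) ≤ A u * (v - u) * (q v)⁻¹ := by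
    have := Real.log_le_sub_one_of_pos (div_pos hqu hqv)
    rw [Real.log_div hqu.ne' hqv.ne'] at this
    have e : (q u - q v) * (q v)⁻¹ = q u / q v - 1 := by field_simp
    have : (q u - q v) * (q v)⁻¹ ≤ A u * (v - u) * (q v)⁻¹ :=
      mul_le_mul_of_nonneg_right p2 (inv_nonneg.2 hqv.le)
    linarith
  have hinv : (q u)⁻¹ ≤ (q v)⁻¹ := inv_anti₀ hqv hquv
  have hinvw : (q u)⁻¹ ≤ (q w)⁻¹ := inv_anti₀ hqw hqwu
  have fin : A u * (v - u) * (q v)⁻¹ - A v * (v - u) * (q u)⁻¹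
      ≤ (A x * (q v)⁻¹ - A v * (q w)⁻¹ - (A x * (q u)⁻¹ - A u * (q w)⁻¹)) * (v - u) := by
    have t1 : A u * ((q v)⁻¹ - (q u)⁻¹) ≤ A x * ((q v)⁻¹ - (q u)⁻¹) :=
      mul_le_mul_of_nonneg_right hAx (by linarith)
    have t2 : (A u - A v) * (q u)⁻¹ ≤ (A u - A v) * (q w)⁻¹ :=
      mul_le_mul_of_nonneg_left hinvw (by linarith)
    have := mul_le_mul_of_nonneg_right (add_le_add t1 t2) hd
    nlinarith
  rw [abs_le]
  constructor <;> linarith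

end LSAux2

section LSAux3

noncomputable def lsQ (m₁ : Measure ℝ) (a₁ : ℝ → ℝ≥0∞) (m₂ : Measure ℝ) (a₂ : ℝ → ℝ≥0∞)
    (v : ℝ) : ℝ≥0∞ := lsT m₁ a₁ v + lsT m₂ a₂ v

noncomputable def lsH (m₁ : Measure ℝ) (a₁ : ℝ → ℝ≥0∞) (m₂ : Measure ℝ) (a₂ : ℝ → ℝ≥0∞)
    (v : ℝ) : ℝ≥0∞ := ∫⁻ u in Set.Icc 0 v, (lsQ m₁ a₁ m₂ a₂ u)⁻¹

variable {m₁ m₂ : Measure ℝ} {a₁ a₂ : ℝ → ℝ≥0∞}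

theorem lsQ_anti : Antitone (lsQ m₁ a₁ m₂ a₂) := fun _ _ h =>
  add_le_add (LSide.T_anti h) (LSide.T_anti h)

theorem lsH_mono : Monotone (lsH m₁ a₁ m₂ a₂) := fun _ _ h =>
  lintegral_mono_set (Set.Icc_subset_Icc_right h)

theorem lsQ_top (h₁ : LSide m₁ a₁) (h₂ : LSide m₂ a₂) (v : ℝ) : lsQ m₁ a₁ m₂ a₂ v ≠ ⊤ := by
  have := h₁.fin
  have := h₂.fin
  exact ENNReal.add_ne_top.2 ⟨measure_ne_top _ _, measure_ne_top _ _⟩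

theorem lsQ_cont (h₁ : LSide m₁ a₁) (h₂ : LSide m₂ a₂) :
    Continuous fun v => (lsQ m₁ a₁ m₂ a₂ v).toReal := by
  have := h₁.fin
  have := h₂.fin
  have e : (fun v => (lsQ m₁ a₁ m₂ a₂ v).toReal)
      = fun v => (lsT m₁ a₁ v).toReal + (lsT m₂ a₂ v).toReal := by
    funext v
    exact ENNReal.toReal_add (measure_ne_top _ _) (measure_ne_top _ _)
  rw [e]
  exact h₁.T_cont.add h₂.T_cont

/-- increments of H -/
theorem lsH_incr (_h₁ : LSide m₁ a₁) (_h₂ : LSide m₂ a₂) {w : ℝ} (hQw : 0 < lsQ m₁ a₁ m₂ a₂ w)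
    {u v : ℝ} (hu : 0 ≤ u) (huv : u ≤ v) (hvw : v ≤ w) :
    lsH m₁ a₁ m₂ a₂ v ≠ ⊤ ∧
    (v - u) / (lsQ m₁ a₁ m₂ a₂ u).toReal
      ≤ (lsH m₁ a₁ m₂ a₂ v).toReal - (lsH m₁ a₁ m₂ a₂ u).toReal ∧
    (lsH m₁ a₁ m₂ a₂ v).toReal - (lsH m₁ a₁ m₂ a₂ u).toReal
      ≤ (v - u) / (lsQ m₁ a₁ m₂ a₂ v).toReal := by
  set Q := lsQ m₁ a₁ m₂ a₂ with hQ
  have hQpos : ∀ z, z ≤ w → Q z ≠ 0 := fun z hz => (hQw.trans_le (lsQ_anti hz)).ne'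
  have hfin : ∀ z, z ≤ w → lsH m₁ a₁ m₂ a₂ z ≠ ⊤ := by
    intro z hz
    have : lsH m₁ a₁ m₂ a₂ z ≤ ∫⁻ _ in Set.Icc 0 z, (Q z)⁻¹ := by
      apply setLIntegral_mono' measurableSet_Icc
      intro s hs
      exact ENNReal.inv_le_inv.2 (lsQ_anti hs.2)
    rw [setLIntegral_const] at this
    refine (this.trans_lt (ENNReal.mul_lt_top ?_ ?_)).ne
    · exact (ENNReal.inv_ne_top.2 (hQpos z hz)).lt_top
    · rw [Real.volume_Icc]; exact ENNReal.ofReal_lt_top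
  have hsplit : lsH m₁ a₁ m₂ a₂ v = lsH m₁ a₁ m₂ a₂ u + ∫⁻ s in Set.Ioc u v, (Q s)⁻¹ := by
    unfold lsH
    rw [← Set.Icc_union_Ioc_eq_Icc hu huv, lintegral_union measurableSet_Ioc]
    rw [Set.disjoint_left]
    intro s hs hs'
    exact absurd hs.2 (not_le.2 hs'.1)
  have hI : ∫⁻ s in Set.Ioc u v, (Q s)⁻¹ ≠ ⊤ := by
    intro ht
    rw [ht] at hsplit
    exact hfin v hvw (by rw [hsplit]; simp)
  have hdiff : (lsH m₁ a₁ m₂ a₂ v).toReal - (lsH m₁ a₁ m₂ a₂ u).toReal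
      = (∫⁻ s in Set.Ioc u v, (Q s)⁻¹).toReal := by
    rw [hsplit, ENNReal.toReal_add (hfin u (huv.trans hvw)) hI]; ring
  have hconst : ∀ z, ((Q z)⁻¹ * volume (Set.Ioc u v)).toReal = (v - u) / (Q z).toReal := by
    intro z
    rw [ENNReal.toReal_mul, ENNReal.toReal_inv, Real.volume_Ioc,
      ENNReal.toReal_ofReal (by linarith), div_eq_inv_mul]
  refine ⟨hfin v hvw, ?_, ?_⟩
  · rw [hdiff, ← hconst]
    apply ENNReal.toReal_mono hI
    rw [← setLIntegral_const]
    apply setLIntegral_mono' measurableSet_Ioc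
    intro s hs
    exact ENNReal.inv_le_inv.2 (lsQ_anti hs.1.le)
  · rw [hdiff, ← hconst]
    apply ENNReal.toReal_mono
    · apply ENNReal.mul_ne_top (ENNReal.inv_ne_top.2 (hQpos v hvw))
      rw [Real.volume_Ioc]; exact ENNReal.ofReal_ne_top
    rw [← setLIntegral_const]
    apply setLIntegral_mono' measurableSet_Ioc
    intro s hs
    exact ENNReal.inv_le_inv.2 (lsQ_anti hs.2)

theorem ls_caseA (h₁ : LSide m₁ a₁) (h₂ : LSide m₂ a₂)
    (hQ0 : lsQ m₁ a₁ m₂ a₂ 0 = 1) {ψ₁ ψ₂ : ℝ → ℝ≥0∞}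
    (hψ₁ : ∀ y, 0 ≤ y → ψ₁ y = lsH m₁ a₁ m₂ a₂ (lsD m₁ a₁ y))
    (hψ₂ : ∀ y, 0 ≤ y → ψ₂ y = lsH m₁ a₁ m₂ a₂ (lsD m₂ a₂ y))
    {w y₁ y₂ : ℝ} (hw : 0 ≤ w) (hy₁ : 0 ≤ y₁) (hy₂ : 0 ≤ y₂) (hw₁ : w < lsD m₁ a₁ y₁)
    (hw₂ : w < lsD m₂ a₂ y₂) :
    0 < (lsQ m₁ a₁ m₂ a₂ w).toReal ∧
    ∫⁻ s in {s : ℝ | 0 < s ∧ ENNReal.ofReal s < lsH m₁ a₁ m₂ a₂ w}, (lsN a₁ ψ₁ s + lsN a₂ ψ₂ s)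
      = ENNReal.ofReal (- Real.log (lsQ m₁ a₁ m₂ a₂ w).toReal) := by
  have hQw : 0 < lsQ m₁ a₁ m₂ a₂ w :=
    (h₁.T_pos hw hw₁ hy₁).trans_le le_self_add
  set Q := lsQ m₁ a₁ m₂ a₂ with hQ
  set H := lsH m₁ a₁ m₂ a₂ with hH
  set g : ℝ → ℝ≥0∞ := fun s => lsN a₁ ψ₁ s + lsN a₂ ψ₂ s with hg
  have hQt : ∀ v, Q v ≠ ⊤ := lsQ_top h₁ h₂
  have hqpos : ∀ v, v ≤ w → 0 < (Q v).toReal := fun v hv =>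
    ENNReal.toReal_pos (hQw.trans_le (lsQ_anti hv)).ne' (hQt v)
  refine ⟨hqpos w le_rfl, ?_⟩
  have hHt : ∀ v, v ≤ w → H v ≠ ⊤ := by
    intro v hv
    have := (lsH_incr h₁ h₂ hQw hw le_rfl le_rfl).1
    exact ((lsH_mono hv).trans_lt this.lt_top).ne
  have hset : {s : ℝ | 0 < s ∧ ENNReal.ofReal s < H w} = Set.Ioo 0 (H w).toReal := by
    ext s
    simp only [Set.mem_ofPred_eq, Set.mem_Ioo]
    constructor
    · rintro ⟨h1, h2⟩
      exact ⟨h1, (ENNReal.ofReal_lt_iff_lt_toReal h1.le (hHt w le_rfl)).1 h2⟩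
    · rintro ⟨h1, h2⟩
      exact ⟨h1, (ENNReal.ofReal_lt_iff_lt_toReal h1.le (hHt w le_rfl)).2 h2⟩
  rw [hset]
  set hh : ℝ → ℝ := fun v => (H v).toReal with hhdef
  have hhmono : ∀ u v, u ≤ v → v ≤ w → hh u ≤ hh v := fun u v huv hv =>
    ENNReal.toReal_mono (hHt v hv) (lsH_mono huv)
  change ∫⁻ s in Set.Ioo 0 (hh w), g s = _
  set AA : ℝ → ℝ≥0∞ := fun v => a₁ (lsE m₁ a₁ v) + a₂ (lsE m₂ a₂ v) with hAA
  have hAt : ∀ v, 0 < v → v ≤ w → AA v ≠ ⊤ := by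
    intro v hv hvw
    exact ENNReal.add_ne_top.2
      ⟨(h₁.afin _ (h₁.E_pos hv (hvw.trans hw₁.le) hy₁)).ne,
       (h₂.afin _ (h₂.E_pos hv (hvw.trans hw₂.le) hy₂)).ne⟩
  have hJ : ∀ u v, 0 < u → u ≤ v → v ≤ w →
      AA v * ENNReal.ofReal (hh v - hh u) ≤ ∫⁻ s in Set.Ico (hh u) (hh v), g s ∧
      ∫⁻ s in Set.Ico (hh u) (hh v), g s ≤ AA u * ENNReal.ofReal (hh v - hh u) := by
    intro u v hu huv hv
    have hb : ∀ l ∈ Set.Ioo (hh u) (hh v), AA v ≤ g l ∧ g l ≤ AA u := by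
      intro l hl
      have hl0 : 0 ≤ l := le_trans ENNReal.toReal_nonneg hl.1.le
      have hl1 : H u < ENNReal.ofReal l :=
        (ENNReal.lt_ofReal_iff_toReal_lt (hHt u (huv.trans hv))).2 hl.1
      have hl2 : ENNReal.ofReal l ≤ H v :=
        ((ENNReal.ofReal_lt_iff_lt_toReal hl0 (hHt v hv)).2 hl.2).le
      have b1 := h₁.N_bd lsH_mono hψ₁ hu.le huv (hv.trans hw₁.le) hy₁ hl1 hl2
      have b2 := h₂.N_bd lsH_mono hψ₂ hu.le huv (hv.trans hw₂.le) hy₂ hl1 hl2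
      exact ⟨add_le_add b1.1 b2.1, add_le_add b1.2 b2.2⟩
    rw [← setLIntegral_congr (Ioo_ae_eq_Ico (a := hh u) (b := hh v)), ← Real.volume_Ioo,
      ← setLIntegral_const, ← setLIntegral_const]
    exact ⟨setLIntegral_mono' measurableSet_Ioo fun l hl => (hb l hl).1,
      setLIntegral_mono' measurableSet_Ioo fun l hl => (hb l hl).2⟩
  have hJt : ∀ u v, 0 < u → u ≤ v → v ≤ w → ∫⁻ s in Set.Ico (hh u) (hh v), g s ≠ ⊤ := by
    intro u v hu huv hv
    refine ((hJ u v hu huv hv).2.trans_lt (ENNReal.mul_lt_top ?_ ENNReal.ofReal_lt_top)).ne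
    exact (hAt u hu (huv.trans hv)).lt_top
  have main : ∀ x, 0 < x → x ≤ w → ∫⁻ s in Set.Ioo (hh x) (hh w), g s
      = ENNReal.ofReal (Real.log (Q x).toReal - Real.log (Q w).toReal) := by
    intro x hx hxw
    rw [setLIntegral_congr (Ioo_ae_eq_Ico (a := hh x) (b := hh w))]
    have hcore := ls_core hxw (q := fun v => (Q v).toReal) (A := fun v => (AA v).toReal)
      (h := hh) (f := fun v => (∫⁻ s in Set.Ico (hh x) (hh v), g s).toReal)
      (fun v _ hv => hqpos v hv) (fun v _ _ => ENNReal.toReal_nonneg) ?_ ?_ ?_ ?_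
    · rw [← hcore]
      simp only [Set.Ico_self, Measure.restrict_empty, lintegral_zero_measure,
        ENNReal.toReal_zero, sub_zero]
      rw [ENNReal.ofReal_toReal (hJt x w hx hxw le_rfl)]
    · intro u v hu huv hv
      apply ENNReal.toReal_mono (hAt u (hx.trans_le hu) (huv.trans hv))
      apply add_le_add
      · apply h₁.anti
        have := h₁.E_spec (hv.trans hw₁.le) hy₁
        exact LSide.E_le (huv.trans this.2) this.1
      · apply h₂.anti
        have := h₂.E_spec (hv.trans hw₂.le) hy₂
        exact LSide.E_le (huv.trans this.2) this.1
    · intro u v hu huv hv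
      have hu0 := hx.trans_le hu
      have d1 := h₁.T_diff hu0.le huv (hv.trans hw₁.le) hy₁
      have d2 := h₂.T_diff hu0.le huv (hv.trans hw₂.le) hy₂
      have s1 : AA v * ENNReal.ofReal (v - u) + Q v ≤ Q u := by
        have := add_le_add d1.1 d2.1
        refine le_trans (le_of_eq ?_) this
        simp only [hAA, hQ, lsQ]
        ring
      have s2 : Q u ≤ AA u * ENNReal.ofReal (v - u) + Q v := by
        have := add_le_add (d1.2 hu0) (d2.2 hu0)
        refine le_trans this (le_of_eq ?_)
        simp only [hAA, hQ, lsQ]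
        ring
      have t : ∀ z, 0 < z → z ≤ w → (AA z * ENNReal.ofReal (v - u) + Q v).toReal
          = (AA z).toReal * (v - u) + (Q v).toReal := by
        intro z hz hzw
        rw [ENNReal.toReal_add (ENNReal.mul_ne_top (hAt z hz hzw) ENNReal.ofReal_ne_top) (hQt v),
          ENNReal.toReal_mul, ENNReal.toReal_ofReal (by linarith)]
      have s1' := ENNReal.toReal_mono (hQt u) s1
      have s2' := ENNReal.toReal_mono (ENNReal.add_ne_top.2
        ⟨ENNReal.mul_ne_top (hAt u hu0 (huv.trans hv)) ENNReal.ofReal_ne_top, hQt v⟩) s2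
      rw [t v (hu0.trans_le huv) hv] at s1'
      rw [t u hu0 (huv.trans hv)] at s2'
      constructor <;> linarith
    · intro u v hu huv hv
      exact (lsH_incr h₁ h₂ hQw (hx.le.trans hu) huv hv).2
    · intro u v hu huv hv
      have hu0 := hx.trans_le hu
      have hadd : ∫⁻ s in Set.Ico (hh x) (hh v), g s
          = (∫⁻ s in Set.Ico (hh x) (hh u), g s) + ∫⁻ s in Set.Ico (hh u) (hh v), g s := by
        rw [← Set.Ico_union_Ico_eq_Ico (hhmono x u hu (huv.trans hv)) (hhmono u v huv hv),
          lintegral_union measurableSet_Ico]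
        rw [Set.disjoint_left]
        intro s hs hs'
        exact absurd hs.2 (not_lt.2 hs'.1)
      have hd : (∫⁻ s in Set.Ico (hh x) (hh v), g s).toReal
          - (∫⁻ s in Set.Ico (hh x) (hh u), g s).toReal
          = (∫⁻ s in Set.Ico (hh u) (hh v), g s).toReal := by
        rw [hadd, ENNReal.toReal_add (hJt x u hx hu (huv.trans hv)) (hJt u v hu0 huv hv)]
        ring
      have hhd : 0 ≤ hh v - hh u := sub_nonneg.2 (hhmono u v huv hv)
      have t : ∀ z, (AA z * ENNReal.ofReal (hh v - hh u)).toReal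
          = (AA z).toReal * (hh v - hh u) := by
        intro z
        rw [ENNReal.toReal_mul, ENNReal.toReal_ofReal hhd]
      obtain ⟨j1, j2⟩ := hJ u v hu0 huv hv
      rw [hd, ← t, ← t]
      exact ⟨ENNReal.toReal_mono (hJt u v hu0 huv hv) j1,
        ENNReal.toReal_mono (ENNReal.mul_ne_top (hAt u hu0 (huv.trans hv))
          ENNReal.ofReal_ne_top) j2⟩
  have hh0 : hh 0 = 0 := by
    simp [hhdef, hH, lsH]
  rcases hw.eq_or_lt with hw0 | hwpos
  · rw [← hw0, hh0, hQ0]; simp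
  -- let x → 0
  have hxn : ∀ k : ℕ, 0 < w / (k + 1) ∧ w / (k + 1) ≤ w := by
    intro k
    have : (0:ℝ) < k + 1 := by positivity
    refine ⟨by positivity, ?_⟩
    rw [div_le_iff₀ this]
    nlinarith [(Nat.cast_nonneg k : (0:ℝ) ≤ k)]
  have hxlim : Tendsto (fun k : ℕ => w / ((k:ℝ) + 1)) atTop (𝓝 0) := by
    have := (tendsto_one_div_add_atTop_nhds_zero_nat (𝕜 := ℝ)).const_mul w
    simpa [div_eq_mul_inv] using this
  have hmonoI : Monotone fun k : ℕ => Set.Ioo (hh (w / ((k:ℝ) + 1))) (hh w) := by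
    intro j k hjk
    apply Set.Ioo_subset_Ioo_left
    apply hhmono _ _ _ (hxn j).2
    have : (j:ℝ) ≤ k := by exact_mod_cast hjk
    apply div_le_div_of_nonneg_left hw (by positivity) (by linarith)
  have hUn : Set.Ioo 0 (hh w) = ⋃ k : ℕ, Set.Ioo (hh (w / ((k:ℝ) + 1))) (hh w) := by
    ext l
    simp only [Set.mem_Ioo, Set.mem_iUnion]
    constructor
    · rintro ⟨h1, h2⟩
      have hlim : Tendsto (fun k : ℕ => (w / ((k:ℝ) + 1)) / (Q w).toReal) atTop (𝓝 0) := by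
        simpa using hxlim.div_const (Q w).toReal
      obtain ⟨k, hk⟩ := (hlim.eventually (gt_mem_nhds h1)).exists
      refine ⟨k, ?_, h2⟩
      have i1 := (lsH_incr h₁ h₂ hQw le_rfl (hxn k).1.le (hxn k).2).2.2
      have i2 : (w / ((k:ℝ) + 1) - 0) / (Q (w / ((k:ℝ) + 1))).toReal
          ≤ (w / ((k:ℝ) + 1)) / (Q w).toReal := by
        rw [sub_zero]
        apply div_le_div_of_nonneg_left (hxn k).1.le (hqpos w le_rfl)
        exact ENNReal.toReal_mono (hQt _) (lsQ_anti (hxn k).2)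
      have i3 : hh (w / ((k:ℝ) + 1)) - hh 0 ≤ (w / ((k:ℝ) + 1) - 0) / (Q (w / ((k:ℝ) + 1))).toReal := i1
      linarith
    · rintro ⟨k, h1, h2⟩
      exact ⟨lt_of_le_of_lt ENNReal.toReal_nonneg h1, h2⟩
  rw [hUn, setLIntegral_iUnion_of_directed g hmonoI.directed_le]
  have hm2 : Monotone fun k : ℕ => ∫⁻ s in Set.Ioo (hh (w / ((k:ℝ) + 1))) (hh w), g s :=
    fun j k hjk => lintegral_mono_set (hmonoI hjk)
  refine tendsto_nhds_unique (tendsto_atTop_iSup hm2) ?_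
  have hl2 : Tendsto (fun k : ℕ => ENNReal.ofReal
      (Real.log (Q (w / ((k:ℝ) + 1))).toReal - Real.log (Q w).toReal)) atTop
      (𝓝 (ENNReal.ofReal (Real.log (Q 0).toReal - Real.log (Q w).toReal))) := by
    apply ENNReal.tendsto_ofReal
    apply Tendsto.sub_const
    apply Tendsto.log
    · exact ((lsQ_cont h₁ h₂).tendsto 0).comp hxlim
    · exact (hqpos 0 hw).ne'
  have e0 : Real.log (Q 0).toReal - Real.log (Q w).toReal = - Real.log (Q w).toReal := by
    rw [hQ0]; simp
  rw [e0] at hl2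
  refine hl2.congr fun k => (main _ (hxn k).1 (hxn k).2).symm

theorem ls_main (h₁ : LSide m₁ a₁) (h₂ : LSide m₂ a₂)
    (hQ0 : lsQ m₁ a₁ m₂ a₂ 0 = 1)
    (hc : ∀ v, (∃ y, 0 ≤ y ∧ v < lsD m₁ a₁ y) ↔ (∃ y, 0 ≤ y ∧ v < lsD m₂ a₂ y))
    {ψ₁ ψ₂ : ℝ → ℝ≥0∞}
    (hψ₁ : ∀ y, 0 ≤ y → ψ₁ y = lsH m₁ a₁ m₂ a₂ (lsD m₁ a₁ y))
    (hψ₂ : ∀ y, 0 ≤ y → ψ₂ y = lsH m₁ a₁ m₂ a₂ (lsD m₂ a₂ y))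
    {w : ℝ} (hw : 0 ≤ w) (hwy : ∃ y, 0 ≤ y ∧ (w ≤ lsD m₁ a₁ y ∨ w ≤ lsD m₂ a₂ y)) :
    expNegE (∫⁻ s in {s : ℝ | 0 < s ∧ ENNReal.ofReal s < lsH m₁ a₁ m₂ a₂ w},
      (lsN a₁ ψ₁ s + lsN a₂ ψ₂ s)) = (lsQ m₁ a₁ m₂ a₂ w).toReal := by
  by_cases hlt : ∃ y, 0 ≤ y ∧ w < lsD m₁ a₁ y
  · obtain ⟨y₂, hy₂, hw₂⟩ := (hc w).1 hlt
    obtain ⟨y₁, hy₁, hw₁⟩ := hlt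
    obtain ⟨hp, he⟩ := ls_caseA h₁ h₂ hQ0 hψ₁ hψ₂ hw hy₁ hy₂ hw₁ hw₂
    rw [he, expNegE, if_neg ENNReal.ofReal_ne_top, ENNReal.toReal_ofReal, neg_neg, Real.exp_log hp]
    have : (lsQ m₁ a₁ m₂ a₂ w).toReal ≤ 1 := by
      have := ENNReal.toReal_mono (lsQ_top h₁ h₂ 0) (lsQ_anti (m₁ := m₁) (a₁ := a₁) (m₂ := m₂) (a₂ := a₂) hw)
      rw [hQ0] at this
      simpa using this
    have := Real.log_nonpos hp.le this
    linarith
  · have hlt₂ : ¬ ∃ y, 0 ≤ y ∧ w < lsD m₂ a₂ y := fun h => hlt ((hc w).2 h)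
    push Not at hlt hlt₂
    have hQw : lsQ m₁ a₁ m₂ a₂ w = 0 := by
      unfold lsQ
      rw [h₁.T_top hw hlt, h₂.T_top hw hlt₂, add_zero]
    rw [hQw, ENNReal.toReal_zero, expNegE, if_pos]
    have hw0 : w ≠ 0 := by
      rintro rfl
      rw [hQ0] at hQw
      exact one_ne_zero hQw
    have hwpos : 0 < w := lt_of_le_of_ne hw hw0.symm
    set I := ∫⁻ s in {s : ℝ | 0 < s ∧ ENNReal.ofReal s < lsH m₁ a₁ m₂ a₂ w},
      (lsN a₁ ψ₁ s + lsN a₂ ψ₂ s) with hI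
    have hv : ∀ v, 0 ≤ v → v < w → 0 < (lsQ m₁ a₁ m₂ a₂ v).toReal ∧
        ENNReal.ofReal (- Real.log (lsQ m₁ a₁ m₂ a₂ v).toReal) ≤ I := by
      intro v hv hvw
      have hex : (∃ y, 0 ≤ y ∧ v < lsD m₁ a₁ y) := by
        obtain ⟨y, hy, h | h⟩ := hwy
        · exact ⟨y, hy, hvw.trans_le h⟩
        · exact (hc v).2 ⟨y, hy, hvw.trans_le h⟩
      obtain ⟨y₂, hy₂, hw₂⟩ := (hc v).1 hex
      obtain ⟨y₁, hy₁, hw₁⟩ := hex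
      obtain ⟨hp, he⟩ := ls_caseA h₁ h₂ hQ0 hψ₁ hψ₂ hv hy₁ hy₂ hw₁ hw₂
      refine ⟨hp, ?_⟩
      rw [← he]
      apply lintegral_mono_set
      intro s hs
      exact ⟨hs.1, hs.2.trans_le (lsH_mono hvw.le)⟩
    by_contra hIt
    have hb : ∀ v, 0 ≤ v → v < w → Real.exp (-I.toReal) ≤ (lsQ m₁ a₁ m₂ a₂ v).toReal := by
      intro v hv0 hvw
      obtain ⟨hp, hl⟩ := hv v hv0 hvw
      have := (ENNReal.ofReal_le_iff_le_toReal hIt).1 hl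
      rw [← Real.le_log_iff_exp_le hp]
      linarith
    have hlim := ((lsQ_cont h₁ h₂).tendsto w).mono_left (nhdsWithin_le_nhds (s := Set.Iio w))
    have hge : Real.exp (-I.toReal) ≤ (lsQ m₁ a₁ m₂ a₂ w).toReal := by
      apply ge_of_tendsto hlim
      filter_upwards [Ioo_mem_nhdsLT hwpos] with v hv' using hb v hv'.1.le hv'.2
    rw [hQw] at hge
    have := Real.exp_pos (-I.toReal)
    simp at hge
    linarith

end LSAux3

section LSAux4

theorem ls_dfin {m : Measure ℝ} [IsFiniteMeasure m] {a : ℝ → ℝ≥0∞} (ha : Antitone a)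
    (hs : ∀ x ∈ measSupport m, 0 < a x) (y : ℝ) :
    ∫⁻ s in Set.Icc 0 y, (a s)⁻¹ ∂m < ⊤ := by
  have hop : ∀ x, x ∉ measSupport m → ∃ U, IsOpen U ∧ x ∈ U ∧ m U = 0 := by
    intro x hx
    simp only [measSupport, Set.mem_ofPred_eq, not_forall] at hx
    obtain ⟨U, hU, hxU, h0⟩ := hx
    exact ⟨U, hU, hxU, by simpa using h0⟩
  have hcl : IsClosed (measSupport m) := by
    rw [← isOpen_compl_iff, isOpen_iff_mem_nhds]
    intro x hx
    obtain ⟨U, hU, hxU, h0⟩ := hop x hx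
    refine mem_of_superset (hU.mem_nhds hxU) ?_
    intro z hz hz'
    exact (hz' U hU hz).ne' h0
  have hnull : m (measSupport m)ᶜ = 0 := by
    apply measure_null_of_locally_null
    intro x hx
    obtain ⟨U, hU, hxU, h0⟩ := hop x hx
    exact ⟨U, mem_nhdsWithin_of_mem_nhds (hU.mem_nhds hxU), h0⟩
  have hae : ∀ᵐ s ∂m, s ∈ measSupport m := by
    rw [ae_iff]; exact hnull
  by_cases hne : (measSupport m ∩ Set.Icc 0 y).Nonempty
  · have hK : IsCompact (measSupport m ∩ Set.Icc 0 y) := isCompact_Icc.inter_left hcl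
    obtain ⟨k, hk, hmax⟩ := hK.exists_isGreatest hne
    have : ∫⁻ s in Set.Icc 0 y, (a s)⁻¹ ∂m ≤ ∫⁻ _ in Set.Icc 0 y, (a k)⁻¹ ∂m := by
      apply setLIntegral_mono_ae' measurableSet_Icc
      filter_upwards [hae] with s hs1 hs2
      exact ENNReal.inv_le_inv.2 (ha (hmax ⟨hs1, hs2⟩))
    rw [setLIntegral_const] at this
    exact this.trans_lt (ENNReal.mul_lt_top (ENNReal.inv_lt_top.2 (hs k hk.1)) (measure_lt_top _ _))
  · rw [setLIntegral_measure_zero]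
    · simp
    refine measure_mono_null ?_ hnull
    intro s hs1 hs2
    exact hne ⟨s, hs2, hs1⟩

theorem ls_neg (μ : Measure ℝ) (f : ℝ → ℝ≥0∞) (x : ℝ) :
    ∫⁻ s in Set.Icc x 0, f s ∂μ = ∫⁻ t in Set.Icc 0 (-x), f (-t) ∂(μ.map Neg.neg) := by
  have hmp : MeasurePreserving (Neg.neg : ℝ → ℝ) μ (μ.map Neg.neg) :=
    ⟨measurable_neg, rfl⟩
  have := hmp.setLIntegral_comp_preimage_emb (MeasurableEquiv.neg ℝ).measurableEmbedding
    (fun t => f (-t)) (Set.Icc 0 (-x))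
  rw [← this]
  simp

end LSAux4

/-- Law of the stopped local time at the levels `ψ₊(y)`, `ψ₋(−x)`:
for `y > 0` in the support of `μ`,
`exp(−∫₀^{ψ₊(y)} [n((−∞,−φ₋(s)]) + n([φ₊(s),∞))] ds) = 1 + μ̄(y) − μ̄(G_μ⁻¹(D_μ(y)))`,
and for `x < 0` in the support of `μ`,
`exp(−∫₀^{ψ₋(−x)} [n((−∞,−φ₋(s)]) + n([φ₊(s),∞))] ds) = 1 + μ̄(D_μ⁻¹(G_μ(x))) − μ̄(x)`. -/
theorem lawStoppedLocalTime
    (μ n : MeasureTheory.Measure ℝ) [MeasureTheory.IsProbabilityMeasure μ]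
    (hatomless : ∀ x : ℝ, μ {x} = 0)
    (hneg : 0 < μ (Set.Iio (0 : ℝ))) (hpos : 0 < μ (Set.Ioi (0 : ℝ)))
    (hnfin : ∀ s : ℝ, 0 < s → n (Set.Ici s) < ⊤ ∧ n (Set.Iic (-s)) < ⊤)
    (hnsupp : ∀ x ∈ measSupport μ, 0 < n (Set.Iic x) ∧ 0 < n (Set.Ici x))
    (hcompat : (⨆ y : ℝ, Dmu μ n y) = (⨆ x : ℝ, Gmu μ n x))
    :
    (∀ y : ℝ, 0 < y → y ∈ measSupport μ →
        expNegE (cutInt μ n (psiPlus μ n y))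
          = 1 + (μ (Set.Ici y)).toReal - mubarGinv μ n (Dmu μ n y)) ∧
    (∀ x : ℝ, x < 0 → x ∈ measSupport μ →
        expNegE (cutInt μ n (psiMinus μ n (-x)))
          = 1 + mubarDinv μ n (Gmu μ n x) - (μ (Set.Ici x)).toReal) := by
  have hm₂ : ∀ z, (μ.map Neg.neg) (Set.Ici z) = μ (Set.Iic (-z)) := by
    intro z
    rw [Measure.map_apply measurable_neg measurableSet_Ici]
    congr 1
    ext s
    simp only [Set.mem_preimage, Set.mem_Ici, Set.mem_Iic]
    constructor <;> intro h <;> linarith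
  have hpr : IsProbabilityMeasure (μ.map Neg.neg) :=
    Measure.isProbabilityMeasure_map measurable_neg.aemeasurable
  have hns : NullSingletonClass μ := ⟨hatomless⟩
  have hcomp : ∀ x, (μ (Set.Iic x)).toReal = 1 - (μ (Set.Ici x)).toReal := by
    intro x
    rw [← measure_congr (Ioi_ae_eq_Ici (μ := μ) (a := x)), ← Set.compl_Iic]
    have := prob_add_prob_compl (μ := μ) (measurableSet_Iic (a := x))
    have h2 := congrArg ENNReal.toReal this
    rw [ENNReal.toReal_add (measure_ne_top _ _) (measure_ne_top _ _)] at h2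
    simp only [ENNReal.toReal_one] at h2
    linarith
  set m₂ : Measure ℝ := μ.map Neg.neg with hm₂def
  set a₁ : ℝ → ℝ≥0∞ := fun s => n (Set.Ici s) with ha₁
  set a₂ : ℝ → ℝ≥0∞ := fun s => n (Set.Iic (-s)) with ha₂
  have anti₁ : Antitone a₁ := fun x y hxy => measure_mono (Set.Ici_subset_Ici.2 hxy)
  have anti₂ : Antitone a₂ := fun x y hxy => measure_mono (Set.Iic_subset_Iic.2 (neg_le_neg hxy))
  have h₁ : LSide μ a₁ :=
    { fin := inferInstance
      atom := hatomless
      anti := anti₁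
      afin := fun s hs => (hnfin s hs).1
      dfin := ls_dfin anti₁ fun x hx => (hnsupp x hx).2 }
  have h₂ : LSide m₂ a₂ :=
    { fin := inferInstance
      atom := by
        intro x
        rw [hm₂def, Measure.map_apply measurable_neg (measurableSet_singleton x)]
        have : (Neg.neg ⁻¹' {x} : Set ℝ) = {-x} := by
          ext s; simp [neg_eq_iff_eq_neg]
        rw [this]; exact hatomless _
      anti := anti₂
      afin := fun s hs => (hnfin s hs).2
      dfin := by
        apply ls_dfin anti₂
        intro x hx
        refine (hnsupp (-x) ?_).1
        intro U hU hxU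
        have := hx (Neg.neg ⁻¹' U) (hU.preimage continuous_neg) hxU
        rw [hm₂def, Measure.map_apply measurable_neg
          ((hU.preimage continuous_neg).measurableSet)] at this
        simpa using this }
  have hD : ∀ y, Dmu μ n y = ENNReal.ofReal (lsD μ a₁ y) := fun y => (h₁.ofD y).symm
  have hG : ∀ x, Gmu μ n x = ENNReal.ofReal (lsD m₂ a₂ (-x)) := by
    intro x
    rw [h₂.ofD]
    exact ls_neg μ (fun s => (n (Set.Iic s))⁻¹) x
  have hQ0 : lsQ μ a₁ m₂ a₂ 0 = 1 := by
    unfold lsQ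
    rw [LSide.T_zero, LSide.T_zero, hm₂, neg_zero,
      ← measure_congr (Ioi_ae_eq_Ici (μ := μ) (a := 0)), ← Set.compl_Iic, add_comm]
    exact prob_add_prob_compl measurableSet_Iic
  have hc : ∀ v, (∃ y, 0 ≤ y ∧ v < lsD μ a₁ y) ↔ (∃ y, 0 ≤ y ∧ v < lsD m₂ a₂ y) := by
    intro v
    rcases lt_or_ge v 0 with hv | hv
    · exact ⟨fun _ => ⟨0, le_rfl, hv.trans_le (LSide.nonneg 0)⟩,
        fun _ => ⟨0, le_rfl, hv.trans_le (LSide.nonneg 0)⟩⟩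
    have k1 : (∃ y, 0 ≤ y ∧ v < lsD μ a₁ y) ↔ ENNReal.ofReal v < ⨆ y, Dmu μ n y := by
      rw [lt_iSup_iff]
      constructor
      · rintro ⟨y, hy, hvy⟩
        exact ⟨y, by rw [hD]; exact (ENNReal.ofReal_lt_ofReal_iff_of_nonneg hv).2 hvy⟩
      · rintro ⟨y, hy⟩
        rw [hD, ENNReal.ofReal_lt_ofReal_iff_of_nonneg hv] at hy
        refine ⟨y, ?_, hy⟩
        by_contra hneg
        rw [h₁.zero (not_le.1 hneg).le] at hy
        linarith
    have k2 : (∃ y, 0 ≤ y ∧ v < lsD m₂ a₂ y) ↔ ENNReal.ofReal v < ⨆ x, Gmu μ n x := by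
      rw [lt_iSup_iff]
      constructor
      · rintro ⟨y, hy, hvy⟩
        refine ⟨-y, ?_⟩
        rw [hG, neg_neg]; exact (ENNReal.ofReal_lt_ofReal_iff_of_nonneg hv).2 hvy
      · rintro ⟨y, hy⟩
        rw [hG, ENNReal.ofReal_lt_ofReal_iff_of_nonneg hv] at hy
        refine ⟨-y, ?_, hy⟩
        by_contra hneg
        rw [h₂.zero (not_le.1 hneg).le] at hy
        linarith
    rw [k1, k2, hcompat]
  have hmD : ∀ v, 0 ≤ v → mubarDinv μ n (ENNReal.ofReal v) = (lsT μ a₁ v).toReal := by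
    intro v hv
    have hset : DinvSet μ n (ENNReal.ofReal v) = {y | 0 ≤ y ∧ v < lsD μ a₁ y} := by
      ext y
      simp only [DinvSet, Set.mem_ofPred_eq, hD, ENNReal.ofReal_lt_ofReal_iff_of_nonneg hv]
    rw [← h₁.T_inv hv, mubarDinv, hset]
    split_ifs <;> simp
  have hmG : ∀ v, 0 ≤ v → mubarGinv μ n (ENNReal.ofReal v) = 1 - (lsT m₂ a₂ v).toReal := by
    intro v hv
    have hset : GinvSet μ n (ENNReal.ofReal v) = -{y | 0 ≤ y ∧ v < lsD m₂ a₂ y} := by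
      ext y
      simp only [GinvSet, Set.mem_ofPred_eq, hG, ENNReal.ofReal_lt_ofReal_iff_of_nonneg hv,
        Set.mem_neg]
      constructor
      · rintro ⟨p, q⟩; exact ⟨by linarith, q⟩
      · rintro ⟨p, q⟩; exact ⟨by linarith, q⟩
    rw [← h₂.T_inv hv, mubarGinv, hset, Real.sSup_neg, Set.nonempty_neg, hm₂]
    split_ifs
    · rw [hcomp]; ring
    · simp
  have hTt₁ : ∀ v, lsT μ a₁ v ≠ ⊤ := fun v => measure_ne_top _ _
  have hTt₂ : ∀ v, lsT m₂ a₂ v ≠ ⊤ := fun v => measure_ne_top _ _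
  have hR₁ : ∀ y, 0 ≤ y → 1 + (μ (Set.Ici y)).toReal - mubarGinv μ n (Dmu μ n y)
      = (lsQ μ a₁ m₂ a₂ (lsD μ a₁ y)).toReal := by
    intro y hy
    rw [hD, hmG _ (LSide.nonneg y), lsQ, ENNReal.toReal_add (hTt₁ _) (hTt₂ _), h₁.T_D hy]
    ring
  have hR₂ : ∀ x, x ≤ 0 → 1 + mubarDinv μ n (Gmu μ n x) - (μ (Set.Ici x)).toReal
      = (lsQ μ a₁ m₂ a₂ (lsD m₂ a₂ (-x))).toReal := by
    intro x hx
    rw [hG, hmD _ (LSide.nonneg (-x)), lsQ, ENNReal.toReal_add (hTt₁ _) (hTt₂ _),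
      h₂.T_D (by linarith), hm₂, neg_neg, hcomp]
    ring
  have hQm : Measurable (lsQ μ a₁ m₂ a₂) := lsQ_anti.measurable
  have hQt := lsQ_top h₁ h₂
  have hψ₁ : ∀ y, 0 ≤ y → psiPlus μ n y = lsH μ a₁ m₂ a₂ (lsD μ a₁ y) := by
    intro y hy
    rw [lsH, ← h₁.psi_eq hQm hQt hy, psiPlus]
    apply setLIntegral_congr_fun measurableSet_Icc
    intro s hs
    simp only [psiPlusIntegrand]
    rw [hR₁ s hs.1, ENNReal.ofReal_toReal (hQt _)]
  have hψ₂ : ∀ y, 0 ≤ y → psiMinus μ n y = lsH μ a₁ m₂ a₂ (lsD m₂ a₂ y) := by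
    intro y hy
    rw [lsH, ← h₂.psi_eq hQm hQt hy, psiMinus, ls_neg, neg_neg]
    apply setLIntegral_congr_fun measurableSet_Icc
    intro s hs
    simp only [psiMinusIntegrand]
    rw [hR₂ (-s) (by linarith [hs.1]), ENNReal.ofReal_toReal (hQt _), neg_neg]
  have hcut : ∀ L, cutInt μ n L = ∫⁻ s in {s : ℝ | 0 < s ∧ ENNReal.ofReal s < L},
      (lsN a₁ (psiPlus μ n) s + lsN a₂ (psiMinus μ n) s) := by
    intro L
    unfold cutInt
    congr 1
    funext s
    exact add_comm _ _
  constructor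
  · intro y hy _
    rw [hcut, hψ₁ y hy.le, hR₁ y hy.le]
    exact ls_main h₁ h₂ hQ0 hc hψ₁ hψ₂ (LSide.nonneg y) ⟨y, hy.le, Or.inl le_rfl⟩
  · intro x hx _
    have hx' : 0 ≤ -x := by linarith
    rw [hcut, hψ₂ (-x) hx', hR₂ x hx.le]
    exact ls_main h₁ h₂ hQ0 hc hψ₁ hψ₂ (LSide.nonneg (-x)) ⟨-x, hx', Or.inr le_rfl⟩
end

section
/- For every y > 0: μ̄(y) = ∫_{ψ₊(y)}^∞ n([φ₊(l),∞)) · ρ(l) dl. (This is the analytic identity expressing that the two-sided stopping time T of Theorem 1 satisfies P(F_T ≥ y) = μ̄(y) for y > 0.) -/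
open MeasureTheory Filter
open scoped ENNReal Topology Classical

namespace UT

theorem cdf_mono (ν : Measure ℝ) : Monotone (fun s => ν (Set.Iic s)) :=
  fun _ _ h => measure_mono (Set.Iic_subset_Iic.2 h)

theorem cdf_le (ν : Measure ℝ) [NullSingletonClass ν] (h0 : ν (Set.Iic 0) = 0)
    (hinf : ν {s | ν (Set.Iic s) = ⊤} = 0) (c : ℝ≥0∞) (_hc : c ≠ ⊤) :
    ν {s | ν (Set.Iic s) ≤ c} = min c (ν Set.univ) := by
  have hsup : ν Set.univ = ⨆ x : ℝ, ν (Set.Iic x) :=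
    tendsto_nhds_unique (tendsto_measure_Iic_atTop ν) (tendsto_atTop_iSup (cdf_mono ν))
  by_cases hcV : ν Set.univ ≤ c
  · rw [min_eq_right hcV]
    congr 1
    ext s
    simp only [Set.mem_ofPred_eq, Set.mem_univ, iff_true]
    exact (measure_mono (Set.subset_univ _)).trans hcV
  push Not at hcV
  rw [min_eq_left hcV.le]
  obtain ⟨M, hM⟩ : ∃ M : ℝ, c < ν (Set.Iic M) := by
    rw [hsup] at hcV
    exact lt_iSup_iff.1 hcV
  set S : Set ℝ := {s | ν (Set.Iic s) ≤ c} with hS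
  have hbdd : BddAbove S := by
    refine ⟨M, fun s hs => ?_⟩
    by_contra hlt
    push Not at hlt
    exact absurd (hM.trans_le (cdf_mono ν hlt.le)) (not_lt.2 hs)
  have hne : S.Nonempty := ⟨0, by simp [hS, h0]⟩
  set t := sSup S with ht
  have hFt : ν (Set.Iic t) ≤ c := by
    obtain ⟨u, hu, hut, hul⟩ := exists_seq_strictMono_tendsto t
    have e : Set.Iio t = ⋃ n, Set.Iic (u n) :=
      (iUnion_Iic_eq_Iio_of_lt_of_tendsto hut hul).symm
    rw [← measure_congr (Iio_ae_eq_Iic (μ := ν) (a := t)), e,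
      (Monotone.directed_le (fun i j hij => Set.Iic_subset_Iic.2 (hu.monotone hij))).measure_iUnion]
    refine iSup_le fun n => ?_
    obtain ⟨s, hs, hns⟩ := exists_lt_of_lt_csSup hne (hut n)
    exact (cdf_mono ν hns.le).trans hs
  have hSt : S = Set.Iic t := by
    ext s
    refine ⟨fun hs => le_csSup hbdd hs, fun hs => (cdf_mono ν hs).trans hFt⟩
  rw [hSt]
  refine le_antisymm hFt ?_
  have hgt : ∀ x, t < x → c < ν (Set.Iic x) := by
    intro x hx
    by_contra hle
    push Not at hle
    exact absurd (le_csSup hbdd (show x ∈ S from hle)) (not_le.2 hx)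
  by_cases hx0 : ∃ x0 > t, ν (Set.Iic x0) ≠ ⊤
  · have := tendsto_measure_biInter_gt (μ := ν) (s := fun r : ℝ => Set.Iic r) (a := t)
      (fun r _ => measurableSet_Iic.nullMeasurableSet)
      (fun i j _ hij => Set.Iic_subset_Iic.2 hij) hx0
    have e : (⋂ r, ⋂ (_ : r > t), Set.Iic r) = Set.Iic t := by
      ext z
      simp only [Set.mem_iInter, Set.mem_Iic]
      exact ⟨fun h => le_of_forall_gt_imp_ge_of_dense h, fun h r hr => h.trans hr.le⟩
    rw [e] at this
    refine ge_of_tendsto this ?_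
    filter_upwards [self_mem_nhdsWithin] with x hx
    exact (hgt x hx).le
  · push Not at hx0
    have hz : ν (Set.Ioi t) = 0 :=
      measure_mono_null (fun x hx => hx0 x hx) hinf
    have : ν (Set.Iic (t+1)) ≤ ν (Set.Iic t) + ν (Set.Ioi t) := by
      refine (measure_mono ?_).trans (measure_union_le _ _)
      intro x _
      simp only [Set.mem_union, Set.mem_Iic, Set.mem_Ioi]
      exact le_or_gt x t
    rw [hz, add_zero] at this
    exact (hgt (t+1) (by linarith)).le.trans this

theorem cdf_meas (ν : Measure ℝ) : Measurable (fun s => ν (Set.Iic s)) :=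
  (cdf_mono ν).measurable

theorem cdf_eq_null (ν : Measure ℝ) [NullSingletonClass ν] (h0 : ν (Set.Iic 0) = 0)
    (hinf : ν {s | ν (Set.Iic s) = ⊤} = 0) (c : ℝ≥0∞) :
    ν {s | ν (Set.Iic s) = c} = 0 := by
  by_cases hc : c = ⊤
  · rw [hc]; exact hinf
  by_cases hc0 : c = 0
  · have := cdf_le ν h0 hinf c hc
    refine measure_mono_null (fun s hs => ?_) (this.trans (by simp [hc0]))
    exact le_of_eq hs
  have key : ∀ c' < c, ν {s | ν (Set.Iic s) = c} ≤ c - c' := by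
    intro c' hc'
    have h1 : {s | ν (Set.Iic s) = c} ⊆ {s | ν (Set.Iic s) ≤ c} \ {s | ν (Set.Iic s) ≤ c'} := by
      intro s hs
      simp only [Set.mem_ofPred_eq] at hs
      simp [hs, hc']
    refine (measure_mono h1).trans ?_
    have hsub : {s | ν (Set.Iic s) ≤ c'} ⊆ {s | ν (Set.Iic s) ≤ c} := fun s hs => le_trans hs hc'.le
    rw [measure_sdiff hsub
      (measurableSet_le (cdf_meas ν) measurable_const).nullMeasurableSet
      (by rw [cdf_le ν h0 hinf c' (ne_top_of_lt hc')]; exact ne_top_of_le_ne_top (ne_top_of_lt hc') (min_le_left _ _)),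
      cdf_le ν h0 hinf c hc, cdf_le ν h0 hinf c' (ne_top_of_lt hc')]
    rcases le_total (ν Set.univ) c' with hV | hV
    · rw [min_eq_right hV, min_eq_right (hV.trans hc'.le)]; simp
    · rw [min_eq_left hV]; exact tsub_le_tsub_right (min_le_left _ _) _
  by_contra hne
  set d := ν {s | ν (Set.Iic s) = c} with hd
  have hd0 : 0 < d := pos_iff_ne_zero.2 hne
  have hm : 0 < min d c := lt_min hd0 (pos_iff_ne_zero.2 hc0)
  have hdc : d ≤ c := by simpa using key 0 (pos_iff_ne_zero.2 hc0)
  obtain ⟨e, he0, hed⟩ := exists_between hd0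
  have hle : e ≤ c := hed.le.trans hdc
  have := key (c - e) (ENNReal.sub_lt_self hc hc0 he0.ne')
  rw [ENNReal.sub_sub_cancel hc hle] at this
  exact absurd hed (not_lt.2 this)

theorem cdf_strict (ν : Measure ℝ) [NullSingletonClass ν] (h0 : ν (Set.Iic 0) = 0)
    (hinf : ν {s | ν (Set.Iic s) = ⊤} = 0) :
    ∀ᵐ s ∂ν, ∀ y < s, ν (Set.Iic y) < ν (Set.Iic s) := by
  have h : ∀ᵐ s ∂ν, ∀ q : ℚ, ν (Set.Iic s) ≠ ν (Set.Iic (q : ℝ)) := by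
    rw [ae_all_iff]
    intro q
    rw [ae_iff]
    simpa using cdf_eq_null ν h0 hinf (ν (Set.Iic (q : ℝ)))
  filter_upwards [h] with s hs y hy
  obtain ⟨q, hq1, hq2⟩ := exists_rat_btwn hy
  exact (cdf_mono ν hq1.le).trans_lt (lt_of_le_of_ne (cdf_mono ν hq2.le) (hs q).symm)

theorem vol_aux (V : ℝ≥0∞) (b : ℝ) :
    volume ({x : ℝ | 0 < x ∧ ENNReal.ofReal x < V} ∩ Set.Iic b) = min (ENNReal.ofReal b) V := by
  by_cases hV : V = ⊤
  · have : ({x : ℝ | 0 < x ∧ ENNReal.ofReal x < V} ∩ Set.Iic b) = Set.Ioc 0 b := by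
      ext x; simp [hV]
    rw [this]; simp [hV]
  · rcases le_or_gt V (ENNReal.ofReal b) with h | h
    · have : ({x : ℝ | 0 < x ∧ ENNReal.ofReal x < V} ∩ Set.Iic b) = Set.Ioo 0 V.toReal := by
        ext x
        simp only [Set.mem_inter_iff, Set.mem_ofPred_eq, Set.mem_Iic, Set.mem_Ioo]
        constructor
        · rintro ⟨⟨h1, h2⟩, h3⟩
          exact ⟨h1, (ENNReal.ofReal_lt_iff_lt_toReal h1.le hV).1 h2⟩
        · rintro ⟨h1, h2⟩
          have h3 := (ENNReal.ofReal_lt_iff_lt_toReal h1.le hV).2 h2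
          refine ⟨⟨h1, h3⟩, ?_⟩
          exact ((ENNReal.ofReal_lt_ofReal_iff_of_nonneg h1.le).1 (h3.trans_le h)).le
      rw [this, min_eq_right h]; simp [hV]
    · have : ({x : ℝ | 0 < x ∧ ENNReal.ofReal x < V} ∩ Set.Iic b) = Set.Ioc 0 b := by
        ext x
        simp only [Set.mem_inter_iff, Set.mem_ofPred_eq, Set.mem_Iic, Set.mem_Ioc]
        constructor
        · rintro ⟨⟨h1, h2⟩, h3⟩
          exact ⟨h1, h3⟩
        · rintro ⟨h1, h2⟩
          exact ⟨⟨h1, (ENNReal.ofReal_le_ofReal h2).trans_lt h⟩, h2⟩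
      rw [this, min_eq_left h.le]; simp

theorem meas_cut (V : ℝ≥0∞) : MeasurableSet {x : ℝ | 0 < x ∧ ENNReal.ofReal x < V} :=
  (measurableSet_lt measurable_const measurable_id).inter
    (measurableSet_lt ENNReal.measurable_ofReal measurable_const)

theorem cdf_map (ν : Measure ℝ) [NullSingletonClass ν] (h0 : ν (Set.Iic 0) = 0)
    (hinf : ν {s | ν (Set.Iic s) = ⊤} = 0) :
    ν.map (fun s => (ν (Set.Iic s)).toReal) =
      volume.restrict {x : ℝ | 0 < x ∧ ENNReal.ofReal x < ν Set.univ} := by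
  have hm : Measurable (fun s => (ν (Set.Iic s)).toReal) := (cdf_meas ν).ennreal_toReal
  have hI : ∀ b : ℝ, (ν.map (fun s => (ν (Set.Iic s)).toReal)) (Set.Iic b) =
      (volume.restrict {x : ℝ | 0 < x ∧ ENNReal.ofReal x < ν Set.univ}) (Set.Iic b) := by
    intro b
    rw [Measure.map_apply hm measurableSet_Iic, Measure.restrict_apply measurableSet_Iic,
      Set.inter_comm, vol_aux]
    rw [← cdf_le ν h0 hinf _ ENNReal.ofReal_ne_top]
    apply measure_congr
    have hpos : ∀ᵐ s ∂ν, ν (Set.Iic s) ≠ 0 := by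
      rw [ae_iff]; simpa using cdf_eq_null ν h0 hinf 0
    have hf : ∀ᵐ s ∂ν, ν (Set.Iic s) ≠ ⊤ := by
      rw [ae_iff]; simpa using hinf
    filter_upwards [hpos, hf] with s h1 h2
    apply propext
    change (ν (Set.Iic s)).toReal ≤ b ↔ ν (Set.Iic s) ≤ ENNReal.ofReal b
    constructor
    · intro h; rw [← ENNReal.ofReal_toReal h2]; exact ENNReal.ofReal_le_ofReal h
    · intro h
      by_cases hb : 0 ≤ b
      · exact ENNReal.toReal_le_of_le_ofReal hb h
      · rw [ENNReal.ofReal_of_nonpos (not_le.1 hb).le] at h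
        exact absurd (le_antisymm h bot_le) h1
  have hfin : ∀ b : ℝ, (volume.restrict {x : ℝ | 0 < x ∧ ENNReal.ofReal x < ν Set.univ}) (Set.Iic b) ≠ ⊤ := by
    intro b
    rw [Measure.restrict_apply measurableSet_Iic, Set.inter_comm, vol_aux]
    exact ne_top_of_le_ne_top ENNReal.ofReal_ne_top (min_le_left _ _)
  symm
  refine Measure.ext_of_Ioc _ _ fun a b hab => ?_
  have e : Set.Ioc a b = Set.Iic b \ Set.Iic a := by
    ext x; simp [and_comm]
  rw [e, measure_sdiff (Set.Iic_subset_Iic.2 hab.le) measurableSet_Iic.nullMeasurableSet (hfin a),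
    measure_sdiff (Set.Iic_subset_Iic.2 hab.le) measurableSet_Iic.nullMeasurableSet
      (by rw [hI]; exact hfin a), hI, hI]

theorem cdf_lintegral (ν : Measure ℝ) [NullSingletonClass ν] (h0 : ν (Set.Iic 0) = 0)
    (hinf : ν {s | ν (Set.Iic s) = ⊤} = 0) (g : ℝ≥0∞ → ℝ≥0∞) (hg : Measurable g) :
    ∫⁻ s, g (ν (Set.Iic s)) ∂ν =
      ∫⁻ x in {x : ℝ | 0 < x ∧ ENNReal.ofReal x < ν Set.univ}, g (ENNReal.ofReal x) := by
  have hm : Measurable (fun s => (ν (Set.Iic s)).toReal) := (cdf_meas ν).ennreal_toReal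
  rw [← cdf_map ν h0 hinf, lintegral_map (show Measurable fun x => g (ENNReal.ofReal x) from hg.comp ENNReal.measurable_ofReal) hm]
  apply lintegral_congr_ae
  have hf : ∀ᵐ s ∂ν, ν (Set.Iic s) ≠ ⊤ := by
    rw [ae_iff]; simpa using hinf
  filter_upwards [hf] with s hs
  rw [ENNReal.ofReal_toReal hs]

/-- log integral -/
theorem log_int (a : ℝ) (ha0 : 0 ≤ a) (ha : a < 1) :
    ∫⁻ u in Set.Ioo (0 : ℝ) a, (1 - ENNReal.ofReal u)⁻¹ = ENNReal.ofReal (- Real.log (1 - a)) := by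
  have h1 : ∀ u ∈ Set.Ioo (0:ℝ) a, (1 - ENNReal.ofReal u)⁻¹ = ENNReal.ofReal ((1 - u)⁻¹) := by
    intro u hu
    rw [ENNReal.ofReal_inv_of_pos (by linarith [hu.2]), ENNReal.ofReal_sub _ hu.1.le, ENNReal.ofReal_one]
  rw [setLIntegral_congr_fun measurableSet_Ioo h1]
  have hcont : ContinuousOn (fun u : ℝ => (1 - u)⁻¹) (Set.Icc 0 a) := by
    apply ContinuousOn.inv₀ (by fun_prop)
    intro x hx; linarith [hx.2]
  rw [← ofReal_integral_eq_lintegral_ofReal]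
  · congr 1
    rw [← integral_Ioc_eq_integral_Ioo, ← intervalIntegral.integral_of_le ha0,
      intervalIntegral.integral_comp_sub_left (fun x => x⁻¹) 1,
      integral_inv_of_pos (by linarith) (by linarith)]
    rw [← Real.log_inv]; simp
  · exact (hcont.integrableOn_Icc).mono_set Set.Ioo_subset_Icc_self
  · filter_upwards [ae_restrict_mem measurableSet_Ioo] with u hu
    simp only [Pi.zero_apply, inv_nonneg]; linarith [hu.2]

theorem log_int_top :
    ∫⁻ u in {x : ℝ | 0 < x ∧ ENNReal.ofReal x < 1}, (1 - ENNReal.ofReal u)⁻¹ = ⊤ := by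
  by_contra hne
  set I := ∫⁻ u in {x : ℝ | 0 < x ∧ ENNReal.ofReal x < 1}, (1 - ENNReal.ofReal u)⁻¹ with hI
  have key : ∀ R : ℝ, 0 ≤ R → R ≤ I.toReal := by
    intro R hR
    have he : Real.exp (-R) ≤ 1 := by simpa using hR
    have hp := Real.exp_pos (-R)
    have h := log_int (1 - Real.exp (-R)) (by linarith) (by linarith)
    rw [sub_sub_cancel, Real.log_exp, neg_neg] at h
    have hle : ENNReal.ofReal R ≤ I := by
      rw [← h, hI]
      apply lintegral_mono_set
      intro x hx
      refine ⟨hx.1, ?_⟩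
      rw [ENNReal.ofReal_lt_one]; linarith [hx.2]
    exact (ENNReal.ofReal_le_iff_le_toReal hne).1 hle
  have := key (I.toReal + 1) (by positivity)
  linarith

end UT

namespace UT

noncomputable def Dm (lam : Measure ℝ) (h : ℝ → ℝ≥0∞) (y : ℝ) : ℝ≥0∞ :=
  ∫⁻ s in Set.Iic y, (h s)⁻¹ ∂lam

noncomputable def Vm (lam : Measure ℝ) (h : ℝ → ℝ≥0∞) : ℝ≥0∞ :=
  ∫⁻ s, (h s)⁻¹ ∂lam

structure Side (lam : Measure ℝ) (h : ℝ → ℝ≥0∞) : Prop where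
  fin : IsFiniteMeasure lam
  noat : NullSingletonClass lam
  zero : lam (Set.Iic 0) = 0
  anti : Antitone h
  hfin : ∀ s, 0 < s → h s < ⊤
  hpos : ∀ᵐ s ∂lam, h s ≠ 0
  Dfin : ∀ y, Dm lam h y < ⊤

variable {lam : Measure ℝ} {h : ℝ → ℝ≥0∞}

theorem Side.hne (S : Side lam h) : ∀ᵐ s ∂lam, h s ≠ ⊤ := by
  have : ∀ᵐ s ∂lam, s ∉ Set.Iic (0:ℝ) := by
    exact measure_eq_zero_iff_ae_notMem.1 S.zero
  filter_upwards [this] with s hs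
  exact (S.hfin s (by simpa using hs)).ne

theorem Side.hmeas (S : Side lam h) : Measurable (fun s => (h s)⁻¹) :=
  S.anti.measurable.inv

noncomputable def nu (lam : Measure ℝ) (h : ℝ → ℝ≥0∞) : Measure ℝ :=
  lam.withDensity (fun s => (h s)⁻¹)

theorem nu_Iic (y : ℝ) : nu lam h (Set.Iic y) = Dm lam h y := by
  rw [nu, withDensity_apply _ measurableSet_Iic]; rfl

theorem nu_univ : nu lam h Set.univ = Vm lam h := by
  rw [nu, withDensity_apply _ MeasurableSet.univ, Measure.restrict_univ]; rfl

theorem Side.ac (S : Side lam h) : lam ≪ nu lam h := by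
  refine withDensity_absolutelyContinuous' S.hmeas.aemeasurable ?_
  filter_upwards [S.hne] with s hs
  simpa using hs

theorem Side.nu_noat (S : Side lam h) : NullSingletonClass (nu lam h) := by
  have := S.noat
  unfold nu; infer_instance

theorem Dm_mono : Monotone (Dm lam h) := by
  intro a b hab
  simp only [← nu_Iic]
  exact cdf_mono _ hab

theorem Side.nu0 (S : Side lam h) : nu lam h (Set.Iic 0) = 0 :=
  withDensity_absolutelyContinuous _ _ S.zero

theorem Side.nuinf (S : Side lam h) : nu lam h {s | nu lam h (Set.Iic s) = ⊤} = 0 := by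
  have : {s | nu lam h (Set.Iic s) = ⊤} = ∅ := by
    ext s; simp [nu_Iic, (S.Dfin s).ne]
  rw [this]; simp

theorem Side.D_eq_null (S : Side lam h) (c : ℝ≥0∞) : lam {s | Dm lam h s = c} = 0 := by
  have := S.nu_noat
  apply S.ac
  simpa only [nu_Iic] using cdf_eq_null (nu lam h) S.nu0 S.nuinf c

theorem Side.D_ae_ne (S : Side lam h) (c : ℝ≥0∞) : ∀ᵐ s ∂lam, Dm lam h s ≠ c := by
  rw [ae_iff]; simpa using S.D_eq_null c

theorem D_le_V (y : ℝ) : Dm lam h y ≤ Vm lam h := by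
  rw [← nu_Iic, ← nu_univ]; exact measure_mono (Set.subset_univ _)

theorem Side.D_ae_lt (S : Side lam h) : ∀ᵐ s ∂lam, Dm lam h s < Vm lam h := by
  filter_upwards [S.D_ae_ne (Vm lam h)] with s hs
  exact lt_of_le_of_ne (D_le_V s) hs

theorem V_eq_iSup : Vm lam h = ⨆ y, Dm lam h y := by
  simp only [← nu_Iic, ← nu_univ]
  exact tendsto_nhds_unique (tendsto_measure_Iic_atTop _) (tendsto_atTop_iSup (cdf_mono _))

theorem Side.push (S : Side lam h) (g : ℝ≥0∞ → ℝ≥0∞) (hg : Measurable g) :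
    ∫⁻ s, g (Dm lam h s) * (h s)⁻¹ ∂lam =
      ∫⁻ x in {x : ℝ | 0 < x ∧ ENNReal.ofReal x < Vm lam h}, g (ENNReal.ofReal x) := by
  have := S.nu_noat
  rw [← nu_univ, ← cdf_lintegral (nu lam h) S.nu0 S.nuinf g hg]
  simp only [nu_Iic]
  rw [nu, lintegral_withDensity_eq_lintegral_mul _ S.hmeas (show Measurable fun s => g (Dm lam h s) from hg.comp Dm_mono.measurable)]
  simp only [Pi.mul_apply, mul_comm]

noncomputable def Lam (H : ℝ≥0∞ → ℝ≥0∞) (c : ℝ≥0∞) : ℝ≥0∞ :=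
  ∫⁻ x in {x : ℝ | 0 < x ∧ ENNReal.ofReal x < c}, (H (ENNReal.ofReal x))⁻¹

structure HH (H : ℝ≥0∞ → ℝ≥0∞) (V : ℝ≥0∞) : Prop where
  anti : Antitone H
  pos : ∀ v, v < V → H v ≠ 0
  fin : ∀ v, H v ≠ ⊤
  top : Lam H V = ⊤

variable {H : ℝ≥0∞ → ℝ≥0∞} {V : ℝ≥0∞}

theorem Lam_mono : Monotone (Lam H) := by
  intro a b hab
  exact lintegral_mono_set fun x hx => ⟨hx.1, hx.2.trans_le hab⟩

theorem vol_cut (c : ℝ≥0∞) : volume {x : ℝ | 0 < x ∧ ENNReal.ofReal x < c} = c := by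
  by_cases hc : c = ⊤
  · have : {x : ℝ | 0 < x ∧ ENNReal.ofReal x < c} = Set.Ioi 0 := by
      ext x; simp [hc]
    rw [this, hc]; simp
  · have := vol_aux c c.toReal
    rw [ENNReal.ofReal_toReal hc, min_self] at this
    refine Eq.trans ?_ this
    congr 1
    ext x
    simp only [Set.mem_ofPred_eq, Set.mem_inter_iff, Set.mem_Iic]
    refine ⟨fun hx => ⟨hx, ((ENNReal.ofReal_lt_iff_lt_toReal hx.1.le hc).1 hx.2).le⟩, fun hx => hx.1⟩

theorem HH.Lam_fin (A : HH H V) (c : ℝ≥0∞) (hc : c < V) : Lam H c ≠ ⊤ := by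
  have : Lam H c ≤ ∫⁻ x in {x : ℝ | 0 < x ∧ ENNReal.ofReal x < c}, (H c)⁻¹ := by
    refine setLIntegral_mono measurable_const fun x hx => ?_
    exact ENNReal.inv_le_inv.2 (A.anti hx.2.le)
  refine ne_top_of_le_ne_top ?_ this
  rw [setLIntegral_const, vol_cut]
  exact ENNReal.mul_ne_top (by simpa using A.pos c hc) (ne_top_of_lt hc)

theorem HH.Hmeas (A : HH H V) : Measurable fun v => (H v)⁻¹ := A.anti.measurable.inv

theorem HH.Lam_strict (A : HH H V) (c c' : ℝ≥0∞) (hcc : c < c') (hc : c' ≤ V) :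
    Lam H c < Lam H c' := by
  have hcf := ne_top_of_lt hcc
  have hsub : {x : ℝ | 0 < x ∧ ENNReal.ofReal x < c} ⊆ {x : ℝ | 0 < x ∧ ENNReal.ofReal x < c'} :=
    fun x hx => ⟨hx.1, hx.2.trans hcc⟩
  have e : Lam H c' = Lam H c + ∫⁻ x in {x : ℝ | 0 < x ∧ ENNReal.ofReal x < c'} \
      {x : ℝ | 0 < x ∧ ENNReal.ofReal x < c}, (H (ENNReal.ofReal x))⁻¹ := by
    rw [Lam, Lam, ← lintegral_union ((meas_cut c').diff (meas_cut c)) Set.disjoint_sdiff_right,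
      Set.union_sdiff_cancel hsub]
  rw [e]
  refine ENNReal.lt_add_right (A.Lam_fin c (hcc.trans_le hc)) ?_
  refine (((setLIntegral_pos_iff (A.Hmeas.comp ENNReal.measurable_ofReal)).2 ?_)).ne'
  have : Function.support ((fun v => (H v)⁻¹) ∘ ENNReal.ofReal) = Set.univ := by
    ext x; simp [A.fin]
  rw [this, Set.univ_inter, measure_sdiff hsub (meas_cut c).nullMeasurableSet (by rwa [vol_cut]),
    vol_cut, vol_cut]
  exact tsub_pos_of_lt hcc

noncomputable def kd (lam : Measure ℝ) (h : ℝ → ℝ≥0∞) (H : ℝ≥0∞ → ℝ≥0∞) (s : ℝ) : ℝ≥0∞ :=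
  (h s * H (Dm lam h s))⁻¹

noncomputable def psi (lam : Measure ℝ) (h : ℝ → ℝ≥0∞) (H : ℝ≥0∞ → ℝ≥0∞) (y : ℝ) : ℝ≥0∞ :=
  ∫⁻ s in Set.Iic y, kd lam h H s ∂lam

noncomputable def kap (lam : Measure ℝ) (h : ℝ → ℝ≥0∞) (H : ℝ≥0∞ → ℝ≥0∞) : Measure ℝ :=
  lam.withDensity (kd lam h H)

theorem kap_Iic (y : ℝ) : kap lam h H (Set.Iic y) = psi lam h H y := by
  rw [kap, withDensity_apply _ measurableSet_Iic]; rfl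

theorem kd_meas (S : Side lam h) (A : HH H V) : Measurable (kd lam h H) :=
  (S.anti.measurable.mul (A.anti.measurable.comp Dm_mono.measurable)).inv

theorem kd_eq (S : Side lam h) (_A : HH H V) :
    ∀ᵐ s ∂lam, kd lam h H s = (H (Dm lam h s))⁻¹ * (h s)⁻¹ := by
  filter_upwards [S.hne, S.hpos] with s h1 h2
  rw [kd, ENNReal.mul_inv (Or.inl h2) (Or.inl h1), mul_comm]

theorem psi_eq (S : Side lam h) (A : HH H (Vm lam h)) (y : ℝ) :
    psi lam h H y = Lam H (Dm lam h y) := by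
  have hg : Measurable ((Set.Iio (Dm lam h y)).indicator fun v => (H v)⁻¹) :=
    A.Hmeas.indicator measurableSet_Iio
  have key := S.push _ hg
  have e1 : psi lam h H y = ∫⁻ s, (Set.Iio (Dm lam h y)).indicator (fun v => (H v)⁻¹) (Dm lam h s) * (h s)⁻¹ ∂lam := by
    rw [psi, ← lintegral_indicator measurableSet_Iic]
    apply lintegral_congr_ae
    filter_upwards [kd_eq S A, S.D_ae_ne (Dm lam h y)] with s h1 h2
    by_cases hs : s ≤ y
    · have : Dm lam h s < Dm lam h y := lt_of_le_of_ne (Dm_mono hs) h2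
      rw [Set.indicator_of_mem (by exact hs), Set.indicator_of_mem (by exact this), h1]
    · have : ¬ Dm lam h s < Dm lam h y := not_lt.2 (Dm_mono (not_le.1 hs).le)
      rw [Set.indicator_of_notMem (by exact hs), Set.indicator_of_notMem (by exact this), zero_mul]
  rw [e1, key, Lam, ← lintegral_indicator (meas_cut _), ← lintegral_indicator (meas_cut _)]
  congr 1
  ext x
  simp only [Set.indicator_apply, Set.mem_ofPred_eq, Set.mem_Iio]
  have := D_le_V (lam := lam) (h := h) y
  by_cases h1 : 0 < x ∧ ENNReal.ofReal x < Dm lam h y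
  · rw [if_pos ⟨h1.1, h1.2.trans_le this⟩, if_pos h1.2, if_pos h1]
  · rw [if_neg h1]
    split_ifs with h2 h3
    · exact absurd ⟨h2.1, h3⟩ h1
    · rfl
    · rfl

theorem kap_univ (S : Side lam h) (A : HH H (Vm lam h)) : kap lam h H Set.univ = ⊤ := by
  rw [kap, withDensity_apply _ MeasurableSet.univ, Measure.restrict_univ,
    lintegral_congr_ae (kd_eq S A), S.push _ A.Hmeas]
  exact A.top

theorem psi_lt_top (S : Side lam h) (A : HH H (Vm lam h)) : ∀ᵐ s ∂lam, psi lam h H s ≠ ⊤ := by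
  filter_upwards [S.D_ae_lt] with s hs
  rw [psi_eq S A]
  exact A.Lam_fin _ hs

theorem kap_ac : kap lam h H ≪ lam := withDensity_absolutelyContinuous _ _

theorem ac_kap (S : Side lam h) (A : HH H (Vm lam h)) : lam ≪ kap lam h H := by
  refine withDensity_absolutelyContinuous' (kd_meas S A).aemeasurable ?_
  filter_upwards [S.hne] with s hs
  simp only [kd, ne_eq, ENNReal.inv_eq_zero]
  exact ENNReal.mul_ne_top hs (A.fin _)

theorem kap_inf (S : Side lam h) (A : HH H (Vm lam h)) :
    kap lam h H {s | kap lam h H (Set.Iic s) = ⊤} = 0 := by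
  have : ∀ᵐ s ∂(kap lam h H), psi lam h H s ≠ ⊤ := (kap_ac (h := h) (H := H)).ae_le (psi_lt_top S A)
  rw [ae_iff] at this
  simpa [kap_Iic] using this

theorem kap_zero (S : Side lam h) : kap lam h H (Set.Iic 0) = 0 := kap_ac S.zero

theorem kap_noat (S : Side lam h) : NullSingletonClass (kap lam h H) := by
  have := S.noat
  unfold kap; infer_instance

theorem psi_eq_null (S : Side lam h) (A : HH H (Vm lam h)) (c : ℝ≥0∞) :
    ∀ᵐ s ∂lam, psi lam h H s ≠ c := by
  have := kap_noat (H := H) S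
  rw [ae_iff]
  apply ac_kap S A
  simpa [kap_Iic] using cdf_eq_null (kap lam h H) (kap_zero S) (kap_inf S A) c

theorem psi_mono : Monotone (psi lam h H) := by
  intro a b hab
  simp only [← kap_Iic]
  exact cdf_mono _ hab

/-- abstract version of `n([φ(l),∞))`. -/
noncomputable def NN (h : ℝ → ℝ≥0∞) (p : ℝ → ℝ≥0∞) (l : ℝ) : ℝ≥0∞ :=
  if {y : ℝ | 0 ≤ y ∧ ENNReal.ofReal l ≤ p y}.Nonempty then
    h (sInf {y : ℝ | 0 ≤ y ∧ ENNReal.ofReal l ≤ p y}) else 0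

theorem NN_anti (hh : Antitone h) (p : ℝ → ℝ≥0∞) : Antitone (NN h p) := by
  intro a b hab
  have hsub : {y : ℝ | 0 ≤ y ∧ ENNReal.ofReal b ≤ p y} ⊆ {y : ℝ | 0 ≤ y ∧ ENNReal.ofReal a ≤ p y} :=
    fun y hy => ⟨hy.1, (ENNReal.ofReal_le_ofReal hab).trans hy.2⟩
  unfold NN
  by_cases h1 : {y : ℝ | 0 ≤ y ∧ ENNReal.ofReal b ≤ p y}.Nonempty
  · rw [if_pos h1, if_pos (h1.mono hsub)]
    exact hh (csInf_le_csInf ⟨0, fun y hy => hy.1⟩ h1 hsub)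
  · rw [if_neg h1]; exact bot_le

theorem NN_psi (S : Side lam h) (A : HH H (Vm lam h)) :
    ∀ᵐ s ∂lam, NN h (psi lam h H) (psi lam h H s).toReal = h s := by
  have := kap_noat (H := H) S
  have h1 := (ac_kap S A).ae_le (cdf_strict (kap lam h H) (kap_zero S) (kap_inf S A))
  simp only [kap_Iic] at h1
  have : ∀ᵐ s ∂lam, s ∉ Set.Iic (0:ℝ) := by
    exact measure_eq_zero_iff_ae_notMem.1 S.zero
  filter_upwards [h1, psi_lt_top S A, this] with s hs hf h0
  have h0 : 0 < s := by simpa using h0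
  have hL : IsLeast {y : ℝ | 0 ≤ y ∧ ENNReal.ofReal (psi lam h H s).toReal ≤ psi lam h H y} s := by
    rw [ENNReal.ofReal_toReal hf]
    refine ⟨⟨h0.le, le_rfl⟩, fun y hy => ?_⟩
    by_contra hlt
    exact absurd (hs y (not_le.1 hlt)) (not_lt.2 hy.2)
  rw [NN, if_pos hL.nonempty, hL.csInf_eq]

theorem transfer (S : Side lam h) (A : HH H (Vm lam h)) (G : ℝ≥0∞ → ℝ≥0∞) (hG : Measurable G) :
    ∫⁻ l in Set.Ioi (0:ℝ), G (ENNReal.ofReal l) * NN h (psi lam h H) l =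
      ∫⁻ s, G (psi lam h H s) * (H (Dm lam h s))⁻¹ ∂lam := by
  have := kap_noat (H := H) S
  have hN : Measurable (NN h (psi lam h H)) := (NN_anti S.anti _).measurable
  have hg : Measurable (fun c : ℝ≥0∞ => G c * NN h (psi lam h H) c.toReal) :=
    hG.mul (hN.comp ENNReal.measurable_toReal)
  have key := cdf_lintegral (kap lam h H) (kap_zero S) (kap_inf S A) _ hg
  have e : {x : ℝ | 0 < x ∧ ENNReal.ofReal x < kap lam h H Set.univ} = Set.Ioi 0 := by
    ext x; simp [kap_univ S A]
  rw [e] at key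
  have e2 : ∫⁻ l in Set.Ioi (0:ℝ), G (ENNReal.ofReal l) * NN h (psi lam h H) l =
      ∫⁻ l in Set.Ioi (0:ℝ), G (ENNReal.ofReal l) * NN h (psi lam h H) (ENNReal.ofReal l).toReal := by
    refine setLIntegral_congr_fun measurableSet_Ioi fun l hl => ?_
    simp only [ENNReal.toReal_ofReal (le_of_lt hl)]
  rw [e2, ← key]
  simp only [kap_Iic]
  rw [kap, lintegral_withDensity_eq_lintegral_mul _ (kd_meas S A)
    (show Measurable fun s => G (psi lam h H s) * NN h (psi lam h H) (psi lam h H s).toReal from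
      hg.comp psi_mono.measurable)]
  apply lintegral_congr_ae
  filter_upwards [NN_psi S A, kd_eq S A, S.hne, S.hpos] with s h1 h2 h3 h4
  rw [Pi.mul_apply, h1, h2]
  calc (H (Dm lam h s))⁻¹ * (h s)⁻¹ * (G (psi lam h H s) * h s)
      = G (psi lam h H s) * (H (Dm lam h s))⁻¹ * ((h s)⁻¹ * h s) := by ring
    _ = _ := by rw [ENNReal.inv_mul_cancel h4 h3, mul_one]

end UT

namespace UT

noncomputable def Hf (l₁ : Measure ℝ) (h₁ : ℝ → ℝ≥0∞) (l₂ : Measure ℝ) (h₂ : ℝ → ℝ≥0∞)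
    (v : ℝ≥0∞) : ℝ≥0∞ :=
  l₁ {s | v < Dm l₁ h₁ s} + l₂ {s | v < Dm l₂ h₂ s}

noncomputable def mm (l₁ : Measure ℝ) (h₁ : ℝ → ℝ≥0∞) (l₂ : Measure ℝ) (h₂ : ℝ → ℝ≥0∞) :
    Measure ℝ :=
  l₁.map (fun s => (Dm l₁ h₁ s).toReal) + l₂.map (fun s => (Dm l₂ h₂ s).toReal)

variable {l₁ l₂ : Measure ℝ} {h₁ h₂ : ℝ → ℝ≥0∞}

theorem Dr_meas {l : Measure ℝ} {h : ℝ → ℝ≥0∞} : Measurable (fun s => (Dm l h s).toReal) :=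
  Dm_mono.measurable.ennreal_toReal

theorem D_small {l : Measure ℝ} {h : ℝ → ℝ≥0∞} (S : Side l h) (c : ℝ≥0∞) (hc : 0 < c) :
    ∃ s, 0 < s ∧ Dm l h s < c := by
  have := S.nu_noat
  by_contra hcon
  push Not at hcon
  obtain ⟨e, he, hec⟩ := exists_between hc
  have h1 := cdf_le (nu l h) S.nu0 S.nuinf e (ne_top_of_lt hec)
  have h2 : nu l h {s | nu l h (Set.Iic s) ≤ e} = 0 := by
    refine measure_mono_null (fun s hs => ?_) S.nu0
    by_contra hs0
    have := hcon s (not_le.1 hs0)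
    rw [← nu_Iic] at this
    exact absurd (hec.trans_le this) (not_lt.2 hs)
  rw [h2] at h1
  have h3 : e ≤ nu l h Set.univ := by
    have := hcon 1 one_pos
    rw [← nu_Iic] at this
    exact hec.le.trans (this.trans (measure_mono (Set.subset_univ _)))
  rw [min_eq_left h3] at h1
  exact he.ne h1

theorem D_tail_pos {l : Measure ℝ} {h : ℝ → ℝ≥0∞} (S : Side l h) (v : ℝ≥0∞) (hv : v < Vm l h) :
    l {s | v < Dm l h s} ≠ 0 := by
  intro h0
  have := S.nu_noat
  have h1 := cdf_le (nu l h) S.nu0 S.nuinf v (ne_top_of_lt hv)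
  rw [nu_univ, min_eq_left hv.le] at h1
  have h2 : nu l h {s | v < Dm l h s} = 0 := withDensity_absolutelyContinuous _ _ h0
  have h3 : nu l h Set.univ ≤ v + 0 := by
    rw [← h1, ← h2]
    refine (measure_mono ?_).trans (measure_union_le _ _)
    intro s _
    simp only [nu_Iic]
    exact le_or_gt (Dm l h s) v
  rw [nu_univ, add_zero] at h3
  exact absurd hv (not_lt.2 h3)

structure Two (l₁ : Measure ℝ) (h₁ : ℝ → ℝ≥0∞) (l₂ : Measure ℝ) (h₂ : ℝ → ℝ≥0∞) : Prop where
  S₁ : Side l₁ h₁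
  S₂ : Side l₂ h₂
  hV : Vm l₁ h₁ = Vm l₂ h₂
  hone : l₁ Set.univ + l₂ Set.univ = 1
  hV0 : 0 < Vm l₁ h₁

theorem Hf_anti : Antitone (Hf l₁ h₁ l₂ h₂) := by
  intro a b hab
  exact add_le_add (measure_mono fun s hs => lt_of_le_of_lt hab hs)
    (measure_mono fun s hs => lt_of_le_of_lt hab hs)

theorem Two.Hf_le (T : Two l₁ h₁ l₂ h₂) (v : ℝ≥0∞) : Hf l₁ h₁ l₂ h₂ v ≤ 1 := by
  rw [← T.hone]
  exact add_le_add (measure_mono (Set.subset_univ _)) (measure_mono (Set.subset_univ _))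

theorem map_Iic {l : Measure ℝ} {h : ℝ → ℝ≥0∞} (S : Side l h) (x : ℝ) (hx : 0 ≤ x) :
    l {s | ENNReal.ofReal x < Dm l h s} + l.map (fun s => (Dm l h s).toReal) (Set.Iic x)
      = l Set.univ := by
  rw [Measure.map_apply Dr_meas measurableSet_Iic]
  have e : (fun s => (Dm l h s).toReal) ⁻¹' Set.Iic x = {s | ENNReal.ofReal x < Dm l h s}ᶜ := by
    ext s
    simp only [Set.mem_preimage, Set.mem_Iic, Set.mem_compl_iff, Set.mem_ofPred_eq, not_lt]
    exact (ENNReal.le_ofReal_iff_toReal_le (S.Dfin s).ne hx).symm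
  rw [e]
  exact measure_add_measure_compl (measurableSet_lt measurable_const Dm_mono.measurable)

theorem map_univ {l : Measure ℝ} {h : ℝ → ℝ≥0∞} :
    l.map (fun s => (Dm l h s).toReal) Set.univ = l Set.univ := by
  rw [Measure.map_apply Dr_meas MeasurableSet.univ, Set.preimage_univ]

theorem Two.mm_univ (T : Two l₁ h₁ l₂ h₂) : mm l₁ h₁ l₂ h₂ Set.univ = 1 := by
  rw [mm, Measure.add_apply, map_univ, map_univ, T.hone]

theorem Two.Hf_eq (T : Two l₁ h₁ l₂ h₂) (x : ℝ) (hx : 0 ≤ x) :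
    Hf l₁ h₁ l₂ h₂ (ENNReal.ofReal x) = 1 - mm l₁ h₁ l₂ h₂ (Set.Iic x) := by
  have hle : mm l₁ h₁ l₂ h₂ (Set.Iic x) ≤ 1 := by
    rw [← T.mm_univ]; exact measure_mono (Set.subset_univ _)
  refine ENNReal.eq_sub_of_add_eq (ne_top_of_le_ne_top ENNReal.one_ne_top hle) ?_
  rw [← T.hone, ← map_Iic T.S₁ x hx, ← map_Iic T.S₂ x hx, Hf, mm, Measure.add_apply]
  ring

theorem map_pt {l : Measure ℝ} {h : ℝ → ℝ≥0∞} (S : Side l h) (x : ℝ) :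
    l.map (fun s => (Dm l h s).toReal) {x} = 0 := by
  rw [Measure.map_apply Dr_meas (measurableSet_singleton x)]
  refine measure_mono_null (fun s hs => ?_) (S.D_eq_null (ENNReal.ofReal x))
  have hs : (Dm l h s).toReal = x := hs
  show Dm l h s = ENNReal.ofReal x
  rw [← hs, ENNReal.ofReal_toReal (S.Dfin s).ne]

theorem map_neg {l : Measure ℝ} {h : ℝ → ℝ≥0∞} (S : Side l h) :
    l.map (fun s => (Dm l h s).toReal) (Set.Iic 0) = 0 := by
  rw [Measure.map_apply Dr_meas measurableSet_Iic]
  refine measure_mono_null (fun s hs => ?_) (S.D_eq_null 0)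
  have hs : (Dm l h s).toReal ≤ 0 := hs
  have := le_antisymm hs ENNReal.toReal_nonneg
  rw [ENNReal.toReal_eq_zero_iff] at this
  exact this.resolve_right (S.Dfin s).ne

theorem Two.mm_noat (T : Two l₁ h₁ l₂ h₂) : NullSingletonClass (mm l₁ h₁ l₂ h₂) :=
  ⟨fun x => by rw [mm, Measure.add_apply, map_pt T.S₁, map_pt T.S₂, add_zero]⟩

theorem Two.mm_zero (T : Two l₁ h₁ l₂ h₂) : mm l₁ h₁ l₂ h₂ (Set.Iic 0) = 0 := by
  rw [mm, Measure.add_apply, map_neg T.S₁, map_neg T.S₂, add_zero]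

theorem Two.mm_le (T : Two l₁ h₁ l₂ h₂) (s : Set ℝ) : mm l₁ h₁ l₂ h₂ s ≤ 1 := by
  rw [← T.mm_univ]; exact measure_mono (Set.subset_univ _)

theorem Two.mm_inf (T : Two l₁ h₁ l₂ h₂) :
    mm l₁ h₁ l₂ h₂ {s | mm l₁ h₁ l₂ h₂ (Set.Iic s) = ⊤} = 0 := by
  have : {s | mm l₁ h₁ l₂ h₂ (Set.Iic s) = ⊤} = ∅ := by
    ext s
    simp only [Set.mem_ofPred_eq, Set.mem_empty_iff_false, iff_false]
    exact ne_top_of_le_ne_top ENNReal.one_ne_top (T.mm_le _)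
  rw [this]; simp

theorem Two.J0 (T : Two l₁ h₁ l₂ h₂) (g : ℝ≥0∞ → ℝ≥0∞) (hg : Measurable g) :
    ∫⁻ t, g (Hf l₁ h₁ l₂ h₂ (Dm l₁ h₁ t)) ∂l₁ + ∫⁻ t, g (Hf l₁ h₁ l₂ h₂ (Dm l₂ h₂ t)) ∂l₂ =
      ∫⁻ u in {x : ℝ | 0 < x ∧ ENNReal.ofReal x < 1}, g (1 - ENNReal.ofReal u) := by
  have := T.mm_noat
  have hg2 : Measurable fun u : ℝ≥0∞ => g (1 - u) := hg.comp (measurable_const.sub measurable_id)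
  have key := cdf_lintegral _ T.mm_zero T.mm_inf _ hg2
  rw [T.mm_univ] at key
  rw [← key]
  have hm : Measurable fun x : ℝ => g (Hf l₁ h₁ l₂ h₂ (ENNReal.ofReal x)) :=
    hg.comp (Hf_anti.measurable.comp ENNReal.measurable_ofReal)
  have e : ∫⁻ s, g (1 - mm l₁ h₁ l₂ h₂ (Set.Iic s)) ∂(mm l₁ h₁ l₂ h₂) =
      ∫⁻ s, g (Hf l₁ h₁ l₂ h₂ (ENNReal.ofReal s)) ∂(mm l₁ h₁ l₂ h₂) := by
    apply lintegral_congr_ae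
    filter_upwards [measure_eq_zero_iff_ae_notMem.1 T.mm_zero] with s hs
    rw [T.Hf_eq s (not_le.1 hs).le]
  rw [e, mm, lintegral_add_measure, lintegral_map hm Dr_meas, lintegral_map hm Dr_meas]
  simp only [ENNReal.ofReal_toReal (T.S₁.Dfin _).ne, ENNReal.ofReal_toReal (T.S₂.Dfin _).ne]

theorem Two.Hf_ne (T : Two l₁ h₁ l₂ h₂) (c : ℝ≥0∞) :
    (∀ᵐ t ∂l₁, Hf l₁ h₁ l₂ h₂ (Dm l₁ h₁ t) ≠ c) ∧ (∀ᵐ t ∂l₂, Hf l₁ h₁ l₂ h₂ (Dm l₂ h₂ t) ≠ c) := by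
  have hg : Measurable (({c} : Set ℝ≥0∞).indicator (fun _ => (1 : ℝ≥0∞))) :=
    measurable_const.indicator (measurableSet_singleton c)
  have key := T.J0 _ hg
  have hz : ∫⁻ u in {x : ℝ | 0 < x ∧ ENNReal.ofReal x < 1},
      ({c} : Set ℝ≥0∞).indicator (fun _ => (1 : ℝ≥0∞)) (1 - ENNReal.ofReal u) = 0 := by
    rw [← lintegral_zero (μ := volume.restrict {x : ℝ | 0 < x ∧ ENNReal.ofReal x < 1})]
    apply lintegral_congr_ae
    have hne : ∀ᵐ u : ℝ ∂volume, u ≠ 1 - c.toReal := by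
      exact measure_eq_zero_iff_ae_notMem.1 (measure_singleton (μ := volume) (1 - c.toReal))
    filter_upwards [ae_restrict_mem (meas_cut 1), ae_restrict_of_ae hne] with u hu hu2
    rw [Set.indicator_of_notMem]
    intro hc
    have hc : 1 - ENNReal.ofReal u = c := hc
    apply hu2
    have h1 : u < 1 := by simpa using hu.2
    rw [← hc, ← ENNReal.ofReal_one, ← ENNReal.ofReal_sub _ hu.1.le,
      ENNReal.toReal_ofReal (by linarith)]
    ring
  rw [hz, add_eq_zero] at key
  have m1 : Measurable fun t => Hf l₁ h₁ l₂ h₂ (Dm l₁ h₁ t) := Hf_anti.measurable.comp Dm_mono.measurable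
  have m2 : Measurable fun t => Hf l₁ h₁ l₂ h₂ (Dm l₂ h₂ t) := Hf_anti.measurable.comp Dm_mono.measurable
  refine ⟨?_, ?_⟩
  · have := (lintegral_eq_zero_iff (hg.comp m1)).1 key.1
    filter_upwards [this] with t ht hc
    simp [hc] at ht
  · have := (lintegral_eq_zero_iff (hg.comp m2)).1 key.2
    filter_upwards [this] with t ht hc
    simp [hc] at ht

theorem Two.J (T : Two l₁ h₁ l₂ h₂) (v : ℝ≥0∞) (hv : v < Vm l₁ h₁) :
    ∫⁻ t, (Set.Iio v).indicator (fun w => (Hf l₁ h₁ l₂ h₂ w)⁻¹) (Dm l₁ h₁ t) ∂l₁ +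
    ∫⁻ t, (Set.Iio v).indicator (fun w => (Hf l₁ h₁ l₂ h₂ w)⁻¹) (Dm l₂ h₂ t) ∂l₂ =
      ENNReal.ofReal (- Real.log (Hf l₁ h₁ l₂ h₂ v).toReal) := by
  set c := Hf l₁ h₁ l₂ h₂ v with hc
  have hc1 : c ≤ 1 := T.Hf_le v
  have hcf : c ≠ ⊤ := ne_top_of_le_ne_top ENNReal.one_ne_top hc1
  have hc0 : c ≠ 0 := by
    intro h
    rw [hc, Hf, add_eq_zero] at h
    exact D_tail_pos T.S₁ v hv h.1
  have hcr : 0 < c.toReal := ENNReal.toReal_pos hc0 hcf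
  have hcr1 : c.toReal ≤ 1 := by
    simpa using ENNReal.toReal_mono ENNReal.one_ne_top hc1
  have hg : Measurable ((Set.Ioi c).indicator (fun w : ℝ≥0∞ => w⁻¹)) :=
    measurable_inv.indicator measurableSet_Ioi
  have key := T.J0 _ hg
  have pt : ∀ w, Hf l₁ h₁ l₂ h₂ w ≠ c → (Set.Iio v).indicator (fun w => (Hf l₁ h₁ l₂ h₂ w)⁻¹) w =
      (Set.Ioi c).indicator (fun w : ℝ≥0∞ => w⁻¹) (Hf l₁ h₁ l₂ h₂ w) := by
    intro w hw
    by_cases hwv : w < v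
    · have : c < Hf l₁ h₁ l₂ h₂ w := lt_of_le_of_ne (Hf_anti hwv.le) hw.symm
      rw [Set.indicator_of_mem (by exact hwv), Set.indicator_of_mem (by exact this)]
    · have : ¬ c < Hf l₁ h₁ l₂ h₂ w := not_lt.2 (Hf_anti (not_lt.1 hwv))
      rw [Set.indicator_of_notMem (by exact hwv), Set.indicator_of_notMem (by exact this)]
  have e1 : ∫⁻ t, (Set.Iio v).indicator (fun w => (Hf l₁ h₁ l₂ h₂ w)⁻¹) (Dm l₁ h₁ t) ∂l₁ =
      ∫⁻ t, (Set.Ioi c).indicator (fun w : ℝ≥0∞ => w⁻¹) (Hf l₁ h₁ l₂ h₂ (Dm l₁ h₁ t)) ∂l₁ := by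
    apply lintegral_congr_ae
    filter_upwards [(T.Hf_ne c).1] with t ht
    exact pt _ ht
  have e2 : ∫⁻ t, (Set.Iio v).indicator (fun w => (Hf l₁ h₁ l₂ h₂ w)⁻¹) (Dm l₂ h₂ t) ∂l₂ =
      ∫⁻ t, (Set.Ioi c).indicator (fun w : ℝ≥0∞ => w⁻¹) (Hf l₁ h₁ l₂ h₂ (Dm l₂ h₂ t)) ∂l₂ := by
    apply lintegral_congr_ae
    filter_upwards [(T.Hf_ne c).2] with t ht
    exact pt _ ht
  rw [e1, e2, key]
  have hl := log_int (1 - c.toReal) (by linarith) (by linarith)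
  rw [sub_sub_cancel] at hl
  rw [← hl, ← lintegral_indicator (meas_cut 1), ← lintegral_indicator measurableSet_Ioo]
  congr 1
  ext u
  simp only [Set.indicator_apply, Set.mem_ofPred_eq, Set.mem_Ioi, Set.mem_Ioo]
  have hiff : ∀ u : ℝ, 0 < u → (c < 1 - ENNReal.ofReal u ↔ u < 1 - c.toReal) := by
    intro u hu
    rw [← ENNReal.ofReal_one, ← ENNReal.ofReal_sub _ hu.le, ENNReal.lt_ofReal_iff_toReal_lt hcf]
    constructor <;> intro h <;> linarith
  by_cases h1 : 0 < u ∧ u < 1 - c.toReal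
  · rw [if_pos h1, if_pos ⟨h1.1, by rw [ENNReal.ofReal_lt_one]; linarith [h1.2]⟩,
      if_pos ((hiff u h1.1).2 h1.2)]
  · rw [if_neg h1]
    split_ifs with h2 h3
    · exact absurd ⟨h2.1, (hiff u h2.1).1 h3⟩ h1
    · rfl
    · rfl

theorem bound_side {l : Measure ℝ} {h : ℝ → ℝ≥0∞} (S : Side l h) {H : ℝ≥0∞ → ℝ≥0∞} (hH : Antitone H)
    (s₀ : ℝ) (C v₀ : ℝ≥0∞) (hC : h s₀ ≤ C) (hv : Dm l h s₀ ≤ v₀) :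
    ∫⁻ t, (H (Dm l h t))⁻¹ ∂l ≤ (H v₀)⁻¹ * l Set.univ + C * Lam H (Vm l h) := by
  have hHm : Measurable fun v => (H v)⁻¹ := hH.measurable.inv
  have e : Lam H (Vm l h) = ∫⁻ s, (H (Dm l h s))⁻¹ * (h s)⁻¹ ∂l := by
    rw [S.push _ hHm]; rfl
  rw [e, ← lintegral_const, ← lintegral_const_mul, ← lintegral_add_left measurable_const]
  · apply lintegral_mono_ae
    filter_upwards [S.hne, S.hpos] with t h1 h2
    by_cases ht : Dm l h t ≤ v₀
    · exact (ENNReal.inv_le_inv.2 (hH ht)).trans le_self_add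
    · have hst : s₀ ≤ t := by
        by_contra hlt
        exact ht ((Dm_mono (not_le.1 hlt).le).trans hv)
      have hhC : h t ≤ C := (S.anti hst).trans hC
      refine le_trans ?_ le_add_self
      calc (H (Dm l h t))⁻¹ = h t * ((H (Dm l h t))⁻¹ * (h t)⁻¹) := by
            rw [mul_comm, mul_assoc, ENNReal.inv_mul_cancel h2 h1, mul_one]
        _ ≤ _ := by gcongr
  · exact (hHm.comp Dm_mono.measurable).mul S.hmeas

theorem Two.hh (T : Two l₁ h₁ l₂ h₂) : HH (Hf l₁ h₁ l₂ h₂) (Vm l₁ h₁) where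
  anti := Hf_anti
  pos := by
    intro v hv h
    rw [Hf, add_eq_zero] at h
    exact D_tail_pos T.S₁ v hv h.1
  fin := fun v => ne_top_of_le_ne_top ENNReal.one_ne_top (T.Hf_le v)
  top := by
    have htop := (T.J0 _ measurable_inv).trans log_int_top
    obtain ⟨s1, hs1, hd1⟩ := D_small T.S₁ _ T.hV0
    obtain ⟨s2, hs2, hd2⟩ := D_small T.S₂ _ T.hV0
    have b1 := bound_side T.S₁ (Hf_anti (l₁ := l₁) (h₁ := h₁) (l₂ := l₂) (h₂ := h₂)) s1 _
      (max (Dm l₁ h₁ s1) (Dm l₂ h₂ s2)) le_rfl (le_max_left _ _)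
    have b2 := bound_side T.S₂ (Hf_anti (l₁ := l₁) (h₁ := h₁) (l₂ := l₂) (h₂ := h₂)) s2 _
      (max (Dm l₁ h₁ s1) (Dm l₂ h₂ s2)) le_rfl (le_max_right _ _)
    rw [← T.hV] at b2
    have hp : Hf l₁ h₁ l₂ h₂ (max (Dm l₁ h₁ s1) (Dm l₂ h₂ s2)) ≠ 0 := by
      intro h
      rw [Hf, add_eq_zero] at h
      exact D_tail_pos T.S₁ _ (max_lt hd1 hd2) h.1
    by_contra hne
    have := T.S₁.fin
    have := T.S₂.fin
    have b := add_le_add b1 b2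
    rw [htop, top_le_iff] at b
    refine absurd b ?_
    have f1 := (T.S₁.hfin s1 hs1).ne
    have f2 := (T.S₂.hfin s2 hs2).ne
    refine ENNReal.add_ne_top.2 ⟨ENNReal.add_ne_top.2 ⟨?_, ?_⟩, ENNReal.add_ne_top.2 ⟨?_, ?_⟩⟩
    · exact ENNReal.mul_ne_top (by simpa using hp) (measure_ne_top _ _)
    · exact ENNReal.mul_ne_top f1 hne
    · exact ENNReal.mul_ne_top (by simpa using hp) (measure_ne_top _ _)
    · exact ENNReal.mul_ne_top f2 hne

/-- the abstract cut integral -/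
noncomputable def cutA (N₁ N₂ : ℝ → ℝ≥0∞) (L : ℝ≥0∞) : ℝ≥0∞ :=
  ∫⁻ s in {s : ℝ | 0 < s ∧ ENNReal.ofReal s < L}, (N₂ s + N₁ s)

theorem cut_side {l : Measure ℝ} {h : ℝ → ℝ≥0∞} (S : Side l h) {H : ℝ≥0∞ → ℝ≥0∞}
    (A : HH H (Vm l h)) (v : ℝ≥0∞) (hv : v < Vm l h) :
    ∫⁻ s in {s : ℝ | 0 < s ∧ ENNReal.ofReal s < Lam H v}, NN h (psi l h H) s =
      ∫⁻ t, (Set.Iio v).indicator (fun w => (H w)⁻¹) (Dm l h t) ∂l := by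
  have key := transfer S A ((Set.Iio (Lam H v)).indicator fun _ => 1)
    (measurable_const.indicator measurableSet_Iio)
  have e1 : ∫⁻ s in {s : ℝ | 0 < s ∧ ENNReal.ofReal s < Lam H v}, NN h (psi l h H) s =
      ∫⁻ s in Set.Ioi (0:ℝ), (Set.Iio (Lam H v)).indicator (fun _ => 1) (ENNReal.ofReal s) *
        NN h (psi l h H) s := by
    rw [← lintegral_indicator (meas_cut _), ← lintegral_indicator measurableSet_Ioi]
    congr 1
    ext s
    by_cases h1 : 0 < s <;> by_cases h2 : ENNReal.ofReal s < Lam H v <;>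
      simp [Set.indicator_apply, h1, h2]
  rw [e1, key]
  congr 1
  ext t
  have hiff : psi l h H t < Lam H v ↔ Dm l h t < v := by
    rw [psi_eq S A]
    constructor
    · intro hlt
      by_contra hcon
      exact absurd hlt (not_lt.2 (Lam_mono (not_lt.1 hcon)))
    · intro hlt
      exact A.Lam_strict _ _ hlt hv.le
  by_cases h1 : Dm l h t < v
  · simp [Set.indicator_apply, h1, hiff.2 h1]
  · have := mt hiff.1 h1
    simp [Set.indicator_apply, h1, this]

theorem Two.cut_eq (T : Two l₁ h₁ l₂ h₂) (v : ℝ≥0∞) (hv : v < Vm l₁ h₁) :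
    cutA (NN h₁ (psi l₁ h₁ (Hf l₁ h₁ l₂ h₂))) (NN h₂ (psi l₂ h₂ (Hf l₁ h₁ l₂ h₂)))
      (Lam (Hf l₁ h₁ l₂ h₂) v) = ENNReal.ofReal (- Real.log (Hf l₁ h₁ l₂ h₂ v).toReal) := by
  have A1 := T.hh
  have A2 := T.hh
  rw [T.hV] at A2
  rw [cutA, lintegral_add_left (NN_anti T.S₂.anti _).measurable, cut_side T.S₁ A1 v hv,
    cut_side T.S₂ A2 v (by rwa [← T.hV]), add_comm]
  exact T.J v hv

theorem expNegE_anti : Antitone expNegE := by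
  intro a b hab
  unfold expNegE
  by_cases hb : b = ⊤
  · rw [if_pos hb]; split_ifs
    · rfl
    · positivity
  · have ha : a ≠ ⊤ := ne_top_of_le_ne_top hb hab
    rw [if_neg hb, if_neg ha]
    exact Real.exp_le_exp.2 (neg_le_neg (ENNReal.toReal_mono hb hab))

theorem Two.main (T : Two l₁ h₁ l₂ h₂) (y : ℝ) :
    ∫⁻ l in {l : ℝ | 0 ≤ l ∧ psi l₁ h₁ (Hf l₁ h₁ l₂ h₂) y ≤ ENNReal.ofReal l},
      NN h₁ (psi l₁ h₁ (Hf l₁ h₁ l₂ h₂)) l *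
        ENNReal.ofReal (expNegE (cutA (NN h₁ (psi l₁ h₁ (Hf l₁ h₁ l₂ h₂)))
          (NN h₂ (psi l₂ h₂ (Hf l₁ h₁ l₂ h₂))) (ENNReal.ofReal l))) = l₁ (Set.Ici y) := by
  have A := T.hh
  set H := Hf l₁ h₁ l₂ h₂ with hHdef
  set cut := cutA (NN h₁ (psi l₁ h₁ H)) (NN h₂ (psi l₂ h₂ H)) with hcut
  have hcm : Monotone cut := by
    intro a b hab
    exact lintegral_mono_set fun x hx => ⟨hx.1, hx.2.trans_le hab⟩
  have hR : Measurable fun c => ENNReal.ofReal (expNegE (cut c)) := by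
    have : Antitone fun c => ENNReal.ofReal (expNegE (cut c)) :=
      fun a b hab => ENNReal.ofReal_le_ofReal (expNegE_anti (hcm hab))
    exact this.measurable
  have key := transfer T.S₁ A
    ((Set.Ici (psi l₁ h₁ H y)).indicator fun c => ENNReal.ofReal (expNegE (cut c)))
    (hR.indicator measurableSet_Ici)
  have hms : MeasurableSet {l : ℝ | 0 ≤ l ∧ psi l₁ h₁ H y ≤ ENNReal.ofReal l} :=
    (measurableSet_le measurable_const measurable_id).inter
      (measurableSet_le measurable_const ENNReal.measurable_ofReal)
  have e1 : ∫⁻ l in {l : ℝ | 0 ≤ l ∧ psi l₁ h₁ H y ≤ ENNReal.ofReal l},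
      NN h₁ (psi l₁ h₁ H) l * ENNReal.ofReal (expNegE (cut (ENNReal.ofReal l))) =
      ∫⁻ l in Set.Ioi (0:ℝ), (Set.Ici (psi l₁ h₁ H y)).indicator
        (fun c => ENNReal.ofReal (expNegE (cut c))) (ENNReal.ofReal l) * NN h₁ (psi l₁ h₁ H) l := by
    rw [← lintegral_indicator hms, ← lintegral_indicator measurableSet_Ioi]
    apply lintegral_congr_ae
    have hne : ∀ᵐ u : ℝ ∂volume, u ∉ ({0} : Set ℝ) :=
      measure_eq_zero_iff_ae_notMem.1 (measure_singleton (μ := volume) (0:ℝ))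
    filter_upwards [hne] with s hs
    have hs : s ≠ 0 := hs
    have h0 : 0 ≤ s ↔ 0 < s := ⟨fun h => lt_of_le_of_ne h hs.symm, le_of_lt⟩
    by_cases h1 : 0 < s <;> by_cases h2 : psi l₁ h₁ H y ≤ ENNReal.ofReal s <;>
      simp [Set.indicator_apply, h0, h1, h2, mul_comm]
  rw [e1, key]
  have e2 : l₁ (Set.Ici y) = ∫⁻ s, (Set.Ici y).indicator (fun _ => 1) s ∂l₁ := by
    rw [lintegral_indicator measurableSet_Ici]; simp
  rw [e2]
  apply lintegral_congr_ae
  filter_upwards [psi_eq_null T.S₁ A (psi l₁ h₁ H y), T.S₁.D_ae_lt] with s hs hlt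
  have hH0 := A.pos _ hlt
  have hHf := A.fin (Dm l₁ h₁ s)
  have hval : ENNReal.ofReal (expNegE (cut (psi l₁ h₁ H s))) = H (Dm l₁ h₁ s) := by
    rw [psi_eq T.S₁ A, hcut, T.cut_eq _ hlt, expNegE, if_neg ENNReal.ofReal_ne_top]
    have hr : 0 < (H (Dm l₁ h₁ s)).toReal := ENNReal.toReal_pos hH0 hHf
    have hr1 : (H (Dm l₁ h₁ s)).toReal ≤ 1 := by
      simpa using ENNReal.toReal_mono ENNReal.one_ne_top (T.Hf_le (Dm l₁ h₁ s))
    rw [ENNReal.toReal_ofReal (by linarith [Real.log_nonpos hr.le hr1]), neg_neg,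
      Real.exp_log hr, ENNReal.ofReal_toReal hHf]
  have hiff : psi l₁ h₁ H y ≤ psi l₁ h₁ H s ↔ y ≤ s := by
    constructor
    · intro h
      by_contra hcon
      exact hs (le_antisymm (psi_mono (not_le.1 hcon).le) h)
    · exact fun h => psi_mono h
  by_cases h1 : y ≤ s
  · rw [Set.indicator_of_mem (by exact hiff.2 h1), Set.indicator_of_mem (by exact h1), hval,
      ENNReal.mul_inv_cancel hH0 hHf]
  · rw [Set.indicator_of_notMem (by exact mt hiff.1 h1), Set.indicator_of_notMem (by exact h1), zero_mul]

end UT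

theorem UT.ofReal_pq {p q : ℝ≥0∞} (hp : p ≠ ⊤) (hq : q ≠ ⊤) :
    ENNReal.ofReal (1 + p.toReal - ((1 : ℝ≥0∞).toReal - q.toReal)) = p + q := by
  have : 1 + p.toReal - ((1 : ℝ≥0∞).toReal - q.toReal) = (p + q).toReal := by
    rw [ENNReal.toReal_add hp hq, ENNReal.toReal_one]; ring
  rw [this, ENNReal.ofReal_toReal (ENNReal.add_ne_top.2 ⟨hp, hq⟩)]

namespace UT

theorem mkSide (μ : Measure ℝ) [IsFiniteMeasure μ] (hat : ∀ x, μ {x} = 0) (h : ℝ → ℝ≥0∞)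
    (hanti : Antitone h) (hfin : ∀ s, 0 < s → h s < ⊤) (hpos : ∀ s ∈ μ.support, 0 < h s) :
    Side (μ.restrict (Set.Ioi 0)) h where
  fin := inferInstance
  noat := by
    have : NullSingletonClass μ := ⟨hat⟩
    infer_instance
  zero := by
    rw [Measure.restrict_apply measurableSet_Iic]
    have : Set.Iic (0:ℝ) ∩ Set.Ioi 0 = ∅ := by
      ext x; simp
    rw [this]; simp
  anti := hanti
  hfin := hfin
  hpos := by
    have h1 : ∀ᵐ s ∂μ, s ∈ μ.support := by
      have := measure_eq_zero_iff_ae_notMem.1 (Measure.measure_compl_support (μ := μ))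
      filter_upwards [this] with s hs
      simpa using hs
    filter_upwards [ae_restrict_of_ae h1] with s hs
    exact (hpos s hs).ne'
  Dfin := by
    intro y
    have h1 : ∀ᵐ s ∂μ, s ∈ μ.support := by
      have := measure_eq_zero_iff_ae_notMem.1 (Measure.measure_compl_support (μ := μ))
      filter_upwards [this] with s hs
      simpa using hs
    have hb : ∃ C : ℝ≥0∞, C ≠ ⊤ ∧ ∀ s ∈ μ.support, 0 < s → s ≤ y → (h s)⁻¹ ≤ C := by
      by_cases hne : (μ.support ∩ Set.Icc 0 y).Nonempty
      · obtain ⟨b, hb⟩ := (isCompact_Icc.inter_left (Measure.isClosed_support (μ := μ))).exists_isGreatest hne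
        refine ⟨(h b)⁻¹, by simpa using (hpos b hb.1.1).ne', fun s hs h0 hy => ?_⟩
        exact ENNReal.inv_le_inv.2 (hanti (hb.2 ⟨hs, h0.le, hy⟩))
      · refine ⟨0, by simp, fun s hs h0 hy => ?_⟩
        exact absurd ⟨s, hs, h0.le, hy⟩ hne
    obtain ⟨C, hC, hb⟩ := hb
    have : Dm (μ.restrict (Set.Ioi 0)) h y ≤ ∫⁻ _ in Set.Iic y, C ∂(μ.restrict (Set.Ioi 0)) := by
      apply lintegral_mono_ae
      filter_upwards [ae_restrict_mem measurableSet_Iic, ae_restrict_of_ae (ae_restrict_of_ae h1),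
        ae_restrict_of_ae (ae_restrict_mem measurableSet_Ioi)] with s h1 h2 h3
      exact hb s h2 h3 h1
    refine this.trans_lt ?_
    rw [setLIntegral_const]
    exact ENNReal.mul_lt_top hC.lt_top (measure_lt_top _ _)

theorem Icc_eq (μ : Measure ℝ) (hat : ∀ x, μ {x} = 0) (f : ℝ → ℝ≥0∞) (y : ℝ) :
    ∫⁻ s in Set.Icc 0 y, f s ∂μ = ∫⁻ s in Set.Iic y, f s ∂(μ.restrict (Set.Ioi 0)) := by
  have : NullSingletonClass μ := ⟨hat⟩
  rw [Measure.restrict_restrict measurableSet_Iic]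
  have e : Set.Iic y ∩ Set.Ioi 0 = Set.Ioc 0 y := by
    ext x; simp [and_comm]
  rw [e]
  exact setLIntegral_congr Ioc_ae_eq_Icc.symm

theorem Icc_neg (μ : Measure ℝ) (f : ℝ → ℝ≥0∞) (x : ℝ) :
    ∫⁻ s in Set.Icc x 0, f s ∂μ = ∫⁻ s in Set.Icc 0 (-x), f (-s) ∂(μ.map Neg.neg) := by
  have he : MeasurableEmbedding (Neg.neg : ℝ → ℝ) := (MeasurableEquiv.neg ℝ).measurableEmbedding
  rw [he.restrict_map, he.lintegral_map]
  have e : (Neg.neg : ℝ → ℝ) ⁻¹' Set.Icc 0 (-x) = Set.Icc x 0 := by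
    ext s; simp [and_comm]
  rw [e]
  simp

theorem tail_eq {l : Measure ℝ} {h : ℝ → ℝ≥0∞} (S : Side l h) (s : ℝ) :
    l (Set.Ici s) = l {t | Dm l h s < Dm l h t} := by
  apply measure_congr
  filter_upwards [S.D_ae_ne (Dm l h s)] with t ht
  apply propext
  change s ≤ t ↔ Dm l h s < Dm l h t
  constructor
  · exact fun hst => lt_of_le_of_ne (Dm_mono hst) ht.symm
  · intro hlt
    by_contra hcon
    exact absurd hlt (not_lt.2 (Dm_mono (not_le.1 hcon).le))

section
variable (μ n : Measure ℝ)

noncomputable abbrev la : Measure ℝ := μ.restrict (Set.Ioi 0)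
noncomputable abbrev lb : Measure ℝ := (μ.map Neg.neg).restrict (Set.Ioi 0)
noncomputable abbrev ha : ℝ → ℝ≥0∞ := fun s => n (Set.Ici s)
noncomputable abbrev hb : ℝ → ℝ≥0∞ := fun s => n (Set.Iic (-s))

theorem map_at (hat : ∀ x : ℝ, μ {x} = 0) (x : ℝ) : (μ.map Neg.neg) {x} = 0 := by
  have he : MeasurableEmbedding (Neg.neg : ℝ → ℝ) := (MeasurableEquiv.neg ℝ).measurableEmbedding
  rw [he.map_apply]
  have : (Neg.neg : ℝ → ℝ) ⁻¹' {x} = {-x} := by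
    ext s; simp [neg_eq_iff_eq_neg]
  rw [this]; exact hat _

theorem Dmu_eq (hat : ∀ x : ℝ, μ {x} = 0) (y : ℝ) : Dmu μ n y = Dm (la μ) (ha n) y :=
  Icc_eq μ hat _ y

theorem Gmu_eq (hat : ∀ x : ℝ, μ {x} = 0) (x : ℝ) : Gmu μ n x = Dm (lb μ) (hb n) (-x) := by
  rw [Gmu, Icc_neg, Icc_eq _ (map_at μ hat)]
  rfl

theorem lb_apply (s : Set ℝ) (hs : MeasurableSet s) :
    lb μ s = μ {t | t < 0 ∧ -t ∈ s} := by
  have he : MeasurableEmbedding (Neg.neg : ℝ → ℝ) := (MeasurableEquiv.neg ℝ).measurableEmbedding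
  rw [lb, Measure.restrict_apply hs, he.map_apply]
  congr 1
  ext t
  simp [and_comm]

theorem mubarD [IsProbabilityMeasure μ] (hat : ∀ x : ℝ, μ {x} = 0) (v : ℝ≥0∞)
    (hv : v < Vm (la μ) (ha n)) :
    mubarDinv μ n v = (la μ {t | v < Dm (la μ) (ha n) t}).toReal := by
  have hne : (DinvSet μ n v).Nonempty := by
    rw [V_eq_iSup] at hv
    obtain ⟨y, hy⟩ := lt_iSup_iff.1 hv
    refine ⟨max y 0, le_max_right _ _, ?_⟩
    rw [Dmu_eq μ n hat]
    exact hy.trans_le (Dm_mono (le_max_left _ _))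
  rw [mubarDinv, if_pos hne]
  congr 1
  have hm : MeasurableSet {t | v < Dm (la μ) (ha n) t} :=
    measurableSet_lt measurable_const Dm_mono.measurable
  rw [la, Measure.restrict_apply hm]
  apply measure_congr
  set x0 := sInf (DinvSet μ n v) with hx0
  have hbd : BddBelow (DinvSet μ n v) := ⟨0, fun y hy => hy.1⟩
  filter_upwards [measure_eq_zero_iff_ae_notMem.1 (hat x0), measure_eq_zero_iff_ae_notMem.1 (hat 0)] with t ht ht0
  have ht : t ≠ x0 := ht
  have ht0 : t ≠ 0 := ht0
  apply propext
  change x0 ≤ t ↔ (v < Dm (la μ) (ha n) t ∧ 0 < t)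
  constructor
  · intro h
    have hlt : x0 < t := lt_of_le_of_ne h ht.symm
    obtain ⟨x, hx, hxt⟩ := exists_lt_of_csInf_lt hne hlt
    have hx2 := hx.2
    rw [Dmu_eq μ n hat] at hx2
    exact ⟨hx2.trans_le (Dm_mono hxt.le), hx.1.trans_lt hxt⟩
  · rintro ⟨h1, h2⟩
    refine csInf_le hbd ⟨h2.le, ?_⟩
    rw [Dmu_eq μ n hat]; exact h1

theorem mubarG [IsProbabilityMeasure μ] (hat : ∀ x : ℝ, μ {x} = 0) (v : ℝ≥0∞)
    (hv : v < Vm (lb μ) (hb n)) :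
    mubarGinv μ n v = 1 - (lb μ {t | v < Dm (lb μ) (hb n) t}).toReal := by
  have hne : (GinvSet μ n v).Nonempty := by
    rw [V_eq_iSup] at hv
    obtain ⟨y, hy⟩ := lt_iSup_iff.1 hv
    refine ⟨-(max y 0), by simp, ?_⟩
    rw [Gmu_eq μ n hat, neg_neg]
    exact hy.trans_le (Dm_mono (le_max_left _ _))
  rw [mubarGinv, if_pos hne]
  have hm : MeasurableSet {t | v < Dm (lb μ) (hb n) t} :=
    measurableSet_lt measurable_const Dm_mono.measurable
  set x0 := sSup (GinvSet μ n v) with hx0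
  have hbd : BddAbove (GinvSet μ n v) := ⟨0, fun y hy => hy.1⟩
  have e : lb μ {t | v < Dm (lb μ) (hb n) t} = μ (Set.Iio x0) := by
    rw [lb_apply μ _ hm]
    apply measure_congr
    filter_upwards [measure_eq_zero_iff_ae_notMem.1 (hat x0)] with t ht
    have ht : t ≠ x0 := ht
    apply propext
    change (t < 0 ∧ v < Dm (lb μ) (hb n) (-t)) ↔ t < x0
    rw [← Gmu_eq μ n hat]
    constructor
    · rintro ⟨h1, h2⟩
      exact lt_of_le_of_ne (le_csSup hbd ⟨h1.le, h2⟩) ht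
    · intro hlt
      obtain ⟨x, hx, hxt⟩ := exists_lt_of_lt_csSup hne hlt
      refine ⟨hxt.trans_le hx.1, hx.2.trans_le ?_⟩
      rw [Gmu_eq μ n hat, Gmu_eq μ n hat]
      exact Dm_mono (neg_le_neg hxt.le)
  rw [e, ← Set.compl_Iio]
  have := prob_compl_eq_one_sub (μ := μ) (measurableSet_Iio (a := x0))
  rw [this, ENNReal.toReal_sub_of_le prob_le_one ENNReal.one_ne_top]
  simp

end

section
variable {μ n : Measure ℝ} [IsProbabilityMeasure μ]

theorem psiP_eq (hat : ∀ x : ℝ, μ {x} = 0) (T : Two (la μ) (ha n) (lb μ) (hb n)) (y : ℝ) :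
    psiPlus μ n y = psi (la μ) (ha n) (Hf (la μ) (ha n) (lb μ) (hb n)) y := by
  rw [psiPlus, Icc_eq μ hat, psi]
  apply lintegral_congr_ae
  apply ae_restrict_of_ae
  filter_upwards [T.S₁.D_ae_lt, ae_restrict_mem measurableSet_Ioi] with s hs h0
  have h0 : 0 < s := h0
  rw [psiPlusIntegrand, kd, Dmu_eq μ n hat, mubarG μ n hat _ (by rwa [← T.hV])]
  have e : μ (Set.Ici s) = la μ (Set.Ici s) := by
    rw [la, Measure.restrict_apply measurableSet_Ici]
    congr 1
    ext t
    simp only [Set.mem_Ici, Set.mem_inter_iff, Set.mem_Ioi]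
    exact ⟨fun h => ⟨h, h0.trans_le h⟩, fun h => h.1⟩
  have := T.S₁.fin
  have := T.S₂.fin
  rw [e, tail_eq T.S₁, Hf, ← ENNReal.ofReal_toReal (measure_ne_top (la μ) _),
    ← ENNReal.ofReal_toReal (measure_ne_top (lb μ) _),
    ← ENNReal.ofReal_add ENNReal.toReal_nonneg ENNReal.toReal_nonneg]
  simp only [ENNReal.toReal_ofReal ENNReal.toReal_nonneg]
  congr 3
  ring

theorem psiM_eq (hat : ∀ x : ℝ, μ {x} = 0) (T : Two (la μ) (ha n) (lb μ) (hb n)) (z : ℝ) :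
    psiMinus μ n z = psi (lb μ) (hb n) (Hf (la μ) (ha n) (lb μ) (hb n)) z := by
  rw [psiMinus, Icc_neg, neg_neg, Icc_eq _ (map_at μ hat), psi]
  apply lintegral_congr_ae
  apply ae_restrict_of_ae
  filter_upwards [T.S₂.D_ae_lt, ae_restrict_mem measurableSet_Ioi] with s hs h0
  have h0 : 0 < s := h0
  rw [psiMinusIntegrand, kd, Gmu_eq μ n hat, neg_neg, mubarD μ n hat _ (by rwa [T.hV])]
  have e : μ (Set.Ici (-s)) = 1 - lb μ (Set.Ici s) := by
    have e1 : lb μ (Set.Ici s) = μ (Set.Iic (-s)) := by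
      rw [lb_apply μ _ measurableSet_Ici]
      congr 1
      ext t
      simp only [Set.mem_Ici, Set.mem_ofPred_eq, Set.mem_Iic]
      exact ⟨fun h => by linarith [h.2], fun h => ⟨by linarith, by linarith⟩⟩
    have : NullSingletonClass μ := ⟨hat⟩
    rw [e1, ← measure_congr (Iio_ae_eq_Iic (μ := μ) (a := -s)), ← Set.compl_Iio]
    exact prob_compl_eq_one_sub (measurableSet_Iio)
  have hle : lb μ {t | Dm (lb μ) (hb n) s < Dm (lb μ) (hb n) t} ≤ 1 := by
    refine (measure_mono (Set.subset_univ _)).trans ?_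
    rw [← T.hone]; exact le_add_self
  have := T.S₁.fin
  have := T.S₂.fin
  rw [e, tail_eq T.S₂, Hf, ENNReal.toReal_sub_of_le hle ENNReal.one_ne_top]
  have hb' : hb n s = n (Set.Iic (-s)) := rfl
  rw [ofReal_pq (measure_ne_top (la μ) _) (measure_ne_top (lb μ) _), hb']
  first | done | rfl | (rw [add_comm])

end

theorem mkTwo (μ n : Measure ℝ) [IsProbabilityMeasure μ]
    (hatomless : ∀ x : ℝ, μ {x} = 0)
    (hpos : 0 < μ (Set.Ioi (0 : ℝ)))
    (hnfin : ∀ s : ℝ, 0 < s → n (Set.Ici s) < ⊤ ∧ n (Set.Iic (-s)) < ⊤)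
    (hnsupp : ∀ x ∈ measSupport μ, 0 < n (Set.Iic x) ∧ 0 < n (Set.Ici x))
    (hcompat : (⨆ y : ℝ, Dmu μ n y) = (⨆ x : ℝ, Gmu μ n x)) :
    Two (la μ) (ha n) (lb μ) (hb n) := by
  have hsup : ∀ x ∈ μ.support, x ∈ measSupport μ := by
    intro x hx U hU hxU
    exact (Measure.mem_support_iff_forall x).1 hx U (hU.mem_nhds hxU)
  have he : MeasurableEmbedding (Neg.neg : ℝ → ℝ) := (MeasurableEquiv.neg ℝ).measurableEmbedding
  have hsup2 : ∀ x ∈ (μ.map Neg.neg).support, -x ∈ measSupport μ := by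
    intro x hx U hU hxU
    have := (Measure.mem_support_iff_forall x).1 hx (Neg.neg ⁻¹' U)
      ((hU.preimage continuous_neg).mem_nhds hxU)
    rw [he.map_apply] at this
    simpa using this
  have hprob : IsProbabilityMeasure (μ.map Neg.neg) :=
    Measure.isProbabilityMeasure_map measurable_neg.aemeasurable
  have S1 : Side (la μ) (ha n) := mkSide μ hatomless _
    (fun a b hab => measure_mono (Set.Ici_subset_Ici.2 hab)) (fun s hs => (hnfin s hs).1)
    (fun s hs => (hnsupp s (hsup s hs)).2)
  have S2 : Side (lb μ) (hb n) := mkSide _ (map_at μ hatomless) _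
    (fun a b hab => measure_mono (Set.Iic_subset_Iic.2 (neg_le_neg hab))) (fun s hs => (hnfin s hs).2)
    (fun s hs => (hnsupp _ (hsup2 s hs)).1)
  refine ⟨S1, S2, ?_, ?_, ?_⟩
  · rw [V_eq_iSup, V_eq_iSup]
    simp only [Dmu_eq μ n hatomless, Gmu_eq μ n hatomless] at hcompat
    rw [hcompat]
    exact neg_surjective.iSup_comp (Dm (lb μ) (hb n))
  · rw [lb_apply μ _ MeasurableSet.univ, la, Measure.restrict_apply MeasurableSet.univ, Set.univ_inter]
    have e : {t : ℝ | t < 0 ∧ -t ∈ (Set.univ : Set ℝ)} = Set.Iio 0 := by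
      ext t; simp
    have : NullSingletonClass μ := ⟨hatomless⟩
    rw [e, measure_congr (Iio_ae_eq_Iic (μ := μ) (a := 0)), ← Set.compl_Iic, add_comm,
      measure_add_measure_compl measurableSet_Iic, measure_univ]
  · rw [pos_iff_ne_zero]
    intro h0
    rw [← nu_univ] at h0
    have := S1.ac h0
    rw [la, Measure.restrict_apply MeasurableSet.univ, Set.univ_inter] at this
    exact hpos.ne' this

end UT

theorem upperTailIdentity
    (μ n : MeasureTheory.Measure ℝ) [MeasureTheory.IsProbabilityMeasure μ]
    (hatomless : ∀ x : ℝ, μ {x} = 0)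
    (hneg : 0 < μ (Set.Iio (0 : ℝ))) (hpos : 0 < μ (Set.Ioi (0 : ℝ)))
    (hnfin : ∀ s : ℝ, 0 < s → n (Set.Ici s) < ⊤ ∧ n (Set.Iic (-s)) < ⊤)
    (hnsupp : ∀ x ∈ measSupport μ, 0 < n (Set.Iic x) ∧ 0 < n (Set.Ici x))
    (hcompat : (⨆ y : ℝ, Dmu μ n y) = (⨆ x : ℝ, Gmu μ n x))
    :
    ∀ y : ℝ, 0 < y →
      μ (Set.Ici y) =
        ∫⁻ l in {l : ℝ | 0 ≤ l ∧ psiPlus μ n y ≤ ENNReal.ofReal l},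
          nPhiPlus μ n l * rho μ n l := by
  intro y hy
  have T := UT.mkTwo μ n hatomless hpos hnfin hnsupp hcompat
  have hP : psiPlus μ n = UT.psi (UT.la μ) (UT.ha n) (UT.Hf (UT.la μ) (UT.ha n) (UT.lb μ) (UT.hb n)) :=
    funext (UT.psiP_eq hatomless T)
  have hM : psiMinus μ n = UT.psi (UT.lb μ) (UT.hb n) (UT.Hf (UT.la μ) (UT.ha n) (UT.lb μ) (UT.hb n)) :=
    funext (UT.psiM_eq hatomless T)
  have hN1 : nPhiPlus μ n = UT.NN (UT.ha n) (psiPlus μ n) := rfl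
  have hN2 : nPhiMinus μ n = UT.NN (UT.hb n) (psiMinus μ n) := rfl
  have hc : cutInt μ n = UT.cutA (nPhiPlus μ n) (nPhiMinus μ n) := rfl
  have key := T.main y
  rw [← hP, ← hM, ← hN1, ← hN2, ← hc] at key
  refine Eq.trans ?_ key.symm
  rw [UT.la, Measure.restrict_apply measurableSet_Ici]
  congr 1
  ext t
  simp only [Set.mem_Ici, Set.mem_inter_iff, Set.mem_Ioi]
  exact ⟨fun h => ⟨h, hy.trans_le h⟩, fun h => h.1⟩
end
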